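/- Auxiliary partition and Whitney-type covering associated to a jump set (Theorem 4.4). There is a universal constant θ₀ > 0 with the following property. Let θ = 2^{−n} ≤ θ₀ for some n ∈ ℕ, μ > 0 and r ∈ (0, 1/8). There is a constant C = C(θ,r) > 0 such that for every set J ⊆ Q_μ which is a finite union of closed line segments and satisfies μθ² ≤ H¹(J) ≤ 2√2·μ·θ^{−2}, there exist: a finite partition (P'_j)_{j=1}^m of Q_μ into pairwise disjoint open simply connected sets covering Q_μ up to a Lebesgue-null set, with H¹(⋃_{j=1}^m ∂P'_j) ≤ C·H¹(J) and ⋃_{j=1}^m ∂P'_j a finite union of closed segments; a family 𝒞 ⊆ ⋃_{i≥8} 𝒬^i of pairwise disjoint dyadic squares; a closed set Z ⊆ Q_μ; and an index I ∈ ℕ with Z ⊆ ⋃_{i=8}^I U_i, such that, writing 𝒞^i = 𝒞 ∩ 𝒬^i: (i) Q_μ \ (J ∩ ⋃_{j=1}^m ∂P'_j) ⊆ ⋃_{Q∈𝒞} Q' ⊆ Q_μ; (ii) if Q₁, Q₂ ∈ 𝒞 and Q₁' ∩ Q₂' ≠ ∅ then θ·d(Q₁) ≤ d(Q₂) ≤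 θ^{−1}·d(Q₁); (iii) every x ∈ Q_μ lies in at most 12 of the enlarged squares Q', Q ∈ 𝒞; (iv) H¹(J ∩ Q') ≤ θ²·s_i for every Q ∈ 𝒞^i with Q'' ⊄ Z; (v) H¹(J ∩ Q') ≤ θ²·s_i for every Q ∈ 𝒞^i such that Q'' ∩ Q̂'' ≠ ∅ for some Q̂ ∈ 𝒞^{i−1} ∪ 𝒞^{i+1}; (vi) J ∩ ⋃_{i≥I+1} ⋃_{Q∈𝒞^i} Q' = ∅. -/

import Mathlib

open MeasureTheory Set
open scoped ENNReal NNReal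

noncomputable section

/-- The Euclidean plane. -/
abbrev E2 := EuclideanSpace ℝ (Fin 2)

/-- The open square `Q_μ = (-μ, μ)²`. -/
def Qsq (μ : ℝ) : Set E2 := {x | ∀ i : Fin 2, |x i| < μ}

/-- `Γ` is a finite union of closed line segments. -/
def FinSegUnion (Γ : Set E2) : Prop :=
  ∃ (n : ℕ) (a b : Fin n → E2), Γ = ⋃ i : Fin n, segment ℝ (a i) (b i)

/-- A dyadic square of the grid `𝒬^i` (for given parameters `θ, μ`):
it is encoded by its scale index `i` and its integer position `k`. -/
structure DSq where
  idx : ℕ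
  pos : Fin 2 → ℤ

namespace DSq

/-- The half-sidelength `s_i = μ θ^i` of a square of `𝒬^i`. -/
def sc (θ μ : ℝ) (Q : DSq) : ℝ := μ * θ ^ Q.idx

/-- The center `p ∈ s(1,1) + 2sℤ²` of the square. -/
def ctr (θ μ : ℝ) (Q : DSq) (j : Fin 2) : ℝ := Q.sc θ μ + 2 * Q.sc θ μ * (Q.pos j : ℝ)

/-- The open square `Q = p + s(-1,1)²` itself. -/
def core (θ μ : ℝ) (Q : DSq) : Set E2 :=
  {x | ∀ j : Fin 2, |x j - Q.ctr θ μ j| < Q.sc θ μ}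

/-- The concentric enlarged square with `lam` times the sidelength
(`lam = 3/2` gives `Q'`, `lam = 3` gives `Q''`, `lam = 5` gives `Q'''`). -/
def enl (θ μ lam : ℝ) (Q : DSq) : Set E2 :=
  {x | ∀ j : Fin 2, |x j - Q.ctr θ μ j| < lam * Q.sc θ μ}

end DSq

/-- The set of bad squares at scale `i` relative to a set `S`:
those with `H¹(S ∩ Q') ≥ θ³ s_i`. -/
def badSq (θ μ : ℝ) (S : Set E2) (i : ℕ) : Set DSq :=
  {Q | Q.idx = i ∧ ENNReal.ofReal (θ ^ 3 * (μ * θ ^ i)) ≤ μH[1] (S ∩ Q.enl θ μ (3 / 2))}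

/-- `J₀`: the union of the boundaries of the squares of `𝒬^7` contained in `Q_μ`. -/
def J0 (θ μ : ℝ) : Set E2 :=
  ⋃ Q ∈ {Q : DSq | Q.idx = 7 ∧ Q.core θ μ ⊆ Qsq μ}, frontier (Q.core θ μ)

/-- The auxiliary jump set `J* = J ∪ J₀`. -/
def Jstar (θ μ : ℝ) (J : Set E2) : Set E2 := J ∪ J0 θ μ

/-- The set `B^i`: the union of the closed enlarged squares `Q'''` over the
bad squares at scale `i` (with respect to `J*`). -/
def Bset (θ μ : ℝ) (J : Set E2) (i : ℕ) : Set E2 :=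
  ⋃ Q ∈ badSq θ μ (Jstar θ μ J) i, closure (Q.enl θ μ 5)

/-- The saturation of a set: `ℝ²` minus the unbounded connected components of the
complement ("fill the holes"). -/
def sat (A : Set E2) : Set E2 :=
  A ∪ {x | Bornology.IsBounded (connectedComponentIn Aᶜ x)}

/-- `U_i`: the saturation of the union of the isolated components of `B^i`,
i.e. of those connected components `B^i_k` with `d(B^i_k) ≤ θ^{-i r} s_i`. -/
def isoU (θ μ : ℝ) (J : Set E2) (r : ℝ) (i : ℕ) : Set E2 :=
  sat (⋃ x ∈ {x | x ∈ Bset θ μ J i ∧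
        Metric.diam (connectedComponentIn (Bset θ μ J i) x) ≤
          θ ^ (-((i : ℝ) * r)) * (μ * θ ^ i)},
    connectedComponentIn (Bset θ μ J i) x)

theorem contractibleSpace_of_deformation {X : Type*} [TopologicalSpace X] {U V : Set X}
    (hVU : V ⊆ U) [ContractibleSpace U] (f : X → X) (hf : ContinuousOn f U) (hfV : MapsTo f U V)
    (H : ℝ × X → X) (hH : ContinuousOn H (Icc 0 1 ×ˢ V))
    (hHV : MapsTo H (Icc 0 1 ×ˢ V) V) (h0 : ∀ p ∈ V, H (0, p) = p)
    (h1 : ∀ p ∈ V, H (1, p) = f p) : ContractibleSpace V := by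
  rw [contractible_iff_id_nullhomotopic]
  let F : C(U, V) := ⟨hfV.restrict f U V, hf.mapsToRestrict hfV⟩
  let i : C(V, U) := ⟨inclusion hVU, continuous_inclusion hVU⟩
  have hn : (F.comp i).Nullhomotopic := by
    have h2 := ((id_nullhomotopic U).comp_right F).comp_left i
    simpa using h2
  obtain ⟨y, hy⟩ := hn
  refine ⟨y, ContinuousMap.Homotopic.trans ?_ hy⟩
  refine ⟨{ toFun := fun q => ⟨H ((q.1 : ℝ), (q.2 : X)), hHV ⟨q.1.2, q.2.2⟩⟩
            continuous_toFun := ?_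
            map_zero_left := ?_
            map_one_left := ?_ }⟩
  · refine Continuous.subtype_mk ?_ _
    exact hH.comp_continuous (by fun_prop) (fun q => ⟨q.1.2, q.2.2⟩)
  · intro p
    ext
    simpa using h0 p p.2
  · intro p
    ext
    exact h1 p p.2

/-- An explicit Urysohn function. -/
theorem exists_urysohn_cutoff {X : Type*} [MetricSpace X] {U S W : Set X} (hS : IsClosed S)
    (hSn : S.Nonempty) (hW : IsOpen W) (hWn : Wᶜ.Nonempty) (hUS : U ∩ S ⊆ W) :
    ∃ l : X → ℝ, ContinuousOn l U ∧ (∀ p, 0 ≤ l p) ∧ (∀ p, l p ≤ 1) ∧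
      (∀ p ∈ U ∩ S, l p = 1) ∧ ∀ p ∉ W, l p = 0 := by
  refine ⟨fun p => Metric.infDist p Wᶜ / (Metric.infDist p Wᶜ + Metric.infDist p S),
    ?_, ?_, ?_, ?_, ?_⟩
  · have h1 := Metric.continuous_infDist_pt Wᶜ
    have h2 := Metric.continuous_infDist_pt S
    refine ContinuousOn.div h1.continuousOn (h1.add h2).continuousOn ?_
    intro p hp h
    have a1 : 0 ≤ Metric.infDist p Wᶜ := Metric.infDist_nonneg
    have a2 : 0 ≤ Metric.infDist p S := Metric.infDist_nonneg
    have b2 : p ∈ S := (hS.mem_iff_infDist_zero hSn).2 (by linarith)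
    have b1 : p ∈ Wᶜ := (hW.isClosed_compl.mem_iff_infDist_zero hWn).2 (by linarith)
    exact b1 (hUS ⟨hp, b2⟩)
  · intro p
    have a1 : 0 ≤ Metric.infDist p Wᶜ := Metric.infDist_nonneg
    have a2 : 0 ≤ Metric.infDist p S := Metric.infDist_nonneg
    positivity
  · intro p
    have a1 : 0 ≤ Metric.infDist p Wᶜ := Metric.infDist_nonneg
    have a2 : 0 ≤ Metric.infDist p S := Metric.infDist_nonneg
    exact div_le_one_of_le₀ (by linarith) (by linarith)
  · rintro p ⟨hp, hpS⟩
    have h2 : Metric.infDist p S = 0 := (hS.mem_iff_infDist_zero hSn).1 hpS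
    have h1 : Metric.infDist p Wᶜ ≠ 0 := fun h =>
      (hW.isClosed_compl.mem_iff_infDist_zero hWn).2 h (hUS ⟨hp, hpS⟩)
    simp [h2, h1]
  · intro p hp
    have : Metric.infDist p Wᶜ = 0 := (hW.isClosed_compl.mem_iff_infDist_zero hWn).1 hp
    simp [this]

theorem isOpen_setOf_forall_mem_Icc {X Y : Type*} [TopologicalSpace X] [TopologicalSpace Y]
    {U : Set Y} (hU : IsOpen U) {q : X × ℝ → Y} (hq : Continuous q) :
    IsOpen {p | ∀ t ∈ Icc (0 : ℝ) 1, q (p, t) ∈ U} := by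
  rw [isOpen_iff_mem_nhds]
  intro p hp
  have := isCompact_Icc.eventually_forall_of_forall_eventually (x₀ := p) (K := Icc (0 : ℝ) 1)
    (P := fun p t => q (p, t) ∈ U)
    (fun t ht => hq.continuousAt.preimage_mem_nhds (hU.mem_nhds (hp t ht)))
  exact this

theorem contractibleSpace_diff_slit {U : Set (ℝ × ℝ)} (hU : IsOpen U) [ContractibleSpace U]
    (h0 : ((0 : ℝ), (0 : ℝ)) ∉ U) (hs : Ioc (0 : ℝ) 1 ×ˢ {(0 : ℝ)} ⊆ U) :
    ContractibleSpace ↥(U \ Ioc (0 : ℝ) 1 ×ˢ {(0 : ℝ)}) := by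
  obtain ⟨b, hb1, hb⟩ : ∃ b > 1, ∀ x ∈ Icc (1 : ℝ) b, ((x, 0) : ℝ × ℝ) ∈ U := by
    have h1 : ((1, 0) : ℝ × ℝ) ∈ U := hs (by simp)
    obtain ⟨ε, hε, hball⟩ := Metric.isOpen_iff.1 hU _ h1
    refine ⟨1 + ε / 2, by linarith, fun x hx => hball ?_⟩
    rw [Metric.mem_ball, Prod.dist_eq]
    simp only [dist_self, Real.dist_eq]
    rw [abs_of_nonneg (by linarith [hx.1]), max_eq_left (by linarith [hx.1])]
    linarith [hx.2]
  set q : (ℝ × ℝ) × ℝ → ℝ × ℝ := fun z => (z.1.1 + z.2 * max (b - z.1.1) 0, z.1.2) with hq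
  have hqc : Continuous q := by fun_prop
  set W := {p | ∀ t ∈ Icc (0 : ℝ) 1, q (p, t) ∈ U} with hW
  have hWo : IsOpen W := isOpen_setOf_forall_mem_Icc hU hqc
  have h00 : ((0 : ℝ), (0 : ℝ)) ∉ W := fun h => h0 (by simpa [hq] using h 0 (by simp))
  have hUS : U ∩ Icc (0 : ℝ) 1 ×ˢ {(0 : ℝ)} ⊆ W := by
    rintro ⟨x, y⟩ ⟨hpU, ⟨hx, hy⟩⟩ t ht
    simp only [mem_singleton_iff] at hx hy
    subst hy
    have hx0 : 0 < x := lt_of_le_of_ne hx.1 (fun h => h0 (by rw [← h] at hpU; exact hpU))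
    have hm : max (b - x) 0 = b - x := max_eq_left (by linarith [hx.2])
    simp only [hq, hm]
    have h1 : 0 < x + t * (b - x) := by nlinarith [ht.1, hx.2]
    have h2 : x + t * (b - x) ≤ b := by nlinarith [ht.1, ht.2, hx.2]
    rcases le_total (x + t * (b - x)) 1 with h | h
    · exact hs ⟨⟨h1, h⟩, rfl⟩
    · exact hb _ ⟨h, h2⟩
  obtain ⟨l, hlc, hl0, hl1, hlS, hlW⟩ := exists_urysohn_cutoff (U := U)
    (isClosed_Icc.prod isClosed_singleton) ⟨((0 : ℝ), (0 : ℝ)), by simp⟩ hWo ⟨_, h00⟩ hUS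
  have hqU : ∀ p ∈ U, ∀ s ∈ Icc (0 : ℝ) 1, q (p, s * l p) ∈ U := by
    intro p hp s hs
    by_cases h : p ∈ W
    · exact h _ ⟨mul_nonneg hs.1 (hl0 p), mul_le_one₀ hs.2 (hl0 p) (hl1 p)⟩
    · simpa [hlW p h, hq] using hp
  have hneg : ∀ x ≤ 0, ((x, 0) : ℝ × ℝ) ∉ W := by
    intro x hx h
    have hbx : 0 < b - x := by linarith
    have := h (-x / (b - x)) ⟨div_nonneg (by linarith) hbx.le,
      div_le_one_of_le₀ (by linarith) hbx.le⟩
    simp only [hq, max_eq_left hbx.le, div_mul_cancel₀ _ hbx.ne'] at this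
    exact h0 (by simpa using this)
  have hkey : ∀ p ∈ U, ∀ s ∈ Icc (0 : ℝ) 1, (p ∉ Ioc (0 : ℝ) 1 ×ˢ {(0 : ℝ)} ∨ s = 1) →
      q (p, s * l p) ∉ Ioc (0 : ℝ) 1 ×ˢ {(0 : ℝ)} := by
    rintro ⟨x, y⟩ hp s hs1 hor ⟨hx, hy⟩
    simp only [hq, mem_singleton_iff] at hx hy
    subst hy
    rcases le_or_gt x 0 with h | h
    · rw [hlW _ (hneg x h)] at hx
      simp only [mul_zero, zero_mul, add_zero] at hx
      linarith [hx.1]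
    · have hnn : 0 ≤ s * l (x, 0) * max (b - x) 0 :=
        mul_nonneg (mul_nonneg hs1.1 (hl0 _)) (le_max_right _ _)
      have hx1 : x ≤ 1 := by linarith [hx.2]
      rcases hor with hn | rfl
      · exact hn ⟨⟨h, hx1⟩, rfl⟩
      · rw [hlS _ ⟨hp, ⟨⟨h.le, hx1⟩, rfl⟩⟩, max_eq_left (by linarith)] at hx
        linarith [hx.2]
  have hlV : ContinuousOn l (U \ Ioc (0 : ℝ) 1 ×ˢ {(0 : ℝ)}) := hlc.mono sdiff_subset
  refine contractibleSpace_of_deformation (U := U) sdiff_subset (fun p => q (p, l p)) ?_ ?_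
    (fun z => q (z.2, z.1 * l z.2)) ?_ ?_ ?_ ?_
  · exact hqc.comp_continuousOn (continuousOn_id.prodMk hlc)
  · intro p hp
    have h1 := hqU p hp 1 (by simp)
    have h2 := hkey p hp 1 (by simp) (Or.inr rfl)
    rw [one_mul] at h1 h2
    exact ⟨h1, h2⟩
  · refine hqc.comp_continuousOn (continuousOn_snd.prodMk (continuousOn_fst.mul ?_))
    exact hlV.comp continuousOn_snd (fun z hz => hz.2)
  · rintro ⟨s, p⟩ ⟨hs, hp⟩
    exact ⟨hqU p hp.1 s hs, hkey p hp.1 s hs (Or.inl hp.2)⟩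
  · intro p hp
    simp [hq]
  · intro p hp
    simp

/-- One side of a crosscut is contractible. -/
theorem contractibleSpace_side_of_crosscut {U V W : Set (ℝ × ℝ)} (hU : IsOpen U)
    [ContractibleSpace U] (hV : IsOpen V) (hW : IsOpen W)
    (h0 : ((0 : ℝ), (0 : ℝ)) ∉ U) (h1 : ((1 : ℝ), (0 : ℝ)) ∉ U)
    (hs : Ioo (0 : ℝ) 1 ×ˢ {(0 : ℝ)} ⊆ U) (hVW : Disjoint V W)
    (hun : V ∪ W = U \ Ioo (0 : ℝ) 1 ×ˢ {(0 : ℝ)})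
    (l : ℝ × ℝ → ℝ) (hlc : ContinuousOn l U) (hl0 : ∀ p, 0 ≤ l p) (hl1 : ∀ p, l p ≤ 1)
    (hlS : ∀ p ∈ Ioo (0 : ℝ) 1 ×ˢ {(0 : ℝ)}, l p = 1)
    (N : Set (ℝ × ℝ)) (hN : N = {p | 0 < p.1 ∧ p.1 < 1 ∧ ∀ t ∈ Icc (0 : ℝ) 1, (p.1, t * p.2) ∈ U})
    (hlN : ∀ p ∉ N, l p = 0) (e : ℝ) (he : e = 1 ∨ e = -1)
    (hNV : ∀ p ∈ N, 0 < e * p.2 → p ∈ V) (hNW : ∀ p ∈ N, e * p.2 < 0 → p ∈ W) :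
    ContractibleSpace V := by
  set σ := Ioo (0 : ℝ) 1 ×ˢ {(0 : ℝ)} with hσ
  have hVU : V ⊆ U := fun p hp => (hun.subset (Or.inl hp)).1
  have hVσ : ∀ p ∈ V, p ∉ σ := fun p hp => (hun.subset (Or.inl hp)).2
  have hWσ : ∀ p ∈ W, p ∉ σ := fun p hp => (hun.subset (Or.inr hp)).2
  have htri : ∀ p ∈ U, p ∈ V ∨ p ∈ W ∨ p ∈ σ := by
    intro p hp
    by_cases h : p ∈ σ
    · exact Or.inr (Or.inr h)
    · rcases hun.superset ⟨hp, h⟩ with h | h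
      · exact Or.inl h
      · exact Or.inr (Or.inl h)
  set S := Icc (0 : ℝ) 1 ×ˢ {(0 : ℝ)} with hS
  have hSc : IsClosed S := isClosed_Icc.prod isClosed_singleton
  have hSn : S.Nonempty := ⟨(0, 0), by simp [hS]⟩
  set d : ℝ × ℝ → ℝ := fun p => min (Metric.infDist p S) (1 / 4) with hd
  have hdc : Continuous d := (Metric.continuous_infDist_pt S).min continuous_const
  set g : ℝ × ℝ → ℝ := fun p => max (min p.1 (1 - d p)) (d p) with hg
  have hgc : Continuous g := (continuous_fst.min (continuous_const.sub hdc)).max hdc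
  have hgσ : ∀ p ∈ σ, (g p, (0 : ℝ)) = p := by
    rintro ⟨x, y⟩ ⟨hx, hy⟩
    simp only [mem_singleton_iff] at hx hy
    subst hy
    have h2 : d (x, 0) = 0 := by
      have : Metric.infDist ((x, 0) : ℝ × ℝ) S = 0 :=
        Metric.infDist_zero_of_mem ⟨⟨hx.1.le, hx.2.le⟩, rfl⟩
      simp [hd, this]
    simp only [hg, h2, sub_zero]
    rw [min_eq_left hx.2.le, max_eq_left hx.1.le]
  have hgU : ∀ p ∈ U, (g p, (0 : ℝ)) ∈ σ := by
    intro p hp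
    by_cases h : p ∈ S
    · have : p ∈ σ := by
        obtain ⟨x, y⟩ := p
        obtain ⟨hx, hy⟩ := h
        simp only [mem_singleton_iff] at hx hy
        subst hy
        refine ⟨⟨lt_of_le_of_ne hx.1 ?_, lt_of_le_of_ne hx.2 ?_⟩, rfl⟩
        · rintro h
          simp only at h
          exact h0 (h ▸ hp)
        · rintro h
          simp only at h
          exact h1 (h ▸ hp)
      rw [hgσ p this]
      exact this
    · have hpos : 0 < d p := by
        refine lt_min ?_ (by norm_num)
        exact (hSc.notMem_iff_infDist_pos hSn).1 h
      have hle : d p ≤ 1 / 4 := min_le_right _ _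
      refine ⟨⟨lt_max_of_lt_right hpos, max_lt ?_ ?_⟩, rfl⟩
      · exact (min_le_right _ _).trans_lt (by linarith)
      · linarith
  classical
  set f : ℝ × ℝ → ℝ × ℝ := fun p => if p ∈ V then p else (g p, 0) with hf
  have hfc : ContinuousOn f U := by
    intro p hp
    rcases htri p hp with h | h | h
    · refine (continuousAt_id.congr ?_).continuousWithinAt
      filter_upwards [hV.mem_nhds h] with q hq
      simp [hf, hq]
    · have : ContinuousAt (fun p => (g p, (0 : ℝ))) p := by fun_prop
      refine (this.congr ?_).continuousWithinAt
      filter_upwards [hW.mem_nhds h] with q hq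
      have hqV : q ∉ V := fun h' => disjoint_left.1 hVW h' hq
      simp [hf, hqV]
    · have hfp : f p = p := by
        simp only [hf, hgσ p h, ite_self]
      refine ContinuousAt.continuousWithinAt ?_
      unfold ContinuousAt
      rw [hfp]
      refine Filter.Tendsto.if' Filter.tendsto_id ?_
      have : ContinuousAt (fun p => (g p, (0 : ℝ))) p := by fun_prop
      have h3 : Filter.Tendsto (fun p => (g p, (0 : ℝ))) (nhds p) (nhds (g p, 0)) := this
      rwa [hgσ p h] at h3
  have hVσU : V ∪ σ ⊆ U := union_subset hVU hs
  have c1 : ContractibleSpace ↥(V ∪ σ) := by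
    refine contractibleSpace_of_deformation hVσU f hfc ?_ (fun z => z.2) continuousOn_snd
      (fun z hz => hz.2) (fun _ _ => rfl) ?_
    · intro p hp
      by_cases h : p ∈ V
      · simp [hf, h]
      · simp only [hf, h, if_false]
        exact Or.inr (hgU p hp)
    · rintro p (h | h)
      · simp [hf, h]
      · simp only [hf, hgσ p h, ite_self]
  have hUn : Uᶜ.Nonempty := ⟨_, h0⟩
  set k : ℝ × ℝ → ℝ := fun p => l p * (Metric.infDist p Uᶜ / 2) with hk
  have hkc : ContinuousOn k U :=
    hlc.mul ((Metric.continuous_infDist_pt Uᶜ).div_const 2).continuousOn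
  have hee : e * e = 1 := by rcases he with rfl | rfl <;> norm_num
  have hk0 : ∀ p, 0 ≤ k p := fun p =>
    mul_nonneg (hl0 p) (div_nonneg Metric.infDist_nonneg (by norm_num))
  have hmove : ∀ p ∈ V ∪ σ, ∀ s ∈ Icc (0 : ℝ) 1, 0 < s * k p →
      (p.1, p.2 + e * (s * k p)) ∈ V := by
    rintro ⟨x, y⟩ hp s hs hpos
    have hlp : l (x, y) ≠ 0 := fun h => by simp [hk, h] at hpos
    have hpN : ((x, y) : ℝ × ℝ) ∈ N := by_contra fun h => hlp (hlN _ h)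
    have hpN' := hpN
    rw [hN] at hpN
    obtain ⟨hx0, hx1, hseg⟩ := hpN
    simp only at hx0 hx1 hseg ⊢
    have hy : 0 ≤ e * y := by
      by_contra! h
      have hw := hNW _ hpN' h
      rcases hp with hp | hp
      · exact disjoint_left.1 hVW hp hw
      · exact hWσ _ hw hp
    have hfin : 0 < e * (y + e * (s * k (x, y))) := by
      have : e * (y + e * (s * k (x, y))) = e * y + s * k (x, y) := by
        linear_combination (s * k (x, y)) * hee
      linarith
    refine hNV _ ?_ hfin
    rw [hN]
    refine ⟨hx0, hx1, fun t ht => ?_⟩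
    simp only
    set z := s * k (x, y) with hz
    have hdpos : 0 < Metric.infDist ((x, y) : ℝ × ℝ) Uᶜ :=
      (hU.isClosed_compl.notMem_iff_infDist_pos hUn).1 (fun h => h (hVσU hp))
    have hzd : z < Metric.infDist ((x, y) : ℝ × ℝ) Uᶜ := by
      have a1 : l (x, y) * (Metric.infDist ((x, y) : ℝ × ℝ) Uᶜ / 2) ≤
        1 * (Metric.infDist ((x, y) : ℝ × ℝ) Uᶜ / 2) := by
        gcongr
        exact hl1 _
      have a2 : z ≤ 1 * k (x, y) := by
        rw [hz]
        gcongr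
        · exact hk0 _
        · exact hs.2
      simp only [hk] at a2
      linarith
    rcases le_total (e * (t * (y + e * z))) (e * y) with h | h
    · have hnn : 0 ≤ e * (t * (y + e * z)) := by nlinarith [ht.1]
      rcases hy.eq_or_lt with hy0 | hy0
      · have h3 : e * (t * (y + e * z)) = 0 := le_antisymm (by linarith) hnn
        have hene : e ≠ 0 := by rintro rfl; norm_num at hee
        have h4 : t * (y + e * z) = 0 := (mul_eq_zero.1 h3).resolve_left hene
        rw [h4]
        simpa using hseg 0 (by simp)
      · have := hseg (e * (t * (y + e * z)) / (e * y))
          ⟨div_nonneg hnn hy, div_le_one_of_le₀ h hy⟩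
        have h5 : e * (t * (y + e * z)) / (e * y) * y = t * (y + e * z) := by
          have hene : e ≠ 0 := by rintro rfl; norm_num at hee
          have hyne : y ≠ 0 := by rintro rfl; simp at hy0
          field_simp
        rwa [h5] at this
    · by_contra hout
      have hle := Metric.infDist_le_dist_of_mem (x := ((x, y) : ℝ × ℝ))
        (show (x, t * (y + e * z)) ∈ Uᶜ from hout)
      rw [Prod.dist_eq] at hle
      simp only [dist_self, Real.dist_eq] at hle
      have hab : |y - t * (y + e * z)| = e * (t * (y + e * z)) - e * y := by
        rcases he with rfl | rfl
        · rw [abs_of_nonpos (by linarith)]; ring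
        · rw [abs_of_nonneg (by linarith)]; ring
      have hub : e * (t * (y + e * z)) ≤ e * (y + e * z) := by nlinarith [ht.2]
      have heq : e * (y + e * z) = e * y + z := by linear_combination z * hee
      rw [hab, max_eq_right (by linarith)] at hle
      linarith
  refine contractibleSpace_of_deformation (U := V ∪ σ) subset_union_left
    (fun p => (p.1, p.2 + e * (1 * k p))) ?_ ?_
    (fun z => (z.2.1, z.2.2 + e * (z.1 * k z.2))) ?_ ?_ ?_ ?_
  · have := hkc.mono hVσU
    fun_prop
  · intro p hp
    rcases (mul_nonneg zero_le_one (hk0 p)).eq_or_lt with h | h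
    · have hpV : p ∈ V := by
        rcases hp with hp | hp
        · exact hp
        · have hdpos : 0 < Metric.infDist p Uᶜ :=
            (hU.isClosed_compl.notMem_iff_infDist_pos hUn).1 (fun h => h (hs hp))
          have : 0 < k p := by
            simp only [hk, hlS p hp]
            positivity
          linarith
      simp only [← h]
      simpa using hpV
    · exact hmove p hp 1 (by simp) h
  · have h2 := (hkc.mono hVU).comp (continuousOn_snd (s := Icc (0 : ℝ) 1 ×ˢ V))
      (fun z hz => hz.2)
    exact (continuous_fst.comp continuous_snd).continuousOn.prodMk
      ((continuous_snd.comp continuous_snd).continuousOn.add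
        (continuousOn_const.mul (continuousOn_fst.mul h2)))
  · rintro ⟨s, p⟩ ⟨hs, hp⟩
    simp only at hs hp ⊢
    rcases (mul_nonneg hs.1 (hk0 p)).eq_or_lt with h | h
    · rw [← h]
      simpa using hp
    · exact hmove p (Or.inl hp) s hs h
  · intro p hp
    simp
  · intro p hp
    simp

theorem eq_of_isPreconnected_of_int_mul_two_pi {X : Type*} [TopologicalSpace X] {s : Set X}
    (hs : IsPreconnected s) {k : X → ℝ} (hk : ContinuousOn k s)
    (hper : ∀ p ∈ s, ∃ m : ℤ, k p = m * (2 * Real.pi)) {p q : X} (hp : p ∈ s) (hq : q ∈ s) :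
    k p = k q := by
  have key : ∀ p ∈ s, ∀ q ∈ s, ¬ k p < k q := by
    intro p hp q hq hlt
    obtain ⟨m, hm⟩ := hper p hp
    obtain ⟨m', hm'⟩ := hper q hq
    have hpi := Real.pi_pos
    have h1 : m < m' := by
      rw [hm, hm'] at hlt
      have := lt_of_mul_lt_mul_right hlt (by positivity)
      exact_mod_cast this
    have h2 : (m : ℝ) + 1 ≤ m' := by exact_mod_cast h1
    have hmem : k p + Real.pi ∈ Icc (k p) (k q) := by
      constructor
      · linarith
      · rw [hm, hm']; nlinarith
    obtain ⟨z, hz, hkz⟩ := hs.intermediate_value hp hq hk hmem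
    obtain ⟨n, hn⟩ := hper z hz
    rw [hm, hn] at hkz
    have h3 : (2 * (n : ℝ)) = 2 * m + 1 := by
      have : (2 * (n : ℝ) - 2 * m - 1) * Real.pi = 0 := by linear_combination hkz
      rcases mul_eq_zero.1 this with h | h
      · linarith
      · exact absurd h hpi.ne'
    have h4 : 2 * n = 2 * m + 1 := by exact_mod_cast h3
    omega
  exact le_antisymm (not_lt.1 (key q hq p hp)) (not_lt.1 (key p hp q hq))

theorem exists_contractible_sides_of_crosscut {U : Set (ℝ × ℝ)} (hU : IsOpen U)
    [ContractibleSpace U] (h0 : ((0 : ℝ), (0 : ℝ)) ∉ U) (h1 : ((1 : ℝ), (0 : ℝ)) ∉ U)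
    (hs : Ioo (0 : ℝ) 1 ×ˢ {(0 : ℝ)} ⊆ U) :
    ∃ V W : Set (ℝ × ℝ), IsOpen V ∧ IsOpen W ∧ Disjoint V W ∧
      V ∪ W = U \ Ioo (0 : ℝ) 1 ×ˢ {(0 : ℝ)} ∧ ContractibleSpace V ∧ ContractibleSpace W := by
  set σ := Ioo (0 : ℝ) 1 ×ˢ {(0 : ℝ)} with hσ
  have hpi := Real.pi_pos
  set N : Set (ℝ × ℝ) := {p | 0 < p.1 ∧ p.1 < 1 ∧ ∀ t ∈ Icc (0 : ℝ) 1, (p.1, t * p.2) ∈ U} with hN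
  have hNo : IsOpen N := by
    refine (isOpen_lt continuous_const continuous_fst).inter
      ((isOpen_lt continuous_fst continuous_const).inter ?_)
    exact isOpen_setOf_forall_mem_Icc hU
      (q := fun z : (ℝ × ℝ) × ℝ => (z.1.1, z.2 * z.1.2)) (by fun_prop)
  set S := Icc (0 : ℝ) 1 ×ˢ {(0 : ℝ)} with hS
  have hSc : IsClosed S := isClosed_Icc.prod isClosed_singleton
  have hUS : U ∩ S = σ := by
    ext ⟨x, y⟩
    constructor
    · rintro ⟨hp, hx, hy⟩
      simp only [mem_singleton_iff] at hx hy
      subst hy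
      refine ⟨⟨lt_of_le_of_ne hx.1 ?_, lt_of_le_of_ne hx.2 ?_⟩, rfl⟩
      · rintro h
        simp only at h
        exact h0 (h ▸ hp)
      · rintro h
        simp only at h
        exact h1 (h ▸ hp)
    · rintro h
      exact ⟨hs h, ⟨h.1.1.le, h.1.2.le⟩, h.2⟩
  have hσN : σ ⊆ N := by
    rintro ⟨x, y⟩ h
    have hh := h
    obtain ⟨hx, hy⟩ := h
    simp only [mem_singleton_iff] at hx hy
    subst hy
    refine ⟨hx.1, hx.2, fun t _ => ?_⟩
    simpa using hs hh
  obtain ⟨l, hlc, hl0, hl1, hlS, hlN⟩ := exists_urysohn_cutoff (U := U) hSc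
    ⟨((0 : ℝ), (0 : ℝ)), by simp [hS]⟩ hNo
    ⟨((0 : ℝ), (0 : ℝ)), fun h => lt_irrefl _ h.1⟩ (hUS.trans_subset hσN)
  rw [hUS] at hlS
  have hl00 : ∀ p : ℝ × ℝ, p.2 = 0 → p ∉ σ → l p = 0 := by
    rintro ⟨x, y⟩ hy h
    exact hlN _ fun hh => h ⟨⟨hh.1, hh.2.1⟩, hy⟩
  have hUσ : IsOpen (U \ σ) := by
    have : U \ σ = U \ S := by
      rw [← hUS]; ext; simp
    rw [this]
    exact hU.sdiff hSc
  have hlat : ∀ p ∈ U, ContinuousAt l p := fun p hp => hlc.continuousAt (hU.mem_nhds hp)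
  classical
  set ψ : ℝ × ℝ → ℝ := fun p => if 0 ≤ p.2 then Real.pi * l p else -(Real.pi * l p) with hψ
  have hψσ : ∀ p ∈ σ, ψ p = Real.pi := by
    intro p hp
    have h2 : p.2 = 0 := hp.2
    simp [hψ, h2, hlS p hp]
  have hψc : ContinuousOn ψ (U \ σ) := by
    rintro p ⟨hp, hpσ⟩
    refine ContinuousAt.continuousWithinAt ?_
    have hlp := hlat p hp
    rcases lt_trichotomy p.2 0 with h | h | h
    · have hc : ContinuousAt (fun p => -(Real.pi * l p)) p := (continuousAt_const.mul hlp).neg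
      refine hc.congr ?_
      filter_upwards [(isOpen_lt continuous_snd continuous_const).mem_nhds h] with q hq
      have : ¬ 0 ≤ q.2 := not_le.2 hq
      simp [hψ, this]
    · have hl : l p = 0 := hl00 p h hpσ
      have hψp : ψ p = 0 := by simp [hψ, hl]
      unfold ContinuousAt at hlp ⊢
      rw [hψp]
      rw [hl] at hlp
      refine Filter.Tendsto.if' ?_ ?_
      · simpa using hlp.const_mul Real.pi
      · simpa using (hlp.const_mul Real.pi).neg
    · have hc : ContinuousAt (fun p => (Real.pi * l p)) p := (continuousAt_const.mul hlp)
      refine hc.congr ?_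
      filter_upwards [(isOpen_lt continuous_const continuous_snd).mem_nhds h] with q hq
      have : 0 ≤ q.2 := le_of_lt hq
      simp [hψ, this]
  have hGc : Continuous (fun p : U => Circle.exp (ψ p)) := by
    have heq : (fun p : U => Circle.exp (ψ p)) = fun p : U => if (0 : ℝ) ≤ (p : ℝ × ℝ).2 then
        Circle.exp (Real.pi * l p) else Circle.exp (-(Real.pi * l p)) := by
      ext p
      simp only [hψ]
      split_ifs <;> rfl
    have hlU : Continuous (fun p : U => l p) := continuousOn_iff_continuous_domRestrict.1 hlc
    rw [heq]
    refine Continuous.if_le ?_ ?_ continuous_const (by fun_prop) ?_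
    · exact Circle.exp.continuous.comp (continuous_const.mul hlU)
    · exact Circle.exp.continuous.comp (continuous_const.mul hlU).neg
    · intro p hp
      by_cases h : (p : ℝ × ℝ) ∈ σ
      · rw [hlS _ h]
        exact Circle.exp_eq_exp.2 ⟨1, by push_cast; ring⟩
      · rw [hl00 _ hp.symm h]
        simp
  have hmid : (((1 / 2 : ℝ), (0 : ℝ)) : ℝ × ℝ) ∈ σ := by
    refine ⟨⟨?_, ?_⟩, rfl⟩ <;> norm_num
  have : SimplyConnectedSpace U := inferInstance
  have : LocallyPathConnectedSpace U := hU.locallyPathConnectedSpace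
  obtain ⟨F, ⟨hF0, hF⟩, -⟩ := Circle.isCoveringMap_exp.existsUnique_continuousMap_lifts
    (⟨fun p : U => Circle.exp (ψ p), hGc⟩ : C(U, Circle)) ⟨_, hs hmid⟩ Real.pi
    (by simp only [ContinuousMap.coe_mk]; rw [hψσ _ hmid])
  set F' : ℝ × ℝ → ℝ := fun p => if h : p ∈ U then F ⟨p, h⟩ else 0 with hF'
  have hF'c : ContinuousOn F' U := by
    rw [continuousOn_iff_continuous_domRestrict]
    have : U.domRestrict F' = F := by
      ext p
      simp [hF', Set.domRestrict]
    rw [this]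
    exact F.continuous
  have hF'm : F' (1 / 2, 0) = Real.pi := by
    simp only [hF', dif_pos (hs hmid)]
    exact hF0
  have hper : ∀ p ∈ U, ∃ m : ℤ, F' p - ψ p = m * (2 * Real.pi) := by
    intro p hp
    have := congrFun hF ⟨p, hp⟩
    simp only [Function.comp_apply, ContinuousMap.coe_mk] at this
    obtain ⟨m, hm⟩ := Circle.exp_eq_exp.1 this
    refine ⟨m, ?_⟩
    simp only [hF', dif_pos hp]
    linarith
  have hσpre : IsPreconnected σ := by
    rw [hσ]
    exact isPreconnected_Ioo.prod isPreconnected_singleton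
  have hFσ : ∀ p ∈ σ, F' p = Real.pi := by
    intro p hp
    have := eq_of_isPreconnected_of_int_mul_two_pi hσpre (k := fun p => F' p - Real.pi)
      ((hF'c.mono hs).sub continuousOn_const) (fun q hq => by
        have := hper q (hs hq)
        rwa [hψσ q hq] at this) hp hmid
    simp only [hF'm] at this
    linarith
  set H : ℝ × ℝ → ℝ := fun p => F' p - ψ p with hH
  have hHc : ContinuousOn H (U \ σ) := (hF'c.mono sdiff_subset).sub hψc
  set V := (U \ σ) ∩ H ⁻¹' (Iio Real.pi) with hV
  set W := (U \ σ) ∩ H ⁻¹' (Ioi Real.pi) with hW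
  have hVo : IsOpen V := hHc.isOpen_inter_preimage hUσ isOpen_Iio
  have hWo : IsOpen W := hHc.isOpen_inter_preimage hUσ isOpen_Ioi
  have hVW : Disjoint V W := by
    rw [disjoint_left]
    rintro p ⟨-, hp⟩ ⟨-, hq⟩
    rw [mem_preimage, mem_Iio] at hp
    rw [mem_preimage, mem_Ioi] at hq
    exact lt_asymm hp hq
  have hun : V ∪ W = U \ σ := by
    rw [hV, hW, ← inter_union_distrib_left, inter_eq_left]
    intro p hp
    obtain ⟨m, hm⟩ := hper p hp.1
    have hne : H p ≠ Real.pi := by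
      intro h
      simp only [hH] at h
      rw [h] at hm
      have h3 : (2 * (m : ℝ)) = 1 := by
        have : (2 * (m : ℝ) - 1) * Real.pi = 0 := by linear_combination -hm
        rcases mul_eq_zero.1 this with h | h
        · linarith
        · exact absurd h hpi.ne'
      have h4 : 2 * m = 1 := by exact_mod_cast h3
      omega
    rcases lt_or_gt_of_ne hne with h | h
    · exact Or.inl h
    · exact Or.inr h
  have hvert : ∀ p ∈ N, ∀ y ∈ uIcc 0 p.2, (p.1, y) ∈ U := by
    rintro ⟨x, y⟩ hp z hz
    obtain ⟨-, -, hp⟩ := hp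
    simp only at hp hz ⊢
    rw [← segment_eq_uIcc] at hz
    obtain ⟨a, b, ha, hb, hab, rfl⟩ := hz
    have := hp b ⟨hb, by linarith⟩
    simpa using this
  have hvpre : ∀ p : ℝ × ℝ, IsPreconnected ({p.1} ×ˢ uIcc 0 p.2) := fun p =>
    isPreconnected_singleton.prod isPreconnected_uIcc
  have hbase : ∀ p ∈ N, ((p.1, (0 : ℝ)) : ℝ × ℝ) ∈ σ := fun p hp => ⟨⟨hp.1, hp.2.1⟩, rfl⟩
  have hoff : ∀ p ∈ N, p.2 ≠ 0 → p ∈ U \ σ := by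
    intro p hp h
    refine ⟨?_, fun hh => h hh.2⟩
    simpa using hvert p hp p.2 (by simp)
  have hNV : ∀ p ∈ N, 0 < p.2 → p ∈ V := by
    intro p hp hy
    refine ⟨hoff p hp hy.ne', ?_⟩
    have hsub : ({p.1} ×ˢ uIcc 0 p.2 : Set (ℝ × ℝ)) ⊆ U := by
      rintro ⟨x, y⟩ ⟨hx, hyy⟩
      simp only [mem_singleton_iff] at hx
      subst hx
      exact hvert p hp y hyy
    have := eq_of_isPreconnected_of_int_mul_two_pi (hvpre p) (k := fun p => F' p - Real.pi * l p)
      ((hF'c.mono hsub).sub (continuousOn_const.mul (hlc.mono hsub))) (fun q hq => by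
        obtain ⟨m, hm⟩ := hper q (hsub hq)
        refine ⟨m, ?_⟩
        have h2 : 0 ≤ q.2 := by
          have := hq.2
          rw [uIcc_of_le hy.le] at this
          exact this.1
        simp only [hψ, if_pos h2] at hm
        exact hm) (p := p) (q := (p.1, 0)) ⟨rfl, by simp⟩ ⟨rfl, by simp⟩
    simp only [hFσ _ (hbase p hp), hlS _ (hbase p hp)] at this
    simp only [mem_preimage, mem_Iio, hH, hψ, if_pos hy.le]
    linarith
  have hNW : ∀ p ∈ N, p.2 < 0 → p ∈ W := by
    intro p hp hy
    refine ⟨hoff p hp hy.ne, ?_⟩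
    have hsub : ({p.1} ×ˢ uIcc 0 p.2 : Set (ℝ × ℝ)) ⊆ U := by
      rintro ⟨x, y⟩ ⟨hx, hyy⟩
      simp only [mem_singleton_iff] at hx
      subst hx
      exact hvert p hp y hyy
    have := eq_of_isPreconnected_of_int_mul_two_pi (hvpre p) (k := fun p => F' p + Real.pi * l p)
      ((hF'c.mono hsub).add (continuousOn_const.mul (hlc.mono hsub))) (fun q hq => by
        obtain ⟨m, hm⟩ := hper q (hsub hq)
        have h2 : q.2 ≤ 0 := by
          have := hq.2
          rw [uIcc_of_ge hy.le] at this
          exact this.2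
        rcases h2.lt_or_eq with h2 | h2
        · simp only [hψ, if_neg (not_le.2 h2)] at hm
          exact ⟨m, by linarith⟩
        · have hq1 : q = (p.1, 0) := Prod.ext hq.1 h2
          refine ⟨1, ?_⟩
          rw [hq1, hFσ _ (hbase p hp), hlS _ (hbase p hp)]
          push_cast
          ring) (p := p) (q := (p.1, 0)) ⟨rfl, by simp⟩ ⟨rfl, by simp⟩
    simp only [hFσ _ (hbase p hp), hlS _ (hbase p hp)] at this
    simp only [mem_preimage, mem_Ioi, hH, hψ, if_neg (not_le.2 hy)]
    linarith
  refine ⟨V, W, hVo, hWo, hVW, hun, ?_, ?_⟩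
  · exact contractibleSpace_side_of_crosscut hU hVo hWo h0 h1 hs hVW hun l hlc hl0 hl1 hlS N hN
      hlN 1 (Or.inl rfl) (fun p hp h => hNV p hp (by simpa using h))
      (fun p hp h => hNW p hp (by simpa using h))
  · exact contractibleSpace_side_of_crosscut hU hWo hVo h0 h1 hs hVW.symm
      (by rw [union_comm]; exact hun) l hlc hl0 hl1 hlS N hN
      hlN (-1) (Or.inr rfl) (fun p hp h => hNW p hp (by linarith))
      (fun p hp h => hNV p hp (by linarith))

theorem finSegUnion_iUnion {ι : Type*} [Finite ι] (a b : ι → E2) :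
    FinSegUnion (⋃ i, segment ℝ (a i) (b i)) := by
  obtain ⟨n, ⟨e⟩⟩ := Finite.exists_equiv_fin ι
  exact ⟨n, a ∘ e.symm, b ∘ e.symm, (e.symm.surjective.iUnion_comp
    (fun i => segment ℝ (a i) (b i))).symm⟩

theorem finSegUnion_segment (a b : E2) : FinSegUnion (segment ℝ a b) := by
  have := finSegUnion_iUnion (ι := Unit) (fun _ => a) (fun _ => b)
  rwa [iUnion_const] at this

theorem FinSegUnion.union {s t : Set E2} (hs : FinSegUnion s) (ht : FinSegUnion t) :
    FinSegUnion (s ∪ t) := by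
  obtain ⟨n, a, b, rfl⟩ := hs
  obtain ⟨m, c, d, rfl⟩ := ht
  have := finSegUnion_iUnion (ι := Fin n ⊕ Fin m) (Sum.elim a c) (Sum.elim b d)
  rw [iUnion_sum] at this
  exact this

theorem isCompact_segment (a b : E2) : IsCompact (segment ℝ a b) := by
  rw [segment_eq_image_lineMap]
  exact isCompact_Icc.image AffineMap.lineMap_continuous

theorem FinSegUnion.isCompact {s : Set E2} (hs : FinSegUnion s) : IsCompact s := by
  obtain ⟨n, a, b, rfl⟩ := hs
  exact isCompact_iUnion fun i => isCompact_segment _ _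

theorem volume_segment (a b : E2) : volume (segment ℝ a b) = 0 := by
  have h : segment ℝ a b ⊆ (affineSpan ℝ {a, b} : AffineSubspace ℝ E2) := by
    refine (AffineSubspace.convex _).segment_subset ?_ ?_ <;>
      exact subset_affineSpan _ _ (by simp)
  refine measure_mono_null h ?_
  refine Measure.addHaar_affineSubspace _ _ fun htop => ?_
  have h2 : Module.finrank ℝ (vectorSpan ℝ ({a, b} : Set E2)) ≤ 1 := by
    have := collinear_pair ℝ a b
    exact (collinear_iff_finrank_le_one).1 this
  rw [← direction_affineSpan, htop, AffineSubspace.direction_top] at h2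
  simp at h2

theorem FinSegUnion.volume_eq_zero {s : Set E2} (hs : FinSegUnion s) : volume s = 0 := by
  obtain ⟨n, a, b, rfl⟩ := hs
  exact measure_iUnion_null fun i => volume_segment _ _

/-- The point whose `j`-th coordinate is `c` and whose other coordinate is `d`. -/
def axisPt (j : Fin 2) (c d : ℝ) : E2 := WithLp.toLp 2 fun i => if i = j then c else d

theorem segment_axisPt (j : Fin 2) (c : ℝ) {L : ℝ} (hL : 0 ≤ L) :
    segment ℝ (axisPt j c (-L)) (axisPt j c L) = {x : E2 | x j = c ∧ ∀ i ≠ j, |x i| ≤ L} := by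
  ext x
  constructor
  · rintro ⟨s, t, hs, ht, hst, rfl⟩
    constructor
    · simp [axisPt]
      linear_combination c * hst
    · intro i hi
      simp only [axisPt, PiLp.add_apply, PiLp.smul_apply, if_neg hi, smul_eq_mul]
      rw [abs_le]
      constructor <;> nlinarith
  · rintro ⟨h1, h2⟩
    rcases hL.eq_or_lt with rfl | hL
    · have : x = axisPt j c 0 := by
        ext i
        by_cases hi : i = j
        · subst hi; simp [axisPt, h1]
        · have := h2 i hi
          simp only [axisPt, if_neg hi]
          exact abs_nonpos_iff.1 this
      rw [this]
      simp
    · have hk : ∃ k, k ≠ j := ⟨j + 1, by fin_cases j <;> decide⟩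
      obtain ⟨k, hk⟩ := hk
      have hxk := abs_le.1 (h2 k hk)
      refine ⟨(L - x k) / (2 * L), (L + x k) / (2 * L), div_nonneg (by linarith) (by linarith),
        div_nonneg (by linarith) (by linarith), by field_simp; ring, ?_⟩
      ext i
      by_cases hi : i = j
      · subst hi
        simp [axisPt, ← h1]
        field_simp
        ring
      · have : i = k := by omega
        subst this
        simp [axisPt, hi]
        field_simp
        ring

/-- The boundary of `Q_μ`. -/
def bdry (μ : ℝ) : Set E2 := {x | (∀ j, |x j| ≤ μ) ∧ ∃ j, |x j| = μ}

/-- The four sides of `Q_μ`, as segments. -/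
def sideEnd (μ : ℝ) (q : Fin 2 × Bool) (d : ℝ) : E2 := axisPt q.1 (if q.2 then μ else -μ) d

theorem bdry_eq {μ : ℝ} (hμ : 0 < μ) :
    bdry μ = ⋃ q : Fin 2 × Bool, segment ℝ (sideEnd μ q (-μ)) (sideEnd μ q μ) := by
  ext x
  simp only [mem_iUnion, sideEnd, segment_axisPt _ _ hμ.le]
  constructor
  · rintro ⟨h, j, hj⟩
    rcases (abs_eq hμ.le).1 hj with h1 | h1
    · exact ⟨(j, true), by simpa using h1, fun i _ => h i⟩
    · exact ⟨(j, false), by simpa using h1, fun i _ => h i⟩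
  · rintro ⟨⟨j, b⟩, h1, h2⟩
    have : |x j| = μ := by
      rw [h1]
      cases b <;> simp [abs_of_pos hμ]
    refine ⟨fun i => ?_, j, this⟩
    by_cases hi : i = j
    · rw [hi, this]
    · exact h2 i hi

theorem finSegUnion_bdry {μ : ℝ} (hμ : 0 < μ) : FinSegUnion (bdry μ) := by
  rw [bdry_eq hμ]
  exact finSegUnion_iUnion _ _

/-- The closed square. -/
def cSq (μ : ℝ) : Set E2 := {x | ∀ j, |x j| ≤ μ}

theorem isClosed_cSq (μ : ℝ) : IsClosed (cSq μ) := by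
  simp only [cSq, ofPred_forall]
  exact isClosed_iInter fun j => isClosed_le (by fun_prop) continuous_const

theorem convex_cSq (μ : ℝ) : Convex ℝ (cSq μ) := by
  intro x hx y hy a b ha hb hab j
  have h1 := abs_le.1 (hx j)
  have h2 := abs_le.1 (hy j)
  simp only [PiLp.add_apply, PiLp.smul_apply, smul_eq_mul]
  rw [abs_le]
  constructor <;> nlinarith

theorem isOpen_Qsq (μ : ℝ) : IsOpen (Qsq μ) := by
  simp only [Qsq, ofPred_forall]
  exact isOpen_iInter_of_finite fun j => isOpen_lt (by fun_prop) continuous_const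

theorem convex_Qsq (μ : ℝ) : Convex ℝ (Qsq μ) := by
  have : Qsq μ = ⋂ j : Fin 2, (fun x : E2 => x j) ⁻¹' (Ioo (-μ) μ) := by
    ext x
    simp only [Qsq, mem_ofPred_eq, abs_lt, mem_iInter, mem_preimage, mem_Ioo]
  rw [this]
  refine convex_iInter fun j => ?_
  exact (convex_Ioo _ _).is_linear_preimage ⟨fun _ _ => rfl, fun _ _ => rfl⟩

theorem Qsq_subset_cSq (μ : ℝ) : Qsq μ ⊆ cSq μ := fun _ hx j => (hx j).le

theorem cSq_diff_bdry (μ : ℝ) : cSq μ \ bdry μ = Qsq μ := by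
  ext x
  constructor
  · rintro ⟨h, h2⟩ j
    exact lt_of_le_of_ne (h j) fun h' => h2 ⟨h, j, h'⟩
  · rintro h
    exact ⟨fun j => (h j).le, fun ⟨_, j, hj⟩ => (h j).ne hj⟩

theorem bdry_subset_cSq (μ : ℝ) : bdry μ ⊆ cSq μ := fun _ hx => hx.1

theorem cSq_subset_closure {μ : ℝ} (hμ : 0 < μ) : cSq μ ⊆ closure (Qsq μ) := by
  intro x hx
  have h0 : (0 : E2) ∈ Qsq μ := fun j => by simpa using hμ
  have : Filter.Tendsto (fun t : ℝ => t • x) (nhdsWithin 1 (Iio 1)) (nhds x) := by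
    have h1 : ContinuousAt (fun t : ℝ => t • x) 1 := by fun_prop
    have h2 := h1.tendsto
    rw [one_smul] at h2
    exact h2.mono_left nhdsWithin_le_nhds
  refine mem_closure_of_tendsto this ?_
  filter_upwards [Ioo_mem_nhdsLT (show (0 : ℝ) < 1 by norm_num)] with t ht j
  simp only [PiLp.smul_apply, smul_eq_mul, abs_mul, abs_of_pos ht.1]
  have := hx j
  nlinarith [abs_nonneg (x j), ht.1, ht.2]

/-- A similarity of the plane moving `a` to the origin and `b` to `(1, 0)`. -/
theorem exists_homeomorph_lineMap {a b : E2} (hab : a ≠ b) :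
    ∃ φ : E2 ≃ₜ ℝ × ℝ, ∀ s : ℝ, φ (AffineMap.lineMap a b s) = (s, 0) := by
  set v : E2 := b - a with hv
  have hn : v 0 ^ 2 + v 1 ^ 2 ≠ 0 := by
    intro h
    have h0 : v 0 = 0 := by nlinarith [sq_nonneg (v 0), sq_nonneg (v 1)]
    have h1 : v 1 = 0 := by nlinarith [sq_nonneg (v 0), sq_nonneg (v 1)]
    have : v = 0 := by ext i; fin_cases i <;> assumption
    exact hab (sub_eq_zero.1 this).symm
  refine ⟨{ toFun := fun x => (((x 0 - a 0) * v 0 + (x 1 - a 1) * v 1) / (v 0 ^ 2 + v 1 ^ 2),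
              ((x 1 - a 1) * v 0 - (x 0 - a 0) * v 1) / (v 0 ^ 2 + v 1 ^ 2))
            invFun := fun z => WithLp.toLp 2 ![a 0 + z.1 * v 0 - z.2 * v 1,
              a 1 + z.1 * v 1 + z.2 * v 0]
            left_inv := ?_
            right_inv := ?_
            continuous_toFun := by fun_prop
            continuous_invFun := ?_ }, ?_⟩
  · intro x
    ext i
    fin_cases i
    · simp
      field_simp
      ring
    · simp
      field_simp
      ring
  · rintro ⟨s, t⟩
    simp
    constructor
    · field_simp
      ring
    · field_simp
      ring
  · refine (PiLp.continuous_toLp 2 _).comp (continuous_pi fun i => ?_)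
    fin_cases i
    · simp; fun_prop
    · simp; fun_prop
  · intro s
    simp [AffineMap.lineMap_apply, ← hv]
    constructor
    · field_simp
    · ring_nf; simp

theorem image_lineMap_eq {a b : E2} (φ : E2 ≃ₜ ℝ × ℝ)
    (hφ : ∀ s : ℝ, φ (AffineMap.lineMap a b s) = (s, 0)) (T : Set ℝ) :
    φ '' (AffineMap.lineMap a b '' T) = T ×ˢ {(0 : ℝ)} := by
  rw [image_image]
  simp only [hφ]
  ext ⟨x, y⟩
  simp [eq_comm]

theorem contractibleSpace_diff_segment_Ioc {U : Set E2} (hU : IsOpen U) (hUc : ContractibleSpace U)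
    {a b : E2} (hab : a ≠ b) (ha : a ∉ U) (hs : AffineMap.lineMap a b '' Ioc (0 : ℝ) 1 ⊆ U) :
    ContractibleSpace ↥(U \ AffineMap.lineMap a b '' Ioc (0 : ℝ) 1) := by
  obtain ⟨φ, hφ⟩ := exists_homeomorph_lineMap hab
  have c1 : ContractibleSpace ↥(φ '' U) := (φ.image U).symm.contractibleSpace
  have h0 : ((0 : ℝ), (0 : ℝ)) ∉ φ '' U := by
    rintro ⟨x, hx, h⟩
    have := hφ 0
    rw [AffineMap.lineMap_apply_zero, ← h] at this
    exact ha (φ.injective this ▸ hx)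
  have hs' := image_mono (f := φ) hs
  rw [image_lineMap_eq φ hφ] at hs'
  have := contractibleSpace_diff_slit (φ.isOpen_image.2 hU) h0 hs'
  rw [← image_lineMap_eq φ hφ, ← image_sdiff φ.injective] at this
  exact (φ.image _).contractibleSpace

theorem exists_contractible_sides_Ioo {U : Set E2} (hU : IsOpen U) (hUc : ContractibleSpace U)
    {a b : E2} (hab : a ≠ b) (ha : a ∉ U) (hb : b ∉ U)
    (hs : AffineMap.lineMap a b '' Ioo (0 : ℝ) 1 ⊆ U) :
    ∃ V W : Set E2, IsOpen V ∧ IsOpen W ∧ Disjoint V W ∧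
      V ∪ W = U \ AffineMap.lineMap a b '' Ioo (0 : ℝ) 1 ∧
      ContractibleSpace V ∧ ContractibleSpace W := by
  obtain ⟨φ, hφ⟩ := exists_homeomorph_lineMap hab
  have c1 : ContractibleSpace ↥(φ '' U) := (φ.image U).symm.contractibleSpace
  have h0 : ((0 : ℝ), (0 : ℝ)) ∉ φ '' U := by
    rintro ⟨x, hx, h⟩
    have := hφ 0
    rw [AffineMap.lineMap_apply_zero, ← h] at this
    exact ha (φ.injective this ▸ hx)
  have h1 : ((1 : ℝ), (0 : ℝ)) ∉ φ '' U := by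
    rintro ⟨x, hx, h⟩
    have := hφ 1
    rw [AffineMap.lineMap_apply_one, ← h] at this
    exact hb (φ.injective this ▸ hx)
  have hs' := image_mono (f := φ) hs
  rw [image_lineMap_eq φ hφ] at hs'
  obtain ⟨V, W, hV, hW, hd, hun, cV, cW⟩ :=
    exists_contractible_sides_of_crosscut (φ.isOpen_image.2 hU) h0 h1 hs'
  rw [← image_lineMap_eq φ hφ, ← image_sdiff φ.injective] at hun
  refine ⟨φ.symm '' V, φ.symm '' W, φ.symm.isOpen_image.2 hV, φ.symm.isOpen_image.2 hW,
    (disjoint_image_iff φ.symm.injective).2 hd, ?_, (φ.symm.image V).symm.contractibleSpace,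
    (φ.symm.image W).symm.contractibleSpace⟩
  rw [← image_union, hun, image_image]
  simp

/-- The open set `U` is a finite disjoint union of contractible open sets. -/
def FinContractible (U : Set E2) : Prop :=
  ∃ F : Set (Set E2), F.Finite ∧ (∀ P ∈ F, IsOpen P ∧ ContractibleSpace P) ∧
    F.PairwiseDisjoint id ∧ ⋃₀ F = U

theorem finContractible_replace {F 𝒮 : Set (Set E2)} {P T : Set E2} (hf : F.Finite)
    (hF : ∀ P ∈ F, IsOpen P ∧ ContractibleSpace P) (hd : F.PairwiseDisjoint id) (hP : P ∈ F)
    (hT : T ⊆ P) (hSf : 𝒮.Finite) (h𝒮 : ∀ P ∈ 𝒮, IsOpen P ∧ ContractibleSpace P)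
    (hSd : 𝒮.PairwiseDisjoint id) (hS : ⋃₀ 𝒮 = P \ T) : FinContractible (⋃₀ F \ T) := by
  have hSP : ∀ s ∈ 𝒮, s ⊆ P := fun s hs =>
    (subset_sUnion_of_mem hs).trans (hS.subset.trans sdiff_subset)
  have hdis : ∀ Q ∈ F, Q ≠ P → Disjoint Q P := fun Q hQ hne => hd hQ hP hne
  refine ⟨(F \ {P}) ∪ 𝒮, (hf.subset sdiff_subset).union hSf, ?_, ?_, ?_⟩
  · rintro Q (⟨hQ, -⟩ | hQ)
    · exact hF Q hQ
    · exact h𝒮 Q hQ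
  · rintro Q (⟨hQ, hQP⟩ | hQ) R (⟨hR, hRP⟩ | hR) hne
    · exact hd hQ hR hne
    · exact (hdis Q hQ hQP).mono_right (hSP R hR)
    · exact ((hdis R hR hRP).mono_right (hSP Q hQ)).symm
    · exact hSd hQ hR hne
  · rw [sUnion_union, hS]
    ext x
    constructor
    · rintro (⟨Q, ⟨hQ, hQP⟩, hx⟩ | ⟨hx, hxT⟩)
      · exact ⟨⟨Q, hQ, hx⟩, fun h => disjoint_left.1 (hdis Q hQ hQP) hx (hT h)⟩
      · exact ⟨⟨P, hP, hx⟩, hxT⟩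
    · rintro ⟨⟨Q, hQ, hx⟩, hxT⟩
      by_cases h : Q = P
      · exact Or.inr ⟨h ▸ hx, hxT⟩
      · exact Or.inl ⟨Q, ⟨hQ, h⟩, hx⟩

theorem exists_superset_of_isPreconnected {F : Set (Set E2)} (hF : ∀ P ∈ F, IsOpen P)
    (hd : F.PairwiseDisjoint id) {σ : Set E2} (hσ : IsPreconnected σ) (hn : σ.Nonempty)
    (hsub : σ ⊆ ⋃₀ F) : ∃ P ∈ F, σ ⊆ P := by
  obtain ⟨x, hx⟩ := hn
  obtain ⟨P, hP, hxP⟩ := hsub hx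
  refine ⟨P, hP, ?_⟩
  refine hσ.subset_left_of_subset_union (hF P hP) (v := ⋃₀ (F \ {P}))
    (isOpen_sUnion fun Q hQ => hF Q hQ.1) ?_ ?_ ⟨x, hx, hxP⟩
  · rw [disjoint_sUnion_right]
    rintro Q ⟨hQ, hne⟩
    exact hd hP hQ (Ne.symm hne)
  · intro y hy
    obtain ⟨Q, hQ, hyQ⟩ := hsub hy
    by_cases h : Q = P
    · exact Or.inl (h ▸ hyQ)
    · exact Or.inr ⟨Q, ⟨hQ, h⟩, hyQ⟩

theorem sdiff_union_singleton_of_notMem {X : Type*} {U s : Set X} {a : X} (ha : a ∉ U) :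
    U \ (s ∪ {a}) = U \ s := by
  ext x
  simp only [mem_sdiff, mem_union, mem_singleton_iff, not_or, and_congr_right_iff,
    and_iff_left_iff_imp]
  rintro hx - rfl
  exact ha hx

/-- Removing a segment which starts outside and whose interior is inside. -/
theorem FinContractible.diff_segment {U : Set E2} (hU : FinContractible U) {a b : E2}
    (hab : a ≠ b) (ha : a ∉ U) (hs : AffineMap.lineMap a b '' Ioo (0 : ℝ) 1 ⊆ U) :
    FinContractible (U \ segment ℝ a b) := by
  obtain ⟨F, hf, hF, hd, rfl⟩ := hU
  rw [segment_eq_image_lineMap]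
  set γ : ℝ →ᵃ[ℝ] E2 := AffineMap.lineMap a b with hγ
  have h0 : γ 0 = a := AffineMap.lineMap_apply_zero _ _
  have h1 : γ 1 = b := AffineMap.lineMap_apply_one _ _
  have hγc : Continuous γ := AffineMap.lineMap_continuous
  by_cases hb : b ∈ ⋃₀ F
  · have hs' : γ '' Ioc 0 1 ⊆ ⋃₀ F := by
      rintro _ ⟨t, ht, rfl⟩
      rcases ht.2.eq_or_lt with h | h
      · rw [h, h1]; exact hb
      · exact hs ⟨t, ⟨ht.1, h⟩, rfl⟩
    have hpre : IsPreconnected (γ '' Ioc 0 1) := isPreconnected_Ioc.image _ hγc.continuousOn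
    obtain ⟨P, hP, hPs⟩ := exists_superset_of_isPreconnected (fun P hP => (hF P hP).1) hd hpre
      ⟨_, mem_image_of_mem _ (by simp : (1 : ℝ) ∈ Ioc (0 : ℝ) 1)⟩ hs'
    have hc := contractibleSpace_diff_segment_Ioc (hF P hP).1 (hF P hP).2 hab
      (fun h => ha ⟨P, hP, h⟩) hPs
    have hopen : IsOpen (P \ γ '' Ioc 0 1) := by
      have : P \ γ '' Ioc 0 1 = P \ γ '' Icc 0 1 := by
        rw [← Ioc_union_left (zero_le_one' ℝ), image_union, image_singleton, h0,
          sdiff_union_singleton_of_notMem fun h => ha ⟨P, hP, h⟩]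
      rw [this]
      exact (hF P hP).1.sdiff (isCompact_Icc.image hγc).isClosed
    have := finContractible_replace (𝒮 := {P \ γ '' Ioc 0 1}) hf hF hd hP hPs
      (finite_singleton _) (by rintro _ rfl; exact ⟨hopen, hc⟩) (by simp) (by simp)
    rw [← Ioc_union_left (zero_le_one' ℝ), image_union, image_singleton, h0,
      sdiff_union_singleton_of_notMem ha]
    exact this
  · have hpre : IsPreconnected (γ '' Ioo 0 1) := isPreconnected_Ioo.image _ hγc.continuousOn
    obtain ⟨P, hP, hPs⟩ := exists_superset_of_isPreconnected (fun P hP => (hF P hP).1) hd hpre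
      ⟨_, mem_image_of_mem _ (by norm_num : (1 / 2 : ℝ) ∈ Ioo (0 : ℝ) 1)⟩ hs
    obtain ⟨V, W, hV, hW, hVW, hun, cV, cW⟩ := exists_contractible_sides_Ioo (hF P hP).1
      (hF P hP).2 hab (fun h => ha ⟨P, hP, h⟩) (fun h => hb ⟨P, hP, h⟩) hPs
    have := finContractible_replace (𝒮 := {V, W}) hf hF hd hP hPs
      (by simp) (by
        rintro _ (rfl | rfl)
        · exact ⟨hV, cV⟩
        · exact ⟨hW, cW⟩) (by
        rw [pairwiseDisjoint_insert]
        refine ⟨by simp, ?_⟩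
        rintro _ rfl _
        exact hVW) (by rw [sUnion_pair]; exact hun)
    rw [← Ioc_union_left (zero_le_one' ℝ), ← Ioo_union_right (zero_lt_one' ℝ), image_union,
      image_union, image_singleton, image_singleton, h0, h1,
      sdiff_union_singleton_of_notMem ha, sdiff_union_singleton_of_notMem hb]
    exact this

theorem sdiff_union_eq {X : Type*} (U s t : Set X) : U \ (s ∪ t) = (U \ s) \ t := by
  ext
  simp [and_assoc, not_or]

theorem eventually_mem_or_notMem_of_ordConnected {A : Set ℝ} (hA : A.OrdConnected) (t : ℝ) :
    ((∀ᶠ s in nhdsWithin t (Ioi t), s ∈ A) ∨ ∀ᶠ s in nhdsWithin t (Ioi t), s ∉ A) ∧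
    ((∀ᶠ s in nhdsWithin t (Iio t), s ∈ A) ∨ ∀ᶠ s in nhdsWithin t (Iio t), s ∉ A) := by
  constructor
  · by_cases h : ∃ᶠ s in nhdsWithin t (Ioi t), s ∈ A
    · left
      obtain ⟨s₀, hs₀, hts₀⟩ := (h.and_eventually self_mem_nhdsWithin).exists
      filter_upwards [Ioo_mem_nhdsGT hts₀] with s hs
      obtain ⟨s₁, hs₁, hts₁⟩ := (h.and_eventually (Ioo_mem_nhdsGT hs.1)).exists
      exact hA.out hs₁ hs₀ ⟨hts₁.2.le, hs.2.le⟩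
    · exact Or.inr (Filter.not_frequently.1 h)
  · by_cases h : ∃ᶠ s in nhdsWithin t (Iio t), s ∈ A
    · left
      obtain ⟨s₀, hs₀, hts₀⟩ := (h.and_eventually self_mem_nhdsWithin).exists
      filter_upwards [Ioo_mem_nhdsLT hts₀] with s hs
      obtain ⟨s₁, hs₁, hts₁⟩ := (h.and_eventually (Ioo_mem_nhdsLT hs.2)).exists
      exact hA.out hs₀ hs₁ ⟨hs.1.le, hts₁.1.le⟩
    · exact Or.inr (Filter.not_frequently.1 h)

theorem eventually_all_mem_or_notMem {n : ℕ} {A : Fin n → Set ℝ} {l : Filter ℝ}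
    (h : ∀ i, (∀ᶠ s in l, s ∈ A i) ∨ ∀ᶠ s in l, s ∉ A i) :
    (∀ᶠ s in l, s ∈ ⋃ i, A i) ∨ ∀ᶠ s in l, s ∉ ⋃ i, A i := by
  by_cases hh : ∃ i, ∀ᶠ s in l, s ∈ A i
  · obtain ⟨i, hi⟩ := hh
    exact Or.inl (hi.mono fun s hs => mem_iUnion.2 ⟨i, hs⟩)
  · right
    have : ∀ i, ∀ᶠ s in l, s ∉ A i := fun i => (h i).resolve_left (not_exists.1 hh i)
    filter_upwards [Filter.eventually_all.2 this] with s hs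
    simpa using hs

theorem FinSegUnion.eventually_mem_or_notMem {Γ : Set E2} (hΓ : FinSegUnion Γ) (γ : ℝ →ᵃ[ℝ] E2)
    (t : ℝ) :
    ((∀ᶠ s in nhdsWithin t (Ioi t), γ s ∈ Γ) ∨ ∀ᶠ s in nhdsWithin t (Ioi t), γ s ∉ Γ) ∧
    ((∀ᶠ s in nhdsWithin t (Iio t), γ s ∈ Γ) ∨ ∀ᶠ s in nhdsWithin t (Iio t), γ s ∉ Γ) := by
  obtain ⟨n, a, b, rfl⟩ := hΓ
  have hA : ∀ i, (γ ⁻¹' segment ℝ (a i) (b i)).OrdConnected := fun i =>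
    ((convex_segment _ _).affine_preimage γ).ordConnected
  have h1 := eventually_all_mem_or_notMem fun i =>
    (eventually_mem_or_notMem_of_ordConnected (hA i) t).1
  have h2 := eventually_all_mem_or_notMem fun i =>
    (eventually_mem_or_notMem_of_ordConnected (hA i) t).2
  simp only [← preimage_iUnion, mem_preimage] at h1 h2
  exact ⟨h1, h2⟩

theorem FinContractible.extend_segment {D Γ : Set E2} (hΓ : IsClosed Γ) {a b : E2} (hab : a ≠ b)
    (hsub : segment ℝ a b ⊆ D ∪ Γ) {t t' : ℝ} (h0 : 0 ≤ t) (htt : t < t') (h1 : t' ≤ 1)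
    (ht : FinContractible ((D \ Γ) \ AffineMap.lineMap a b '' Icc 0 t))
    (hor : (∀ s ∈ Ioo t t', AffineMap.lineMap a b s ∈ Γ) ∨
      ∀ s ∈ Ioo t t', AffineMap.lineMap a b s ∉ Γ) :
    FinContractible ((D \ Γ) \ AffineMap.lineMap a b '' Icc 0 t') := by
  rw [segment_eq_image_lineMap] at hsub
  set γ : ℝ →ᵃ[ℝ] E2 := AffineMap.lineMap a b with hγ
  have hγc : Continuous γ := AffineMap.lineMap_continuous
  have hinj : Function.Injective γ := AffineMap.lineMap_injective ℝ hab
  have hun : γ '' Icc 0 t' = γ '' Icc 0 t ∪ γ '' Icc t t' := by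
    rw [← image_union, Icc_union_Icc_eq_Icc h0 htt.le]
  rw [hun, sdiff_union_eq]
  rcases hor with hor | hor
  · have hcl : γ '' Icc t t' ⊆ Γ := by
      rw [← closure_Ioo htt.ne]
      refine (image_closure_subset_closure_image hγc).trans (closure_minimal ?_ hΓ)
      rintro _ ⟨s, hs, rfl⟩
      exact hor s hs
    have : ((D \ Γ) \ γ '' Icc 0 t) \ γ '' Icc t t' = (D \ Γ) \ γ '' Icc 0 t := by
      refine sdiff_eq_left.2 (disjoint_left.2 fun x hx hx' => hx.1.2 (hcl hx'))
    rwa [this]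
  · have : γ '' Icc t t' = segment ℝ (γ t) (γ t') := by
      rw [← segment_eq_Icc htt.le, image_segment]
    rw [this]
    refine ht.diff_segment (fun h => htt.ne (hinj h)) (fun h => h.2 ⟨t, ⟨h0, le_rfl⟩, rfl⟩) ?_
    rintro _ ⟨s, hs, rfl⟩
    rw [← AffineMap.apply_lineMap]
    have hm : AffineMap.lineMap t t' s ∈ Ioo t t' := by
      rw [AffineMap.lineMap_apply]
      simp only [vsub_eq_sub, smul_eq_mul, vadd_eq_add]
      constructor <;> nlinarith [hs.1, hs.2]
    have hnot := hor _ hm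
    refine ⟨⟨?_, hnot⟩, ?_⟩
    · exact (hsub ⟨_, ⟨by linarith [hm.1], by linarith [hm.2]⟩, rfl⟩).resolve_right hnot
    · rintro ⟨u, hu, he⟩
      have := hinj he
      linarith [hm.1, hu.2]

theorem FinContractible.diff_union_segment {D Γ : Set E2} (hΓ : FinSegUnion Γ) {a b : E2}
    (h : FinContractible (D \ Γ)) (ha : a ∈ Γ) (hsub : segment ℝ a b ⊆ D ∪ Γ) :
    FinContractible (D \ (Γ ∪ segment ℝ a b)) := by
  rcases eq_or_ne a b with rfl | hab
  · rwa [segment_same, union_eq_self_of_subset_right (singleton_subset_iff.2 ha)]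
  have hcl := hΓ.isCompact.isClosed
  rw [sdiff_union_eq, segment_eq_image_lineMap]
  set γ : ℝ →ᵃ[ℝ] E2 := AffineMap.lineMap a b with hγ
  set S : Set ℝ := {t | 0 ≤ t ∧ t ≤ 1 ∧ FinContractible ((D \ Γ) \ γ '' Icc 0 t)} with hS
  have h0 : (0 : ℝ) ∈ S := by
    refine ⟨le_rfl, zero_le_one, ?_⟩
    rw [Icc_self, image_singleton, hγ, AffineMap.lineMap_apply_zero]
    rwa [sdiff_eq_left.2 (disjoint_singleton_right.2 fun hh => hh.2 ha)]
  have hbdd : BddAbove S := ⟨1, fun t ht => ht.2.1⟩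
  set T := sSup S with hT
  have hT0 : 0 ≤ T := le_csSup hbdd h0
  have hT1 : T ≤ 1 := csSup_le ⟨0, h0⟩ fun t ht => ht.2.1
  have hev := hΓ.eventually_mem_or_notMem γ T
  have hTS : T ∈ S := by
    by_contra hTS
    have hpos : 0 < T := lt_of_le_of_ne hT0 fun h => hTS (h ▸ h0)
    have : ∃ c < T, (∀ s ∈ Ioo c T, γ s ∈ Γ) ∨ ∀ s ∈ Ioo c T, γ s ∉ Γ := by
      rcases hev.2 with h | h
      · obtain ⟨c, hc, hc'⟩ := (mem_nhdsLT_iff_exists_Ioo_subset).1 h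
        exact ⟨c, hc, Or.inl hc'⟩
      · obtain ⟨c, hc, hc'⟩ := (mem_nhdsLT_iff_exists_Ioo_subset).1 h
        exact ⟨c, hc, Or.inr hc'⟩
    obtain ⟨c, hcT, hc⟩ := this
    obtain ⟨t, ht, hct⟩ := exists_lt_of_lt_csSup ⟨0, h0⟩ hcT
    have htT : t < T := lt_of_le_of_ne (le_csSup hbdd ht) fun h => hTS (h ▸ ht)
    refine hTS ⟨hT0, hT1, FinContractible.extend_segment hcl hab hsub ht.1 htT hT1 ht.2.2 ?_⟩
    exact hc.imp (fun h s hs => h s ⟨hct.trans hs.1, hs.2⟩)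
      fun h s hs => h s ⟨hct.trans hs.1, hs.2⟩
  rcases hT1.eq_or_lt with h1 | h1
  · rw [← h1]
    exact hTS.2.2
  · exfalso
    have : ∃ c > T, (∀ s ∈ Ioo T c, γ s ∈ Γ) ∨ ∀ s ∈ Ioo T c, γ s ∉ Γ := by
      rcases hev.1 with h | h
      · obtain ⟨c, hc, hc'⟩ := (mem_nhdsGT_iff_exists_Ioo_subset).1 h
        exact ⟨c, hc, Or.inl hc'⟩
      · obtain ⟨c, hc, hc'⟩ := (mem_nhdsGT_iff_exists_Ioo_subset).1 h
        exact ⟨c, hc, Or.inr hc'⟩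
    obtain ⟨c, hcT, hc⟩ := this
    have hlt : T < min c 1 := lt_min hcT h1
    have hmem : min c 1 ∈ S := by
      refine ⟨hT0.trans hlt.le, min_le_right _ _, FinContractible.extend_segment hcl hab hsub hT0
        hlt (min_le_right _ _) hTS.2.2 ?_⟩
      exact hc.imp (fun h s hs => h s ⟨hs.1, hs.2.trans_le (min_le_left _ _)⟩)
        fun h s hs => h s ⟨hs.1, hs.2.trans_le (min_le_left _ _)⟩
    exact (le_csSup hbdd hmem).not_gt hlt

theorem segment_eq_union_of_mem {a b c : E2} (hc : c ∈ segment ℝ a b) :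
    segment ℝ a b = segment ℝ c a ∪ segment ℝ c b := by
  rw [segment_eq_image_lineMap] at hc
  obtain ⟨t, ht, rfl⟩ := hc
  set γ : ℝ →ᵃ[ℝ] E2 := AffineMap.lineMap a b with hγ
  have h0 : γ 0 = a := AffineMap.lineMap_apply_zero _ _
  have h1 : γ 1 = b := AffineMap.lineMap_apply_one _ _
  have e1 : segment ℝ (γ t) a = γ '' Icc 0 t := by
    rw [← segment_eq_Icc ht.1, image_segment, h0, segment_symm]
  have e2 : segment ℝ (γ t) b = γ '' Icc t 1 := by
    rw [← segment_eq_Icc ht.2, image_segment, h1]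
  rw [e1, e2, ← image_union, Icc_union_Icc_eq_Icc ht.1 ht.2, segment_eq_image_lineMap]

/-- A connected finite union of segments containing the boundary of the square cuts it into
finitely many contractible open sets. -/
theorem finContractible_of_isPreconnected {μ : ℝ} (hμ : 0 < μ) {n : ℕ} (a b : Fin n → E2)
    (hsub : ∀ i, segment ℝ (a i) (b i) ⊆ cSq μ)
    (hcon : IsPreconnected (bdry μ ∪ ⋃ i, segment ℝ (a i) (b i))) :
    FinContractible (Qsq μ \ (bdry μ ∪ ⋃ i, segment ℝ (a i) (b i))) := by
  classical
  have hbase : FinContractible (Qsq μ \ (bdry μ ∪ ⋃ i ∈ (∅ : Finset (Fin n)),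
      segment ℝ (a i) (b i))) := by
    have : Qsq μ \ (bdry μ ∪ ⋃ i ∈ (∅ : Finset (Fin n)), segment ℝ (a i) (b i)) = Qsq μ := by
      simp only [Finset.notMem_empty, iUnion_false, iUnion_empty, union_empty]
      rw [← cSq_diff_bdry, ← sdiff_union_eq, union_self]
    rw [this]
    refine ⟨{Qsq μ}, finite_singleton _, ?_, by simp, by simp⟩
    rintro _ rfl
    exact ⟨isOpen_Qsq μ, (convex_Qsq μ).contractibleSpace ⟨0, fun j => by simpa using hμ⟩⟩
  obtain ⟨A, hA, hmax⟩ : ∃ A : Finset (Fin n), FinContractible (Qsq μ \ (bdry μ ∪ ⋃ i ∈ A,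
      segment ℝ (a i) (b i))) ∧ ∀ B : Finset (Fin n), FinContractible (Qsq μ \ (bdry μ ∪ ⋃ i ∈ B,
      segment ℝ (a i) (b i))) → B.card ≤ A.card := by
    obtain ⟨A, hA, hmax⟩ := Finset.exists_max_image
      (Finset.univ.filter fun A : Finset (Fin n) => FinContractible (Qsq μ \ (bdry μ ∪ ⋃ i ∈ A,
      segment ℝ (a i) (b i)))) Finset.card ⟨∅, by simpa using hbase⟩
    simp only [Finset.mem_filter, Finset.mem_univ, true_and] at hA hmax
    exact ⟨A, hA, hmax⟩
  set G := bdry μ ∪ ⋃ i ∈ A, segment ℝ (a i) (b i) with hG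
  have hGf : FinSegUnion G := by
    refine (finSegUnion_bdry hμ).union ?_
    have := finSegUnion_iUnion (ι := A) (fun i => a i) (fun i => b i)
    rwa [iUnion_subtype] at this
  have hDG : ∀ s : Set E2, s ⊆ cSq μ → s ⊆ Qsq μ ∪ G := by
    intro s hs x hx
    rw [← cSq_diff_bdry]
    by_cases h : x ∈ bdry μ
    · exact Or.inr (Or.inl h)
    · exact Or.inl ⟨hs hx, h⟩
  have hx0 : axisPt 0 μ μ ∈ bdry μ :=
    ⟨fun j => by simp [axisPt, abs_of_pos hμ], 0, by simp [axisPt, abs_of_pos hμ]⟩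
  have hall : ∀ i, i ∈ A := by
    by_contra! hex
    have hmeet : ∃ i ∉ A, (segment ℝ (a i) (b i) ∩ G).Nonempty := by
      obtain ⟨i₀, hi₀⟩ := hex
      rw [isPreconnected_closed_iff] at hcon
      have hR : IsClosed (⋃ i : {i // i ∉ A}, segment ℝ (a i) (b i)) :=
        (finSegUnion_iUnion (fun i : {i // i ∉ A} => a i) fun i => b i).isCompact.isClosed
      obtain ⟨x, -, hxG, hxR⟩ := hcon G _ hGf.isCompact.isClosed hR (by
          rintro x (hx | hx)
          · exact Or.inl (Or.inl hx)
          · obtain ⟨i, hi⟩ := mem_iUnion.1 hx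
            by_cases h : i ∈ A
            · exact Or.inl (Or.inr (mem_iUnion₂.2 ⟨i, h, hi⟩))
            · exact Or.inr (mem_iUnion.2 ⟨⟨i, h⟩, hi⟩))
        ⟨axisPt 0 μ μ, Or.inl hx0, Or.inl hx0⟩
        ⟨a i₀, Or.inr (mem_iUnion.2 ⟨i₀, left_mem_segment _ _ _⟩),
          mem_iUnion.2 ⟨⟨i₀, hi₀⟩, left_mem_segment _ _ _⟩⟩
      · obtain ⟨⟨i, hi⟩, hx⟩ := mem_iUnion.1 hxR
        exact ⟨i, hi, x, hx, hxG⟩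
    obtain ⟨i, hiA, c, hc, hcG⟩ := hmeet
    have e := segment_eq_union_of_mem hc
    have hcs : segment ℝ c (a i) ⊆ cSq μ := (subset_union_left.trans e.superset).trans (hsub i)
    have hcs' : segment ℝ c (b i) ⊆ cSq μ := (subset_union_right.trans e.superset).trans (hsub i)
    have g1 := hA.diff_union_segment hGf hcG (hDG _ hcs)
    have g2 := g1.diff_union_segment (hGf.union (finSegUnion_segment _ _)) (Or.inl hcG)
      ((hDG _ hcs').trans (union_subset_union_right _ subset_union_left))
    rw [union_assoc, ← e] at g2
    have hle := hmax (insert i A) (by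
      rw [Finset.set_biUnion_insert, union_comm (segment ℝ (a i) (b i)), ← union_assoc]
      exact g2)
    rw [Finset.card_insert_of_notMem hiA] at hle
    omega
  have : G = bdry μ ∪ ⋃ i, segment ℝ (a i) (b i) := by
    rw [hG]
    congr 1
    simp [hall]
  rwa [← this]

theorem subset_closure_diff_of_volume_eq_zero {U Γ : Set E2} (hU : IsOpen U)
    (hΓ : volume Γ = 0) : U ⊆ closure (U \ Γ) := by
  intro x hx
  rw [mem_closure_iff]
  intro W hW hxW
  by_contra hne
  rw [not_nonempty_iff_eq_empty] at hne
  have hsub : W ∩ U ⊆ Γ := by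
    rintro y ⟨hyW, hyU⟩
    by_contra hy
    exact hne.subset ⟨hyW, hyU, hy⟩
  exact ((hW.inter hU).measure_pos volume ⟨x, hxW, hx⟩).ne' (measure_mono_null hsub hΓ)

/-- A connected finite union of segments in the closed square, containing the boundary, is the
union of the frontiers of a finite partition into simply connected open sets. -/
theorem exists_partition_of_isPreconnected {μ : ℝ} (hμ : 0 < μ) {Γ : Set E2}
    (hΓ : FinSegUnion Γ) (hsub : Γ ⊆ cSq μ) (hb : bdry μ ⊆ Γ) (hcon : IsPreconnected Γ) :
    ∃ (m : ℕ) (P : Fin m → Set E2), (∀ j, IsOpen (P j)) ∧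
      (∀ j, SimplyConnectedSpace ↥(P j)) ∧ Pairwise (Function.onFun Disjoint P) ∧
      (∀ j, P j ⊆ Qsq μ) ∧ volume (Qsq μ \ ⋃ j, P j) = 0 ∧ ⋃ j, frontier (P j) = Γ := by
  obtain ⟨F, hf, hF, hd, hU⟩ : FinContractible (Qsq μ \ Γ) := by
    obtain ⟨n, a, b, rfl⟩ := id hΓ
    have e : bdry μ ∪ ⋃ i, segment ℝ (a i) (b i) = ⋃ i, segment ℝ (a i) (b i) :=
      union_eq_self_of_subset_left hb
    have := finContractible_of_isPreconnected hμ a b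
      (fun i => (subset_iUnion _ i).trans hsub) (e.symm ▸ hcon)
    rwa [e] at this
  have hfin : Finite F := hf
  obtain ⟨m, ⟨e⟩⟩ := Finite.exists_equiv_fin F
  have hPU : ⋃ j, (e.symm j : Set E2) = Qsq μ \ Γ := by
    rw [← hU, sUnion_eq_iUnion]
    exact e.symm.surjective.iUnion_comp fun s : F => (s : Set E2)
  have hdis : Pairwise (Function.onFun Disjoint fun j => (e.symm j : Set E2)) := by
    intro j k hjk
    exact hd (e.symm j).2 (e.symm k).2 fun h => hjk (e.symm.injective (Subtype.ext h))
  have hop : ∀ j, IsOpen (e.symm j : Set E2) := fun j => (hF _ (e.symm j).2).1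
  have hPQ : ∀ j, (e.symm j : Set E2) ⊆ Qsq μ \ Γ := fun j => by
    rw [← hPU]
    exact subset_iUnion (fun j => (e.symm j : Set E2)) j
  have hvol := hΓ.volume_eq_zero
  refine ⟨m, fun j => e.symm j, hop, fun j => ?_, hdis, fun j => (hPQ j).trans sdiff_subset,
    ?_, ?_⟩
  · have := (hF _ (e.symm j).2).2
    infer_instance
  · rw [hPU]
    refine measure_mono_null (fun x hx => ?_) hvol
    by_contra h
    exact hx.2 ⟨hx.1, h⟩
  · apply Subset.antisymm
    · refine iUnion_subset fun j x hx => ?_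
      rw [(hop j).frontier_eq] at hx
      by_contra hxΓ
      have hxc : x ∈ cSq μ := closure_minimal
        (((hPQ j).trans sdiff_subset).trans (Qsq_subset_cSq μ)) (isClosed_cSq μ) hx.1
      have hxQ : x ∈ Qsq μ \ Γ := by
        rw [← cSq_diff_bdry]
        exact ⟨⟨hxc, fun h => hxΓ (hb h)⟩, hxΓ⟩
      rw [← hPU] at hxQ
      obtain ⟨k, hk⟩ := mem_iUnion.1 hxQ
      have hjk : k ≠ j := by
        rintro rfl
        exact hx.2 hk
      exact disjoint_left.1 ((hdis hjk).closure_right (hop k)) hk hx.1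
    · intro x hx
      have h1 : x ∈ closure (Qsq μ \ Γ) :=
        closure_minimal (subset_closure_diff_of_volume_eq_zero (isOpen_Qsq μ) hvol)
          isClosed_closure (cSq_subset_closure hμ (hsub hx))
      rw [← hPU, closure_iUnion_of_finite] at h1
      obtain ⟨j, hj⟩ := mem_iUnion.1 h1
      refine mem_iUnion.2 ⟨j, ?_⟩
      rw [(hop j).frontier_eq]
      exact ⟨hj, fun h => (hPQ j h).2 hx⟩

section

section Chain

variable {X : Type*} [PseudoMetricSpace X] (E : Set X) (vis seed : ℕ → X → Prop) (ρ : ℕ → ℝ)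
  (I : ℕ)

/-- One step of a chain in `E`: `y` is visible at some scale `k ∈ [i, I]` and `z` is at distance
at most `ρ k`. -/
def ChainStep (i : ℕ) (y z : X) : Prop :=
  y ∈ E ∧ z ∈ E ∧ ∃ k, i ≤ k ∧ k ≤ I ∧ vis k y ∧ dist y z ≤ ρ k

/-- The decreasing sets obtained by keeping, at each scale `i ∈ [8, I]`, only the points joined by
a chain to a seed. -/
def chainSet : ℕ → Set X
  | 0 => E
  | i + 1 => {y | (y ∈ chainSet i ∧ ¬ (8 ≤ i ∧ i ≤ I)) ∨ ((8 ≤ i ∧ i ≤ I) ∧ y ∈ E ∧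
      ∃ s ∈ chainSet i, seed i s ∧ Relation.ReflTransGen (ChainStep E vis ρ I i) y s)}

variable {E vis seed ρ I}

theorem ChainStep.mono {i j : ℕ} (hij : i ≤ j) {y z : X} (h : ChainStep E vis ρ I j y z) :
    ChainStep E vis ρ I i y z := by
  obtain ⟨hy, hz, k, hk, hk', h⟩ := h
  exact ⟨hy, hz, k, hij.trans hk, hk', h⟩

theorem mem_chainSet_succ {i : ℕ} (h8 : 8 ≤ i) (hI : i ≤ I) {y : X} :
    y ∈ chainSet E vis seed ρ I (i + 1) ↔ y ∈ E ∧ ∃ s ∈ chainSet E vis seed ρ I i, seed i s ∧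
      Relation.ReflTransGen (ChainStep E vis ρ I i) y s := by
  simp [chainSet, h8, hI]

theorem chainSet_succ_of_not {i : ℕ} (h : ¬ (8 ≤ i ∧ i ≤ I)) :
    chainSet E vis seed ρ I (i + 1) = chainSet E vis seed ρ I i := by
  ext y
  simp only [chainSet, mem_ofPred_eq]
  tauto

theorem chainSet_of_le {i : ℕ} (h : i ≤ 8) : chainSet E vis seed ρ I i = E := by
  induction i with
  | zero => rfl
  | succ i ih => rw [chainSet_succ_of_not (by omega), ih (by omega)]

theorem chainSet_of_lt {i : ℕ} (h : I + 1 ≤ i) :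
    chainSet E vis seed ρ I i = chainSet E vis seed ρ I (I + 1) := by
  induction i, h using Nat.le_induction with
  | base => rfl
  | succ i hi ih => rw [chainSet_succ_of_not (by omega), ih]

theorem chainSet_subset (i : ℕ) : chainSet E vis seed ρ I i ⊆ E := by
  induction i with
  | zero => exact Subset.rfl
  | succ i ih =>
    rintro y (hy | hy)
    · exact ih hy.1
    · exact hy.2.1

theorem mem_chainSet_succ_of_chainStep {i : ℕ} (h8 : 8 ≤ i) (hI : i ≤ I) {y z : X}
    (hz : z ∈ chainSet E vis seed ρ I (i + 1)) (h : ChainStep E vis ρ I i y z) :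
    y ∈ chainSet E vis seed ρ I (i + 1) := by
  rw [mem_chainSet_succ h8 hI] at hz ⊢
  obtain ⟨-, s, hs, hss, hc⟩ := hz
  exact ⟨h.1, s, hs, hss, hc.head h⟩

theorem mem_chainSet_of_chainStep {i : ℕ} {y z : X} (hz : z ∈ chainSet E vis seed ρ I i)
    (h : ChainStep E vis ρ I i y z) : y ∈ chainSet E vis seed ρ I i := by
  rcases le_or_gt i 8 with h8 | h8
  · rw [chainSet_of_le h8]
    exact h.1
  · obtain ⟨j, rfl⟩ : ∃ j, i = j + 1 := ⟨i - 1, by omega⟩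
    have := h.2.2
    obtain ⟨k, hk, hkI, -⟩ := this
    exact mem_chainSet_succ_of_chainStep (by omega) (by omega) hz (h.mono (by omega))

theorem mem_chainSet_of_reflTransGen {i : ℕ} {y z : X} (hz : z ∈ chainSet E vis seed ρ I i)
    (h : Relation.ReflTransGen (ChainStep E vis ρ I i) y z) : y ∈ chainSet E vis seed ρ I i := by
  induction h using Relation.ReflTransGen.head_induction_on with
  | refl => exact hz
  | head h _ ih => exact mem_chainSet_of_chainStep ih h

theorem chainSet_succ_subset (i : ℕ) :
    chainSet E vis seed ρ I (i + 1) ⊆ chainSet E vis seed ρ I i := by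
  rintro y (hy | ⟨-, -, s, hs, -, hc⟩)
  · exact hy.1
  · exact mem_chainSet_of_reflTransGen hs hc

theorem antitone_chainSet : Antitone (chainSet E vis seed ρ I) :=
  antitone_nat_of_succ_le chainSet_succ_subset

/-- Seeds survive. -/
theorem mem_chainSet_succ_of_seed {i : ℕ} {y : X} (hy : y ∈ chainSet E vis seed ρ I i)
    (hs : seed i y) : y ∈ chainSet E vis seed ρ I (i + 1) := by
  by_cases h : 8 ≤ i ∧ i ≤ I
  · exact (mem_chainSet_succ h.1 h.2).2 ⟨chainSet_subset i hy, y, hy, hs, .refl⟩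
  · rwa [chainSet_succ_of_not h]

theorem subset_chainSet {S : Set X} (hS : S ⊆ E) (hs : ∀ i, ∀ y ∈ S, seed i y) (i : ℕ) :
    S ⊆ chainSet E vis seed ρ I i := by
  induction i with
  | zero => exact hS
  | succ i ih => exact fun y hy => mem_chainSet_succ_of_seed (ih hy) (hs i y hy)

theorem mem_chainSet_succ_of_vis {i k : ℕ} (h8 : 8 ≤ i) (hik : i ≤ k) (hkI : k ≤ I) {y z : X}
    (hy : y ∈ E) (hv : vis k y) (hz : z ∈ chainSet E vis seed ρ I (i + 1)) (hd : dist y z ≤ ρ k) :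
    y ∈ chainSet E vis seed ρ I (i + 1) :=
  mem_chainSet_succ_of_chainStep h8 (hik.trans hkI) hz
    ⟨hy, chainSet_subset _ hz, k, hik, hkI, hv, hd⟩

theorem mem_chainSet_of_dist_le (hv : ∀ y, vis I y) {i : ℕ} {y z : X}
    (hy : y ∈ E) (hz : z ∈ chainSet E vis seed ρ I i) (hd : dist y z ≤ ρ I) :
    y ∈ chainSet E vis seed ρ I i := by
  rcases le_or_gt i 8 with h8 | h8
  · rwa [chainSet_of_le h8]
  · obtain ⟨j, rfl⟩ : ∃ j, i = j + 1 := ⟨i - 1, by omega⟩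
    rcases le_or_gt j I with hj | hj
    · exact mem_chainSet_succ_of_vis (by omega) hj le_rfl hy (hv y) hz hd
    · rw [chainSet_of_lt (by omega)] at hz ⊢
      rcases le_or_gt I 7 with hI | hI
      · rwa [chainSet_of_le (by omega)]
      · exact mem_chainSet_succ_of_vis hI le_rfl le_rfl hy (hv y) hz hd

end Chain

end

section

theorem abs_sub_apply_le_dist (x y : E2) (j : Fin 2) : |x j - y j| ≤ dist x y := by
  rw [dist_eq_norm]
  exact PiLp.norm_apply_le (x - y) j

theorem dist_le_of_forall_abs_sub_le {x y : E2} {d : ℝ} (h : ∀ j, |x j - y j| ≤ d) :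
    dist x y ≤ 3 / 2 * d := by
  have hd : 0 ≤ d := (abs_nonneg _).trans (h 0)
  rw [EuclideanSpace.dist_eq, Fin.sum_univ_two]
  refine Real.sqrt_le_iff.2 ⟨by positivity, ?_⟩
  have h0 : dist (x 0) (y 0) ^ 2 ≤ d ^ 2 := pow_le_pow_left₀ dist_nonneg (h 0) 2
  have h1 : dist (x 1) (y 1) ^ 2 ≤ d ^ 2 := pow_le_pow_left₀ dist_nonneg (h 1) 2
  nlinarith

namespace DSq

variable {θ μ : ℝ}

/-- The center of a square, as a point of the plane. -/
def ctrPt (θ μ : ℝ) (Q : DSq) : E2 := WithLp.toLp 2 (Q.ctr θ μ)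

@[simp] theorem ctrPt_apply (Q : DSq) (j : Fin 2) : Q.ctrPt θ μ j = Q.ctr θ μ j := rfl

theorem sc_pos (hθ : 0 < θ) (hμ : 0 < μ) (Q : DSq) : 0 < Q.sc θ μ := by
  unfold sc
  positivity

theorem enl_eq_preimage (Q : DSq) (lam : ℝ) :
    Q.enl θ μ lam = Homeomorph.subRight (Q.ctrPt θ μ) ⁻¹' Qsq (lam * Q.sc θ μ) := rfl

theorem core_eq_enl (Q : DSq) : Q.core θ μ = Q.enl θ μ 1 := by
  simp [core, enl]

theorem isOpen_enl (Q : DSq) (lam : ℝ) : IsOpen (Q.enl θ μ lam) := by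
  rw [enl_eq_preimage]
  exact (isOpen_Qsq _).preimage (Homeomorph.continuous _)

theorem convex_enl (Q : DSq) (lam : ℝ) : Convex ℝ (Q.enl θ μ lam) := by
  have := (convex_Qsq (lam * Q.sc θ μ)).translate_preimage_right (-Q.ctrPt θ μ)
  refine (congrArg _ ?_).mp this
  ext x
  simp [enl, Qsq, neg_add_eq_sub]

theorem closure_enl (hθ : 0 < θ) (hμ : 0 < μ) (Q : DSq) {lam : ℝ} (hl : 0 < lam) :
    closure (Q.enl θ μ lam) = {x | ∀ j, |x j - Q.ctr θ μ j| ≤ lam * Q.sc θ μ} := by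
  have hpos : 0 < lam * Q.sc θ μ := mul_pos hl (Q.sc_pos hθ hμ)
  rw [enl_eq_preimage, ← Homeomorph.preimage_closure]
  have : closure (Qsq (lam * Q.sc θ μ)) = cSq (lam * Q.sc θ μ) :=
    Subset.antisymm (closure_minimal (Qsq_subset_cSq _) (isClosed_cSq _)) (cSq_subset_closure hpos)
  rw [this]
  rfl

theorem enl_mono (hθ : 0 < θ) (hμ : 0 < μ) (Q : DSq) {l₁ l₂ : ℝ} (h : l₁ ≤ l₂) :
    Q.enl θ μ l₁ ⊆ Q.enl θ μ l₂ := fun _ hx j =>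
  (hx j).trans_le (mul_le_mul_of_nonneg_right h (Q.sc_pos hθ hμ).le)

theorem closure_enl_subset (hθ : 0 < θ) (hμ : 0 < μ) (Q : DSq) {l₁ l₂ : ℝ} (h0 : 0 < l₁)
    (h : l₁ < l₂) : closure (Q.enl θ μ l₁) ⊆ Q.enl θ μ l₂ := by
  rw [closure_enl hθ hμ Q h0]
  exact fun _ hx j => (hx j).trans_lt (mul_lt_mul_of_pos_right h (Q.sc_pos hθ hμ))

theorem ctrPt_mem_enl (hθ : 0 < θ) (hμ : 0 < μ) (Q : DSq) {lam : ℝ} (h : 0 < lam) :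
    Q.ctrPt θ μ ∈ Q.enl θ μ lam := fun j => by
  simpa using mul_pos h (Q.sc_pos hθ hμ)

/-- The square of the grid `𝒬^i` whose half-open version contains `x`. -/
def cell (θ μ : ℝ) (i : ℕ) (x : E2) : DSq := ⟨i, fun j => ⌊x j / (2 * (μ * θ ^ i))⌋⟩

@[simp] theorem cell_idx (i : ℕ) (x : E2) : (cell θ μ i x).idx = i := rfl

theorem cell_bounds (hθ : 0 < θ) (hμ : 0 < μ) (i : ℕ) (x : E2) (j : Fin 2) :
    (cell θ μ i x).ctr θ μ j - μ * θ ^ i ≤ x j ∧ x j < (cell θ μ i x).ctr θ μ j + μ * θ ^ i := by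
  have hs : 0 < 2 * (μ * θ ^ i) := by positivity
  have h1 := Int.floor_le (x j / (2 * (μ * θ ^ i)))
  have h2 := Int.lt_floor_add_one (x j / (2 * (μ * θ ^ i)))
  rw [le_div_iff₀ hs] at h1
  rw [div_lt_iff₀ hs] at h2
  simp only [ctr, sc, cell]
  constructor <;> nlinarith

theorem mem_enl_cell (hθ : 0 < θ) (hμ : 0 < μ) (i : ℕ) (x : E2) {lam : ℝ} (hl : 1 < lam) :
    x ∈ (cell θ μ i x).enl θ μ lam := fun j => by
  have h := cell_bounds hθ hμ i x j
  have hs : 0 < μ * θ ^ i := by positivity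
  have : |x j - (cell θ μ i x).ctr θ μ j| ≤ μ * θ ^ i := by
    rw [abs_le]
    constructor <;> linarith [h.1, h.2]
  simp only [sc, cell_idx]
  nlinarith

theorem eq_cell_of_mem_core (hθ : 0 < θ) (hμ : 0 < μ) {Q : DSq} {x : E2} (hx : x ∈ Q.core θ μ) :
    Q = cell θ μ Q.idx x := by
  obtain ⟨i, p⟩ := Q
  have hs : 0 < 2 * (μ * θ ^ i) := by positivity
  congr 1
  funext j
  symm
  rw [Int.floor_eq_iff, le_div_iff₀ hs, div_lt_iff₀ hs]
  have := abs_lt.1 (hx j)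
  simp only [ctr, sc] at this
  constructor <;> nlinarith [this.1, this.2]

/-- The square of the preceding scale containing `Q`. -/
def par (n₀ : ℕ) (Q : DSq) : DSq := ⟨Q.idx - 1, fun j => Q.pos j / ((2 ^ n₀ : ℕ) : ℤ)⟩

@[simp] theorem par_idx (n₀ : ℕ) (Q : DSq) : (Q.par n₀).idx = Q.idx - 1 := rfl

variable {n₀ : ℕ}

theorem par_cell (hθ : θ = (1 / 2) ^ n₀) (i : ℕ) (x : E2) :
    (cell θ μ (i + 1) x).par n₀ = cell θ μ i x := by
  simp only [par, cell, Nat.add_sub_cancel]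
  congr 1
  funext j
  rw [← Int.floor_div_natCast]
  congr 1
  rw [div_div]
  congr 1
  have : θ * ((2 ^ n₀ : ℕ) : ℝ) = 1 := by
    rw [hθ]
    push_cast
    rw [← mul_pow]
    norm_num
  rw [pow_succ]
  linear_combination 2 * μ * θ ^ i * this

theorem abs_ctr_sub_ctr_par_le (hθ : θ = (1 / 2) ^ n₀) (hμ : 0 < μ) {Q : DSq} (hQ : 1 ≤ Q.idx)
    (j : Fin 2) :
    |Q.ctr θ μ j - (Q.par n₀).ctr θ μ j| ≤ (Q.par n₀).sc θ μ - Q.sc θ μ := by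
  obtain ⟨i, p⟩ := Q
  obtain ⟨i, rfl⟩ : ∃ k, i = k + 1 := ⟨i - 1, by simp at hQ; omega⟩
  have hθ0 : 0 < θ := by rw [hθ]; positivity
  have e : θ * ((2 ^ n₀ : ℕ) : ℝ) = 1 := by
    rw [hθ]
    push_cast
    rw [← mul_pow]
    norm_num
  have h1 := Int.emod_add_mul_ediv (p j) ((2 ^ n₀ : ℕ) : ℤ)
  have h2 := Int.emod_nonneg (p j) (b := ((2 ^ n₀ : ℕ) : ℤ)) (by positivity)
  have h3 := Int.emod_lt_of_pos (p j) (b := ((2 ^ n₀ : ℕ) : ℤ)) (by positivity)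
  have h3' : p j % ((2 ^ n₀ : ℕ) : ℤ) + 1 ≤ ((2 ^ n₀ : ℕ) : ℤ) := h3
  generalize hm : p j % ((2 ^ n₀ : ℕ) : ℤ) = m at *
  generalize hq : p j / ((2 ^ n₀ : ℕ) : ℤ) = q at *
  have hpar : (DSq.mk (i + 1) p).par n₀ = ⟨i, fun j => p j / ((2 ^ n₀ : ℕ) : ℤ)⟩ := rfl
  rw [hpar]
  simp only [ctr, sc, hq]
  have c1 : (m : ℝ) + ((2 ^ n₀ : ℕ) : ℝ) * q = p j := by exact_mod_cast h1
  have c2 : (0 : ℝ) ≤ m := by exact_mod_cast h2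
  have c3 : (m : ℝ) + 1 ≤ ((2 ^ n₀ : ℕ) : ℝ) := by exact_mod_cast h3'
  generalize ((2 ^ n₀ : ℕ) : ℝ) = N at *
  have hs : 0 < μ * θ ^ i := by positivity
  rw [pow_succ, ← mul_assoc]
  generalize μ * θ ^ i = s at *
  rw [← c1]
  have e1 : 0 ≤ s * θ * m := by positivity
  have e2 : s * θ * (m + 1) ≤ s * θ * N := mul_le_mul_of_nonneg_left c3 (by positivity)
  have e3 : s * θ * N = s := by rw [mul_assoc, e, mul_one]
  have e4 : s * θ * (N * q) = s * q := by rw [← mul_assoc, e3]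
  rw [abs_le]
  constructor <;> nlinarith

theorem enl_subset_enl_par (hθ : θ = (1 / 2) ^ n₀) (hμ : 0 < μ) {Q : DSq} (hQ : 1 ≤ Q.idx)
    {lam : ℝ} (hl : 1 ≤ lam) : Q.enl θ μ lam ⊆ (Q.par n₀).enl θ μ lam := by
  intro x hx j
  have h := abs_ctr_sub_ctr_par_le hθ hμ hQ j
  have h1 : |x j - (Q.par n₀).ctr θ μ j| ≤ |x j - Q.ctr θ μ j| +
      |Q.ctr θ μ j - (Q.par n₀).ctr θ μ j| := abs_sub_le _ _ _
  have h2 := hx j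
  have h0 : 0 ≤ (Q.par n₀).sc θ μ - Q.sc θ μ := (abs_nonneg _).trans h
  nlinarith

end DSq

end

section

open scoped Pointwise

namespace DSq

variable {θ μ : ℝ} {n₀ : ℕ}

theorem core_cell_subset_Qsq (hθ : θ = (1 / 2) ^ n₀) (hμ : 0 < μ) {i : ℕ} (hi : 1 ≤ n₀ * i)
    {x : E2} (hx : x ∈ Qsq μ) : (cell θ μ i x).core θ μ ⊆ Qsq μ := by
  have hθ0 : 0 < θ := by rw [hθ]; positivity
  obtain ⟨k, hk⟩ : ∃ k, n₀ * i = k + 1 := ⟨n₀ * i - 1, by omega⟩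
  have hs : 0 < 2 * (μ * θ ^ i) := by positivity
  have e : μ = 2 * (μ * θ ^ i) * (2 ^ k : ℤ) := by
    rw [hθ, ← pow_mul, hk, pow_succ]
    push_cast
    have : (1 / 2 : ℝ) ^ k * 2 ^ k = 1 := by
      rw [← mul_pow]
      norm_num
    linear_combination -μ * this
  intro y hy j
  have hxj := abs_lt.1 (hx j)
  have h1 : -(2 ^ k : ℤ) ≤ (cell θ μ i x).pos j := by
    rw [cell, Int.le_floor, le_div_iff₀ hs]
    push_cast at e ⊢
    nlinarith
  have h2 : (cell θ μ i x).pos j < (2 ^ k : ℤ) := by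
    rw [cell, Int.floor_lt, div_lt_iff₀ hs]
    push_cast at e ⊢
    nlinarith
  have hyj := abs_lt.1 (hy j)
  simp only [ctr, sc, cell_idx] at hyj
  generalize (cell θ μ i x).pos j = p at *
  generalize (2 ^ k : ℤ) = N at *
  have h1' : -(N : ℝ) ≤ p := by exact_mod_cast h1
  have h2' : (p : ℝ) + 1 ≤ N := by exact_mod_cast h2
  generalize μ * θ ^ i = s at *
  rw [abs_lt]
  constructor <;> nlinarith

/-- A square is near `L` if its tenfold enlargement meets the set of the next scale. -/
def Near (θ μ : ℝ) (L : ℕ → Set E2) (Q : DSq) : Prop :=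
  (Q.enl θ μ 10 ∩ L (Q.idx + 1)).Nonempty

/-- The maximal squares of scale at least `8` in `Q_μ` which are not near `L`. -/
def leaves (θ μ : ℝ) (n₀ : ℕ) (L : ℕ → Set E2) : Set DSq :=
  {Q | 8 ≤ Q.idx ∧ Q.core θ μ ⊆ Qsq μ ∧ ¬ Q.Near θ μ L ∧
    (Q.idx = 8 ∨ (Q.par n₀).Near θ μ L)}

variable {L : ℕ → Set E2}

theorem Near.par (hθ : θ = (1 / 2) ^ n₀) (hμ : 0 < μ) (hL : Antitone L) {Q : DSq}
    (hQ : 1 ≤ Q.idx) (h : Q.Near θ μ L) : (Q.par n₀).Near θ μ L := by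
  obtain ⟨x, hx, hx'⟩ := h
  exact ⟨x, enl_subset_enl_par hθ hμ hQ (by norm_num) hx, hL (by simp) hx'⟩

theorem near_cell_of_le (hθ : θ = (1 / 2) ^ n₀) (hμ : 0 < μ) (hL : Antitone L) {i k : ℕ}
    (hik : i ≤ k) {x : E2} (h : (cell θ μ k x).Near θ μ L) : (cell θ μ i x).Near θ μ L := by
  induction k, hik using Nat.le_induction with
  | base => exact h
  | succ k hk ih =>
    refine ih ?_
    rw [← par_cell hθ]
    exact h.par hθ hμ hL (by simp)

theorem eq_of_mem_leaves (hθ : θ = (1 / 2) ^ n₀) (hμ : 0 < μ) (hL : Antitone L) {Q₁ Q₂ : DSq}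
    (h₁ : Q₁ ∈ leaves θ μ n₀ L) (h₂ : Q₂ ∈ leaves θ μ n₀ L) {x : E2} (hx₁ : x ∈ Q₁.core θ μ)
    (hx₂ : x ∈ Q₂.core θ μ) : Q₁ = Q₂ := by
  have hθ0 : 0 < θ := by rw [hθ]; positivity
  wlog hle : Q₁.idx ≤ Q₂.idx generalizing Q₁ Q₂
  · exact (this h₂ h₁ hx₂ hx₁ (by omega)).symm
  have e₁ := eq_cell_of_mem_core hθ0 hμ hx₁
  have e₂ := eq_cell_of_mem_core hθ0 hμ hx₂
  rcases hle.eq_or_lt with h | h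
  · rw [e₁, e₂, h]
  · exfalso
    have hn := h₂.2.2.2.resolve_left (by have := h₁.1; omega)
    obtain ⟨k, hk⟩ : ∃ k, Q₂.idx = k + 1 := ⟨Q₂.idx - 1, by omega⟩
    rw [e₂, hk, par_cell hθ] at hn
    have := near_cell_of_le hθ hμ hL (i := Q₁.idx) (by omega) hn
    rw [← e₁] at this
    exact h₁.2.2.1 this

theorem enl_subset_Qsq_of_mem_leaves (hθ0 : 0 < θ) (hμ : 0 < μ) (hb : ∀ i, bdry μ ⊆ L i) {Q : DSq}
    (hQ : Q ∈ leaves θ μ n₀ L) : Q.enl θ μ 10 ⊆ Qsq μ := by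
  refine (Q.convex_enl 10).isPreconnected.subset_left_of_subset_union (isOpen_Qsq μ)
    (isClosed_cSq μ).isOpen_compl ?_ ?_ ⟨Q.ctrPt θ μ, Q.ctrPt_mem_enl hθ0 hμ (by norm_num), ?_⟩
  · exact disjoint_compl_right.mono_left (Qsq_subset_cSq μ)
  · intro x hx
    by_cases h : x ∈ cSq μ
    · left
      rw [← cSq_diff_bdry]
      exact ⟨h, fun hb' => hQ.2.2.1 ⟨x, hx, hb _ hb'⟩⟩
    · exact Or.inr h
  · apply hQ.2.1
    rw [core_eq_enl]
    exact Q.ctrPt_mem_enl hθ0 hμ one_pos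

theorem exists_mem_leaves (hθ : θ = (1 / 2) ^ n₀) (hn : 1 ≤ n₀) (hμ : 0 < μ) {K : Set E2}
    (hK : IsClosed K) {i₀ : ℕ} (hLK : ∀ i, i₀ ≤ i → L i = K) {x : E2}
    (hx : x ∈ Qsq μ) (hxK : x ∉ K) :
    ∃ Q ∈ leaves θ μ n₀ L, x ∈ Q.enl θ μ (3 / 2) := by
  classical
  have hθ0 : 0 < θ := by rw [hθ]; positivity
  have hθ1 : θ < 1 := by rw [hθ]; exact pow_lt_one₀ (by norm_num) (by norm_num) (by omega)
  obtain ⟨ε, hε, hball⟩ := Metric.isOpen_iff.1 hK.isOpen_compl x hxK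
  have hex : ∃ i, 8 ≤ i ∧ ¬ (cell θ μ i x).Near θ μ L := by
    have ht : Filter.Tendsto (fun i : ℕ => 3 / 2 * (11 * (μ * θ ^ i))) Filter.atTop (nhds 0) := by
      have := ((tendsto_pow_atTop_nhds_zero_of_lt_one hθ0.le hθ1).const_mul μ).const_mul 11
      simpa using this.const_mul (3 / 2)
    obtain ⟨i, h1, h2⟩ := ((ht.eventually_lt_const hε).and
      (Filter.eventually_ge_atTop (i₀ + 8))).exists
    refine ⟨i, by omega, ?_⟩
    rintro ⟨z, hz, hzL⟩
    rw [hLK _ (by simp; omega)] at hzL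
    refine hball ?_ hzL
    rw [Metric.mem_ball]
    refine (dist_le_of_forall_abs_sub_le fun j => ?_).trans_lt h1
    have g1 := abs_lt.1 (hz j)
    have g2 := cell_bounds hθ0 hμ i x j
    simp only [sc, cell_idx] at g1
    rw [abs_le]
    constructor <;> linarith
  have hspec := Nat.find_spec hex
  refine ⟨cell θ μ (Nat.find hex) x, ⟨hspec.1, core_cell_subset_Qsq hθ hμ ?_ hx, hspec.2, ?_⟩,
    mem_enl_cell hθ0 hμ _ x (by norm_num)⟩
  · exact Nat.mul_pos hn (by omega)
  · by_cases h : Nat.find hex = 8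
    · exact Or.inl h
    · right
      obtain ⟨k, hk⟩ : ∃ k, Nat.find hex = k + 1 := ⟨Nat.find hex - 1, by omega⟩
      rw [hk, par_cell hθ]
      have := Nat.find_min hex (m := k) (by omega)
      by_contra hc
      exact this ⟨by omega, hc⟩

theorem exists_near_of_mem_leaves (hθ : θ = (1 / 2) ^ n₀) (hμ : 0 < μ) {Q : DSq}
    (hQ : Q ∈ leaves θ μ n₀ L) (h9 : Q.idx ≠ 8) {y : E2} (hy : y ∈ Q.enl θ μ (3 / 2)) :
    ∃ z ∈ L Q.idx, ∀ j, |y j - z j| ≤ 12 * (Q.par n₀).sc θ μ := by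
  have hθ0 : 0 < θ := by rw [hθ]; positivity
  obtain ⟨z, hz, hzL⟩ := hQ.2.2.2.resolve_left h9
  have h8 := hQ.1
  rw [par_idx, Nat.sub_add_cancel (by omega)] at hzL
  refine ⟨z, hzL, fun j => ?_⟩
  have h1 := enl_subset_enl_par hθ hμ (by omega) (by norm_num) hy j
  have h2 := hz j
  have hs := (Q.par n₀).sc_pos hθ0 hμ
  have h3 := abs_sub_le (y j) ((Q.par n₀).ctr θ μ j) (z j)
  rw [abs_sub_comm ((Q.par n₀).ctr θ μ j) (z j)] at h3
  linarith

theorem idx_le_of_mem_leaves (hθ : θ = (1 / 2) ^ n₀) (hθ' : θ ≤ 1 / 128) (hμ : 0 < μ)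
    (hL : Antitone L) {Q₁ Q₂ : DSq} (h₁ : Q₁ ∈ leaves θ μ n₀ L) (h₂ : Q₂ ∈ leaves θ μ n₀ L)
    {x : E2} (hx₁ : x ∈ Q₁.enl θ μ (3 / 2)) (hx₂ : x ∈ Q₂.enl θ μ (3 / 2)) :
    Q₂.idx ≤ Q₁.idx + 1 := by
  by_contra! hlt
  have hθ0 : 0 < θ := by rw [hθ]; positivity
  obtain ⟨z, hz, hd⟩ := exists_near_of_mem_leaves hθ hμ h₂ (by have := h₁.1; omega) hx₂
  refine h₁.2.2.1 ⟨z, fun j => ?_, hL hlt.le hz⟩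
  have h3 := abs_sub_le (z j) (x j) (Q₁.ctr θ μ j)
  have h4 := hx₁ j
  have h5 := hd j
  rw [abs_sub_comm] at h5
  have hs : (Q₂.par n₀).sc θ μ ≤ θ * Q₁.sc θ μ := by
    simp only [sc, par_idx]
    have : θ ^ (Q₂.idx - 1) ≤ θ ^ (Q₁.idx + 1) :=
      pow_le_pow_of_le_one hθ0.le (by linarith) (by omega)
    calc μ * θ ^ (Q₂.idx - 1) ≤ μ * θ ^ (Q₁.idx + 1) := mul_le_mul_of_nonneg_left this hμ.le
      _ = _ := by ring
  have hs₁ := Q₁.sc_pos hθ0 hμ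
  nlinarith

theorem diam_core (hθ0 : 0 < θ) (hμ : 0 < μ) (Q : DSq) :
    Metric.diam (Q.core θ μ) = Q.sc θ μ * Metric.diam (Qsq 1) := by
  have hs := Q.sc_pos hθ0 hμ
  have : Q.core θ μ = (fun x => Q.ctrPt θ μ + x) '' (Q.sc θ μ • Qsq 1) := by
    ext x
    rw [image_add_left, mem_preimage, mem_smul_set_iff_inv_smul_mem₀ hs.ne']
    simp only [core, Qsq, mem_ofPred_eq, PiLp.smul_apply, PiLp.add_apply, PiLp.neg_apply,
      smul_eq_mul, abs_mul, abs_inv, abs_of_pos hs, ctrPt_apply]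
    refine forall_congr' fun j => ?_
    rw [inv_mul_lt_iff₀ hs, mul_one, neg_add_eq_sub]
  rw [this, (isometry_add_left (Q.ctrPt θ μ)).diam_image, diam_smul₀, Real.norm_of_nonneg hs.le]

theorem diam_core_le (hθ : θ = (1 / 2) ^ n₀) (hθ' : θ ≤ 1 / 128) (hμ : 0 < μ)
    (hL : Antitone L) {Q₁ Q₂ : DSq} (h₁ : Q₁ ∈ leaves θ μ n₀ L) (h₂ : Q₂ ∈ leaves θ μ n₀ L)
    (h : (Q₁.enl θ μ (3 / 2) ∩ Q₂.enl θ μ (3 / 2)).Nonempty) :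
    θ * Metric.diam (Q₁.core θ μ) ≤ Metric.diam (Q₂.core θ μ) := by
  have hθ0 : 0 < θ := by rw [hθ]; positivity
  obtain ⟨x, hx₁, hx₂⟩ := h
  have hle := idx_le_of_mem_leaves hθ hθ' hμ hL h₁ h₂ hx₁ hx₂
  rw [diam_core hθ0 hμ, diam_core hθ0 hμ, ← mul_assoc]
  refine mul_le_mul_of_nonneg_right ?_ Metric.diam_nonneg
  simp only [sc]
  calc θ * (μ * θ ^ Q₁.idx) = μ * θ ^ (Q₁.idx + 1) := by ring
    _ ≤ μ * θ ^ Q₂.idx := mul_le_mul_of_nonneg_left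
      (pow_le_pow_of_le_one hθ0.le (by linarith) hle) hμ.le

theorem pos_eq_of_mem_enl (hθ0 : 0 < θ) (hμ : 0 < μ) {Q : DSq} {x : E2}
    (hx : x ∈ Q.enl θ μ (3 / 2)) (j : Fin 2) :
    Q.pos j = ⌊(x j / (μ * θ ^ Q.idx) - 1) / 2⌋ ∨
      Q.pos j = ⌊(x j / (μ * θ ^ Q.idx) - 1) / 2⌋ + 1 := by
  have hs : 0 < μ * θ ^ Q.idx := by positivity
  have h := abs_lt.1 (hx j)
  simp only [ctr, sc] at h
  set s := μ * θ ^ Q.idx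
  obtain ⟨t, ht⟩ : ∃ t, x j = s * t := ⟨x j / s, by field_simp⟩
  rw [ht, mul_div_cancel_left₀ _ hs.ne']
  rw [ht] at h
  have h1 : -(3 / 2) < t - (1 + 2 * Q.pos j) := by
    by_contra! hc
    nlinarith
  have h2 : t - (1 + 2 * Q.pos j) < 3 / 2 := by
    by_contra! hc
    nlinarith
  have h3 := Int.floor_le ((t - 1) / 2)
  have h4 := Int.lt_floor_add_one ((t - 1) / 2)
  generalize ⌊(t - 1) / 2⌋ = f at *
  have h5 : (f : ℝ) < Q.pos j + 1 := by linarith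
  have h6 : (Q.pos j : ℝ) < f + 2 := by linarith
  have h5' : f < Q.pos j + 1 := by exact_mod_cast h5
  have h6' : Q.pos j < f + 2 := by exact_mod_cast h6
  omega

theorem finite_leaves_inter (hθ : θ = (1 / 2) ^ n₀) (hθ' : θ ≤ 1 / 128) (hμ : 0 < μ)
    (hL : Antitone L) (x : E2) :
    {Q ∈ leaves θ μ n₀ L | x ∈ Q.enl θ μ (3 / 2)}.Finite ∧
      {Q ∈ leaves θ μ n₀ L | x ∈ Q.enl θ μ (3 / 2)}.ncard ≤ 8 := by
  classical
  have hθ0 : 0 < θ := by rw [hθ]; positivity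
  set S := {Q ∈ leaves θ μ n₀ L | x ∈ Q.enl θ μ (3 / 2)} with hS
  obtain ⟨i, hi⟩ : ∃ i, ∀ Q ∈ S, Q.idx = i ∨ Q.idx = i + 1 := by
    by_cases hne : ∃ i, ∃ Q ∈ S, Q.idx = i
    · obtain ⟨Q₀, hQ₀, hQi⟩ := Nat.find_spec hne
      refine ⟨Nat.find hne, fun Q hQ => ?_⟩
      have h1 := Nat.find_min' hne ⟨Q, hQ, rfl⟩
      have h2 := idx_le_of_mem_leaves hθ hθ' hμ hL hQ₀.1 hQ.1 hQ₀.2 hQ.2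
      omega
    · exact ⟨0, fun Q hQ => (hne ⟨_, Q, hQ, rfl⟩).elim⟩
  let g : Bool × (Fin 2 → Bool) → DSq := fun p =>
    ⟨if p.1 then i + 1 else i, fun j =>
      ⌊(x j / (μ * θ ^ (if p.1 then i + 1 else i)) - 1) / 2⌋ + if p.2 j then 1 else 0⟩
  have hsub : S ⊆ g '' univ := by
    rintro ⟨k, p⟩ hQ
    have hp := pos_eq_of_mem_enl hθ0 hμ hQ.2
    simp only at hp
    refine ⟨(decide (k = i + 1), fun j =>
      decide (p j ≠ ⌊(x j / (μ * θ ^ k) - 1) / 2⌋)), mem_univ _, ?_⟩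
    have hk : (if decide (k = i + 1) = true then i + 1 else i) = k := by
      rcases hi _ hQ with h | h <;> simp at h <;> simp [h]
    simp only [g, hk]
    congr 1
    funext j
    rcases hp j with h | h <;> simp [h]
  refine ⟨(finite_univ.image g).subset hsub, ?_⟩
  refine (ncard_le_ncard hsub (finite_univ.image g)).trans ((ncard_image_le finite_univ).trans ?_)
  rw [ncard_univ, Nat.card_eq_fintype_card]
  simp

end DSq

end

section

variable {θ μ r : ℝ} {n₀ I : ℕ} {J E : Set E2}

/-- The component of the bad set containing the square is isolated. -/
def DSq.IsIso (θ μ r : ℝ) (J : Set E2) (Q : DSq) : Prop :=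
  Metric.diam (connectedComponentIn (Bset θ μ J Q.idx) (Q.ctrPt θ μ)) ≤
    θ ^ (-((Q.idx : ℝ) * r)) * (μ * θ ^ Q.idx)

/-- Points of the boundary, and points near a bad square that is not isolated. -/
def SeedPt (θ μ r : ℝ) (J : Set E2) (i : ℕ) (y : E2) : Prop :=
  y ∈ bdry μ ∨ ∃ Q ∈ badSq θ μ (Jstar θ μ J) i, ¬ Q.IsIso θ μ r J ∧ y ∈ Q.enl θ μ (3 / 2)

/-- Points near a bad square of scale `k`; at the final scale `I`, all points. -/
def VisPt (θ μ : ℝ) (J : Set E2) (I k : ℕ) (y : E2) : Prop :=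
  k = I ∨ ∃ Q ∈ badSq θ μ (Jstar θ μ J) k, y ∈ Q.enl θ μ (3 / 2)

/-- The part of `E` which survives the removal process down to scale `i`. -/
abbrev keepSet (θ μ r : ℝ) (J E : Set E2) (I i : ℕ) : Set E2 :=
  chainSet E (VisPt θ μ J I) (SeedPt θ μ r J) (fun k => 100 * (μ * θ ^ k)) I i

/-- The leaves on which `J` has large measure. -/
def heavyLeaves (θ μ r : ℝ) (n₀ : ℕ) (J E : Set E2) (I : ℕ) : Set DSq :=
  {Q ∈ DSq.leaves θ μ n₀ (keepSet θ μ r J E I) |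
    ENNReal.ofReal (θ ^ 2 * (μ * θ ^ Q.idx)) < μH[1] (J ∩ Q.enl θ μ (3 / 2))}

theorem finite_setOf_idx_le (hθ : 0 < θ) (hθ1 : θ < 1) (hμ : 0 < μ) (I : ℕ) :
    {Q : DSq | Q.idx ≤ I ∧ Q.core θ μ ⊆ Qsq μ}.Finite := by
  obtain ⟨N, hN⟩ := exists_nat_gt (1 / θ ^ I)
  have hfin : ((Iic I) ×ˢ (Set.pi univ fun _ : Fin 2 => Icc (-(N : ℤ) - 1) (N + 1))).Finite :=
    (finite_Iic I).prod (Finite.pi fun _ => finite_Icc _ _)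
  refine (hfin.image fun p => DSq.mk p.1 p.2).subset ?_
  rintro ⟨i, p⟩ ⟨hi, hQ⟩
  refine ⟨(i, p), ⟨hi, fun j _ => ?_⟩, rfl⟩
  have hc : DSq.ctrPt θ μ ⟨i, p⟩ ∈ Qsq μ := hQ (by
    rw [DSq.core_eq_enl]
    exact DSq.ctrPt_mem_enl hθ hμ _ one_pos)
  have h := abs_lt.1 (hc j)
  simp only [DSq.ctrPt_apply, DSq.ctr, DSq.sc] at h
  have hp : 0 < θ ^ i := by positivity
  have hIi : θ ^ I ≤ θ ^ i := pow_le_pow_of_le_one hθ.le hθ1.le hi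
  have hN' : 1 < N * θ ^ i := by
    rw [div_lt_iff₀ (by positivity)] at hN
    nlinarith [(Nat.cast_nonneg N : (0 : ℝ) ≤ N)]
  have h1 : -1 < θ ^ i * (1 + 2 * p j) := by
    by_contra! hcon
    nlinarith
  have h2 : θ ^ i * (1 + 2 * p j) < 1 := by
    by_contra! hcon
    nlinarith
  have h3 : -(N : ℝ) < 1 + 2 * p j := by
    by_contra! hcon
    nlinarith
  have h4 : (1 + 2 * p j : ℝ) < N := by
    by_contra! hcon
    nlinarith
  have h3' : -(N : ℤ) < 1 + 2 * p j := by exact_mod_cast h3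
  have h4' : 1 + 2 * p j < (N : ℤ) := by exact_mod_cast h4
  change -(N : ℤ) - 1 ≤ p j ∧ p j ≤ N + 1
  constructor <;> omega

theorem closure_enl_subset_component (hθ : 0 < θ) (hμ : 0 < μ) {Q : DSq}
    (hQ : Q ∈ badSq θ μ (Jstar θ μ J) Q.idx) :
    closure (Q.enl θ μ 5) ⊆ connectedComponentIn (Bset θ μ J Q.idx) (Q.ctrPt θ μ) := by
  refine (Q.convex_enl 5).isPreconnected.closure.subset_connectedComponentIn
    (subset_closure (Q.ctrPt_mem_enl hθ hμ (by norm_num))) ?_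
  exact fun x hx => mem_iUnion₂.2 ⟨Q, hQ, hx⟩

theorem closure_enl_subset_isoU (hθ : 0 < θ) (hμ : 0 < μ) {Q : DSq}
    (hQ : Q ∈ badSq θ μ (Jstar θ μ J) Q.idx) (hi : Q.IsIso θ μ r J) :
    closure (Q.enl θ μ 3) ⊆ isoU θ μ J r Q.idx := by
  intro x hx
  refine Or.inl (mem_iUnion₂.2 ⟨Q.ctrPt θ μ, ⟨?_, hi⟩, closure_enl_subset_component hθ hμ hQ
    (closure_mono (Q.enl_mono hθ hμ (by norm_num)) hx)⟩)
  exact mem_iUnion₂.2 ⟨Q, hQ, subset_closure (Q.ctrPt_mem_enl hθ hμ (by norm_num))⟩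

theorem bdry_subset_keepSet (hbE : bdry μ ⊆ E) (i : ℕ) : bdry μ ⊆ keepSet θ μ r J E I i :=
  subset_chainSet hbE (fun _ _ hy => Or.inl hy) i

theorem inter_enl_eq_empty_of_lt (hθ : θ = (1 / 2) ^ n₀) (hθ' : θ ≤ 1 / 128) (hμ : 0 < μ)
    (hI : 8 ≤ I) (hgap : ∀ y ∈ J \ E, ∀ z ∈ E, 100 * (μ * θ ^ I) < dist y z) {Q : DSq}
    (hQ : Q ∈ DSq.leaves θ μ n₀ (keepSet θ μ r J E I)) (hlt : I + 1 ≤ Q.idx) :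
    J ∩ Q.enl θ μ (3 / 2) = ∅ := by
  have hθ0 : 0 < θ := by rw [hθ]; positivity
  by_contra hne
  obtain ⟨y, hyJ, hyQ⟩ := nonempty_iff_ne_empty.2 hne
  obtain ⟨z, hz, hd⟩ := DSq.exists_near_of_mem_leaves hθ hμ hQ (by omega) hyQ
  have hdist : dist y z ≤ 100 * (μ * θ ^ I) := by
    refine (dist_le_of_forall_abs_sub_le hd).trans ?_
    have : (Q.par n₀).sc θ μ ≤ μ * θ ^ I := by
      simp only [DSq.sc, DSq.par_idx]
      exact mul_le_mul_of_nonneg_left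
        (pow_le_pow_of_le_one hθ0.le (by linarith) (by omega)) hμ.le
    have h0 : 0 < μ * θ ^ I := by positivity
    linarith
  by_cases hyE : y ∈ E
  · have hyK : y ∈ keepSet θ μ r J E I Q.idx :=
      mem_chainSet_of_dist_le (fun y => Or.inl rfl) hyE hz hdist
    refine hQ.2.2.1 ⟨y, Q.enl_mono hθ0 hμ (by norm_num) hyQ, ?_⟩
    rw [keepSet, chainSet_of_lt (by omega)] at hyK ⊢
    exact hyK
  · exact (hgap y ⟨hyJ, hyE⟩ z (chainSet_subset _ hz)).not_ge hdist

theorem exists_mem_of_mem_heavyLeaves (hθ : θ = (1 / 2) ^ n₀) (hθ' : θ ≤ 1 / 128) (hμ : 0 < μ)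
    (hI : 8 ≤ I) (hnull : μH[1] (J \ E) = 0)
    (hgap : ∀ y ∈ J \ E, ∀ z ∈ E, 100 * (μ * θ ^ I) < dist y z) {Q : DSq}
    (hQ : Q ∈ heavyLeaves θ μ r n₀ J E I) :
    8 ≤ Q.idx ∧ Q.idx ≤ I ∧ Q ∈ badSq θ μ (Jstar θ μ J) Q.idx ∧
      (∃ y ∈ keepSet θ μ r J E I Q.idx, y ∈ E ∧ y ∈ Q.enl θ μ (3 / 2) ∧
        y ∉ keepSet θ μ r J E I (Q.idx + 1)) ∧ Q.IsIso θ μ r J := by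
  have hθ0 : 0 < θ := by rw [hθ]; positivity
  obtain ⟨hl, hm⟩ := hQ
  have h8 := hl.1
  have hQI : Q.idx ≤ I := by
    by_contra! hc
    rw [inter_enl_eq_empty_of_lt hθ hθ' hμ hI hgap hl hc, measure_empty] at hm
    exact not_lt_bot hm
  have hbad : ∀ P : DSq, ENNReal.ofReal (θ ^ 3 * (μ * θ ^ P.idx)) ≤
      ENNReal.ofReal (θ ^ 2 * (μ * θ ^ Q.idx)) →
      Q.enl θ μ (3 / 2) ⊆ P.enl θ μ (3 / 2) → P ∈ badSq θ μ (Jstar θ μ J) P.idx := by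
    intro P h1 h2
    exact ⟨rfl, h1.trans (hm.le.trans (measure_mono
      (inter_subset_inter subset_union_left h2)))⟩
  have hQbad : Q ∈ badSq θ μ (Jstar θ μ J) Q.idx := by
    refine hbad Q (ENNReal.ofReal_le_ofReal ?_) Subset.rfl
    exact mul_le_mul_of_nonneg_right
      (pow_le_pow_of_le_one hθ0.le (by linarith) (by norm_num)) (by positivity)
  obtain ⟨y, hyE, hyQ⟩ : ∃ y, y ∈ E ∧ y ∈ Q.enl θ μ (3 / 2) := by
    by_contra! hc
    have : J ∩ Q.enl θ μ (3 / 2) ⊆ J \ E := fun y hy => ⟨hy.1, fun h => hc y h hy.2⟩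
    rw [measure_mono_null this hnull] at hm
    exact not_lt_bot hm
  have hnot : y ∉ keepSet θ μ r J E I (Q.idx + 1) := fun h =>
    hl.2.2.1 ⟨y, Q.enl_mono hθ0 hμ (by norm_num) hyQ, h⟩
  have hyK : y ∈ keepSet θ μ r J E I Q.idx := by
    by_cases h : Q.idx = 8
    · rw [h, keepSet, chainSet_of_le le_rfl]
      exact hyE
    · obtain ⟨z, hz, hd⟩ := DSq.exists_near_of_mem_leaves hθ hμ hl h hyQ
      have hpb : Q.par n₀ ∈ badSq θ μ (Jstar θ μ J) (Q.par n₀).idx := by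
        refine hbad _ (le_of_eq ?_) (DSq.enl_subset_enl_par hθ hμ (by omega) (by norm_num))
        congr 1
        obtain ⟨k, hk⟩ : ∃ k, Q.idx = k + 1 := ⟨Q.idx - 1, by omega⟩
        rw [DSq.par_idx, hk, Nat.add_sub_cancel]
        ring
      have hs := (Q.par n₀).sc_pos hθ0 hμ
      have := mem_chainSet_succ_of_vis (E := E) (vis := VisPt θ μ J I) (seed := SeedPt θ μ r J)
        (ρ := fun k => 100 * (μ * θ ^ k)) (I := I) (i := Q.idx - 1) (k := Q.idx - 1)
        (by omega) le_rfl (by omega) hyE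
        (Or.inr ⟨_, hpb, DSq.enl_subset_enl_par hθ hμ (by omega) (by norm_num) hyQ⟩) (z := z)
        (by rwa [Nat.sub_add_cancel (by omega)])
        ((dist_le_of_forall_abs_sub_le hd).trans (by
          simp only [DSq.sc, DSq.par_idx] at *
          linarith))
      rwa [Nat.sub_add_cancel (by omega)] at this
  refine ⟨h8, hQI, hQbad, ⟨y, hyK, hyE, hyQ, hnot⟩, ?_⟩
  by_contra hiso
  exact hnot (mem_chainSet_succ_of_seed hyK (Or.inr ⟨Q, hQbad, hiso, hyQ⟩))

theorem measure_inter_enl_le_of_adjacent (hθ : θ = (1 / 2) ^ n₀) (hθ' : θ ≤ 1 / 128) (hμ : 0 < μ)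
    (hI : 8 ≤ I) (hnull : μH[1] (J \ E) = 0)
    (hgap : ∀ y ∈ J \ E, ∀ z ∈ E, 100 * (μ * θ ^ I) < dist y z) {Q Q' : DSq}
    (hQ : Q ∈ DSq.leaves θ μ n₀ (keepSet θ μ r J E I))
    (hQ' : Q' ∈ DSq.leaves θ μ n₀ (keepSet θ μ r J E I))
    (hidx : Q'.idx + 1 = Q.idx ∨ Q'.idx = Q.idx + 1)
    (hne : (Q.enl θ μ 3 ∩ Q'.enl θ μ 3).Nonempty) :
    μH[1] (J ∩ Q.enl θ μ (3 / 2)) ≤ ENNReal.ofReal (θ ^ 2 * (μ * θ ^ Q.idx)) := by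
  have hθ0 : 0 < θ := by rw [hθ]; positivity
  by_contra! hheavy
  obtain ⟨h8, hQI, hbad, ⟨y, hyK, hyE, hyQ, hnot⟩, -⟩ :=
    exists_mem_of_mem_heavyLeaves hθ hθ' hμ hI hnull hgap ⟨hQ, hheavy⟩
  obtain ⟨w, hw, hw'⟩ := hne
  have hs := Q.sc_pos hθ0 hμ
  have hs' := Q'.sc_pos hθ0 hμ
  rcases hidx with h | h
  · refine hQ'.2.2.1 ⟨y, fun j => ?_, h ▸ hyK⟩
    have e : Q.sc θ μ = θ * Q'.sc θ μ := by
      simp only [DSq.sc, ← h]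
      ring
    have h1 := abs_lt.1 (hyQ j)
    have h2 := abs_lt.1 (hw j)
    have h3 := abs_lt.1 (hw' j)
    have h4 : Q.sc θ μ ≤ Q'.sc θ μ / 128 := by rw [e]; nlinarith
    rw [abs_lt]
    constructor <;> linarith
  · obtain ⟨z, hz, hd⟩ := DSq.exists_near_of_mem_leaves hθ hμ hQ' (by omega)
      (Q'.ctrPt_mem_enl hθ0 hμ (by norm_num))
    rw [h] at hz
    have ep : (Q'.par n₀).sc θ μ = Q.sc θ μ := by
      simp [DSq.sc, DSq.par_idx, h]
    have e : Q'.sc θ μ = θ * Q.sc θ μ := by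
      simp only [DSq.sc, h]
      ring
    rw [ep] at hd
    have hdist : dist y z ≤ 100 * (μ * θ ^ Q.idx) := by
      have h4 : Q'.sc θ μ ≤ Q.sc θ μ / 128 := by rw [e]; nlinarith
      refine (dist_le_of_forall_abs_sub_le (d := 20 * Q.sc θ μ) fun j => ?_).trans ?_
      · have h1 := abs_lt.1 (hyQ j)
        have h2 := abs_lt.1 (hw j)
        have h3 := abs_lt.1 (hw' j)
        have h5 := abs_le.1 (hd j)
        rw [DSq.ctrPt_apply] at h5
        rw [abs_le]
        constructor <;> linarith
      · simp only [DSq.sc] at hs ⊢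
        linarith
    exact hnot (mem_chainSet_succ_of_vis h8 le_rfl hQI hyE (Or.inr ⟨Q, hbad, hyQ⟩) hz hdist)

theorem isClosed_biUnion_heavyLeaves (hθ : θ = (1 / 2) ^ n₀) (hθ' : θ ≤ 1 / 128) (hμ : 0 < μ)
    (hI : 8 ≤ I) (hnull : μH[1] (J \ E) = 0)
    (hgap : ∀ y ∈ J \ E, ∀ z ∈ E, 100 * (μ * θ ^ I) < dist y z) :
    IsClosed (⋃ Q ∈ heavyLeaves θ μ r n₀ J E I, closure (Q.enl θ μ 3)) := by
  have hθ0 : 0 < θ := by rw [hθ]; positivity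
  refine Finite.isClosed_biUnion ?_ fun Q _ => isClosed_closure
  refine (finite_setOf_idx_le hθ0 (by linarith) hμ I).subset fun Q hQ => ?_
  exact ⟨(exists_mem_of_mem_heavyLeaves hθ hθ' hμ hI hnull hgap hQ).2.1, hQ.1.2.1⟩

end

section

section Components

variable {X : Type*} [TopologicalSpace X] {Γ Γ' S : Set X} {x y : X}

theorem connectedComponentIn_eq_of_isPreconnected (hS : IsPreconnected S) (hΓ : S ⊆ Γ)
    (hx : x ∈ S) (hy : y ∈ S) : connectedComponentIn Γ x = connectedComponentIn Γ y :=
  connectedComponentIn_eq (hS.subset_connectedComponentIn hx hΓ hy)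

theorem connectedComponentIn_eq_of_subset (h : Γ ⊆ Γ') (hx : x ∈ Γ) (hy : y ∈ Γ)
    (hxy : connectedComponentIn Γ x = connectedComponentIn Γ y) :
    connectedComponentIn Γ' x = connectedComponentIn Γ' y :=
  connectedComponentIn_eq_of_isPreconnected isPreconnected_connectedComponentIn
    ((connectedComponentIn_subset Γ x).trans h) (mem_connectedComponentIn hx)
    (hxy ▸ mem_connectedComponentIn hy)

theorem image_connectedComponentIn_of_subset {K : Set X} (hK : K ⊆ Γ) (h : Γ ⊆ Γ') :
    (connectedComponentIn Γ') '' K =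
      (fun C => ⋃ x ∈ C, connectedComponentIn Γ' x) '' (connectedComponentIn Γ '' K) := by
  rw [image_image]
  refine image_congr fun x hx => ?_
  refine Subset.antisymm (fun y hy => mem_iUnion₂.2 ⟨x, mem_connectedComponentIn (hK hx), hy⟩) ?_
  refine iUnion₂_subset fun y hy => ?_
  rw [connectedComponentIn_eq_of_isPreconnected isPreconnected_connectedComponentIn
    ((connectedComponentIn_subset Γ x).trans h) hy (mem_connectedComponentIn (hK hx))]

theorem ncard_image_connectedComponentIn_lt {K : Set X} (hK : K ⊆ Γ) (h : Γ ⊆ Γ')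
    (hfin : (connectedComponentIn Γ '' K).Finite) (hx : x ∈ K) (hy : y ∈ K)
    (hne : connectedComponentIn Γ x ≠ connectedComponentIn Γ y)
    (heq : connectedComponentIn Γ' x = connectedComponentIn Γ' y) :
    ((connectedComponentIn Γ') '' K).ncard < (connectedComponentIn Γ '' K).ncard := by
  rw [image_connectedComponentIn_of_subset hK h]
  refine lt_of_le_of_ne (ncard_image_le hfin) fun hc => hne ?_
  refine (ncard_image_iff hfin).1 hc (mem_image_of_mem _ hx) (mem_image_of_mem _ hy) ?_
  have key : ∀ z ∈ K, ⋃ w ∈ connectedComponentIn Γ z, connectedComponentIn Γ' w =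
      connectedComponentIn Γ' z := by
    intro z hz
    refine Subset.antisymm (iUnion₂_subset fun w hw => ?_)
      (fun w hw => mem_iUnion₂.2 ⟨z, mem_connectedComponentIn (hK hz), hw⟩)
    rw [connectedComponentIn_eq_of_isPreconnected isPreconnected_connectedComponentIn
      ((connectedComponentIn_subset Γ z).trans h) hw (mem_connectedComponentIn (hK hz))]
  simp only [key x hx, key y hy, heq]

end Components

/-- `Γ` is a finite union of segments in the closed square containing `K`, each component of
which meets `K`, and having finitely many components. -/
structure Extends (μ : ℝ) (K Γ : Set E2) : Prop where
  finSegUnion : FinSegUnion Γ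
  subset_cSq : Γ ⊆ cSq μ
  subset : K ⊆ Γ
  meets : ∀ x ∈ Γ, ∃ k ∈ K, connectedComponentIn Γ x = connectedComponentIn Γ k
  finite : (connectedComponentIn Γ '' K).Finite

theorem Extends.union_segment {μ : ℝ} {K Γ : Set E2} (h : Extends μ K Γ) {x y : E2} (hx : x ∈ K)
    (hy : y ∈ K) : Extends μ K (Γ ∪ segment ℝ x y) where
  finSegUnion := h.finSegUnion.union (finSegUnion_segment x y)
  subset_cSq := union_subset h.subset_cSq
    ((convex_cSq μ).segment_subset (h.subset_cSq (h.subset hx)) (h.subset_cSq (h.subset hy)))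
  subset := h.subset.trans subset_union_left
  meets := by
    rintro z (hz | hz)
    · obtain ⟨k, hk, e⟩ := h.meets z hz
      exact ⟨k, hk, connectedComponentIn_eq_of_subset subset_union_left hz (h.subset hk) e⟩
    · exact ⟨x, hx, connectedComponentIn_eq_of_isPreconnected
        (convex_segment x y).isPreconnected subset_union_right hz (left_mem_segment _ _ _)⟩
  finite := by
    rw [image_connectedComponentIn_of_subset h.subset subset_union_left]
    exact h.finite.image _

theorem hausdorffMeasure_segment_le {x y : E2} {R : ℝ} (h : dist x y ≤ R) :
    μH[1] (segment ℝ x y) ≤ ENNReal.ofReal R := by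
  rw [hausdorffMeasure_segment, edist_dist]
  exact ENNReal.ofReal_le_ofReal h

/-- Joining by segments the components at mutual distance at most `R`. -/
theorem Extends.exists_merge {μ : ℝ} {K Γ : Set E2} (h : Extends μ K Γ) (R : ℝ) {n : ℕ}
    (hn : (connectedComponentIn Γ '' K).ncard ≤ n + 1) :
    ∃ Γ', Extends μ K Γ' ∧ μH[1] Γ' ≤ μH[1] Γ + n * ENNReal.ofReal R ∧
      ∀ x ∈ K, ∀ y ∈ K, dist x y ≤ R →
        connectedComponentIn Γ' x = connectedComponentIn Γ' y := by
  induction n generalizing Γ with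
  | zero =>
    refine ⟨Γ, h, by simp, fun x hx y hy _ => ?_⟩
    exact ncard_le_one_iff h.finite |>.1 hn (mem_image_of_mem _ hx) (mem_image_of_mem _ hy)
  | succ n ih =>
    by_cases hall : ∀ x ∈ K, ∀ y ∈ K, dist x y ≤ R →
        connectedComponentIn Γ x = connectedComponentIn Γ y
    · exact ⟨Γ, h, le_self_add, hall⟩
    · push Not at hall
      obtain ⟨x, hx, y, hy, hd, hne⟩ := hall
      have h' := h.union_segment hx hy
      have hlt := ncard_image_connectedComponentIn_lt h.subset
        (subset_union_left (t := segment ℝ x y)) h.finite hx hy hne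
        (connectedComponentIn_eq_of_isPreconnected (convex_segment x y).isPreconnected
          subset_union_right (left_mem_segment _ _ _) (right_mem_segment _ _ _))
      obtain ⟨Γ', e, hm, hs⟩ := ih h' (by omega)
      refine ⟨Γ', e, hm.trans ?_, hs⟩
      calc μH[1] (Γ ∪ segment ℝ x y) + n * ENNReal.ofReal R
          ≤ (μH[1] Γ + ENNReal.ofReal R) + n * ENNReal.ofReal R := by
            gcongr
            exact (measure_union_le _ _).trans
              (add_le_add le_rfl (hausdorffMeasure_segment_le hd))
        _ = _ := by
            push_cast
            ring

end

section

namespace DSq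

variable {θ μ : ℝ}

/-- A ball around the square, large compared to the square. -/
def bigBall (θ μ : ℝ) (Q : DSq) : Set E2 := Metric.closedBall (Q.ctrPt θ μ) (200 * Q.sc θ μ)

instance : Countable DSq := by
  have : Function.Injective fun Q : DSq => (Q.idx, Q.pos) := by
    rintro ⟨i, p⟩ ⟨j, q⟩ h
    simp only [Prod.mk.injEq] at h
    rw [h.1, h.2]
  exact this.countable

theorem dist_ctrPt_le_of_mem_closure_enl (hθ : 0 < θ) (hμ : 0 < μ) {Q : DSq} {lam : ℝ}
    (hl : 0 < lam) {x : E2} (hx : x ∈ closure (Q.enl θ μ lam)) :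
    dist x (Q.ctrPt θ μ) ≤ 3 / 2 * (lam * Q.sc θ μ) := by
  rw [closure_enl hθ hμ Q hl] at hx
  exact dist_le_of_forall_abs_sub_le hx

theorem closure_enl_subset_bigBall (hθ : 0 < θ) (hμ : 0 < μ) (Q : DSq) {lam : ℝ}
    (hl : 0 < lam) (hl' : lam ≤ 5) : closure (Q.enl θ μ lam) ⊆ Q.bigBall θ μ := by
  intro x hx
  refine (dist_ctrPt_le_of_mem_closure_enl hθ hμ hl hx).trans ?_
  have := Q.sc_pos hθ hμ
  nlinarith

theorem ctrPt_mem_bigBall (hθ : 0 < θ) (hμ : 0 < μ) (Q : DSq) : Q.ctrPt θ μ ∈ Q.bigBall θ μ :=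
  Metric.mem_closedBall_self (by have := Q.sc_pos hθ hμ; positivity)

theorem isPreconnected_bigBall (Q : DSq) : IsPreconnected (Q.bigBall θ μ) :=
  (convex_closedBall _ _).isPreconnected

/-- If the balls around squares of large measure are enough to cover an interval under a
`1`-Lipschitz map, then the measure near them is at least comparable to the length. -/
theorem ofReal_mul_sub_le_measure (hθ : 0 < θ) (hμ : 0 < μ) {R c : ℝ} (hc : 0 ≤ c)
    (ν : Measure E2) {𝒬 : Set DSq} (hR : ∀ Q ∈ 𝒬, Q.sc θ μ ≤ R)
    (hν : ∀ Q ∈ 𝒬, ENNReal.ofReal (c * Q.sc θ μ) ≤ ν (Q.enl θ μ (3 / 2)))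
    {f : E2 → ℝ} (hf : LipschitzWith 1 f) {α β : ℝ}
    (hcov : Icc α β ⊆ f '' ⋃ Q ∈ 𝒬, Q.bigBall θ μ) {W : Set E2}
    (hW : ∀ Q ∈ 𝒬, (∃ x ∈ Q.bigBall θ μ, f x ∈ Icc α β) → Q.enl θ μ (3 / 2) ⊆ W) :
    ENNReal.ofReal (c * (β - α)) ≤ 2000 * ν W := by
  obtain ⟨u, hu, hdisj, hcover⟩ := Vitali.exists_disjoint_subfamily_covering_enlargement_closedBall
    {Q ∈ 𝒬 | ∃ x ∈ Q.bigBall θ μ, f x ∈ Icc α β} (fun Q => Q.ctrPt θ μ) (fun Q => 200 * Q.sc θ μ)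
    (200 * R) (fun Q hQ => by linarith [hR Q hQ.1]) 5 (by norm_num)
  have hsub : Icc α β ⊆ ⋃ Q ∈ u,
      Metric.closedBall (f (Q.ctrPt θ μ)) (1000 * Q.sc θ μ) := by
    intro t ht
    obtain ⟨x, hx, rfl⟩ := hcov ht
    obtain ⟨Q, hQ, hxQ⟩ := mem_iUnion₂.1 hx
    obtain ⟨P, hP, hsub⟩ := hcover Q ⟨hQ, x, hxQ, ht⟩
    refine mem_iUnion₂.2 ⟨P, hP, ?_⟩
    have h1 := Metric.mem_closedBall.1 (hsub hxQ)
    have h2 := hf.dist_le_mul x (P.ctrPt θ μ)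
    simp only [NNReal.coe_one, one_mul] at h2
    rw [Metric.mem_closedBall]
    linarith
  have hvol : ENNReal.ofReal (β - α) ≤ ∑' Q : u, ENNReal.ofReal (2000 * (Q : DSq).sc θ μ) := by
    rw [← Real.volume_Icc]
    refine (measure_mono hsub).trans ((measure_biUnion_le _ (to_countable u) _).trans ?_)
    refine ENNReal.tsum_le_tsum fun Q => ?_
    rw [Real.volume_closedBall]
    exact ENNReal.ofReal_le_ofReal (by linarith)
  calc ENNReal.ofReal (c * (β - α)) = ENNReal.ofReal c * ENNReal.ofReal (β - α) :=
        ENNReal.ofReal_mul hc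
    _ ≤ ENNReal.ofReal c * ∑' Q : u, ENNReal.ofReal (2000 * (Q : DSq).sc θ μ) := by gcongr
    _ = ∑' Q : u, 2000 * ENNReal.ofReal (c * (Q : DSq).sc θ μ) := by
        rw [← ENNReal.tsum_mul_left]
        congr 1 with Q
        rw [ENNReal.ofReal_mul (by norm_num), ENNReal.ofReal_mul hc, ENNReal.ofReal_ofNat]
        ring
    _ ≤ ∑' Q : u, 2000 * ν ((Q : DSq).enl θ μ (3 / 2)) := by
        refine ENNReal.tsum_le_tsum fun Q => ?_
        gcongr
        exact hν Q (hu Q.2).1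
    _ = 2000 * ν (⋃ Q ∈ u, Q.enl θ μ (3 / 2)) := by
        rw [ENNReal.tsum_mul_left, measure_biUnion (to_countable u) _
          fun Q _ => (isOpen_enl Q _).measurableSet]
        exact hdisj.mono fun Q => subset_closure.trans
          (closure_enl_subset_bigBall hθ hμ Q (by norm_num) (by norm_num))
    _ ≤ 2000 * ν W := by
        gcongr
        exact iUnion₂_subset fun Q hQ => hW Q (hu hQ).1 (hu hQ).2

end DSq

end

section

variable {θ μ r : ℝ} {n₀ I : ℕ} {J E : Set E2}

/-- A point of the boundary, or a point joined by balls around bad squares of scale between `i`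
and `I` to the boundary or to a large set. -/
def Reaches (θ μ r : ℝ) (J : Set E2) (I i : ℕ) (y : E2) : Prop :=
  y ∈ bdry μ ∨ ∃ 𝒬 : Set DSq,
    (∀ Q ∈ 𝒬, i ≤ Q.idx ∧ Q.idx ≤ I ∧ Q ∈ badSq θ μ (Jstar θ μ J) Q.idx) ∧
    IsPreconnected (⋃ Q ∈ 𝒬, Q.bigBall θ μ) ∧ y ∈ ⋃ Q ∈ 𝒬, Q.bigBall θ μ ∧
    (((⋃ Q ∈ 𝒬, Q.bigBall θ μ) ∩ bdry μ).Nonempty ∨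
      ∃ g₁ ∈ ⋃ Q ∈ 𝒬, Q.bigBall θ μ, ∃ g₂ ∈ ⋃ Q ∈ 𝒬, Q.bigBall θ μ,
        θ ^ (-((i : ℝ) * r)) * (μ * θ ^ i) < dist g₁ g₂)

theorem isPreconnected_biUnion_bigBall (hθ : 0 < θ) (hμ : 0 < μ) {Q : DSq}
    (hQ : Q ∈ badSq θ μ (Jstar θ μ J) Q.idx) :
    connectedComponentIn (Bset θ μ J Q.idx) (Q.ctrPt θ μ) ⊆
      ⋃ P ∈ {P ∈ badSq θ μ (Jstar θ μ J) Q.idx |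
        P.ctrPt θ μ ∈ connectedComponentIn (Bset θ μ J Q.idx) (Q.ctrPt θ μ)}, P.bigBall θ μ ∧
    IsPreconnected (⋃ P ∈ {P ∈ badSq θ μ (Jstar θ μ J) Q.idx |
        P.ctrPt θ μ ∈ connectedComponentIn (Bset θ μ J Q.idx) (Q.ctrPt θ μ)},
      P.bigBall θ μ) := by
  set N := connectedComponentIn (Bset θ μ J Q.idx) (Q.ctrPt θ μ) with hN
  set 𝒬 := {P ∈ badSq θ μ (Jstar θ μ J) Q.idx | P.ctrPt θ μ ∈ N} with h𝒬
  have hsub : N ⊆ ⋃ P ∈ 𝒬, P.bigBall θ μ := by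
    intro x hx
    obtain ⟨P, hP, hxP⟩ := mem_iUnion₂.1 (connectedComponentIn_subset _ _ hx)
    have hPi : P.idx = Q.idx := hP.1
    have hPc := closure_enl_subset_component (Q := P) hθ hμ (by rwa [hPi])
    rw [hPi] at hPc
    have hmem : P.ctrPt θ μ ∈ N := by
      rw [hN, connectedComponentIn_eq hx, ← connectedComponentIn_eq (hPc hxP)]
      exact hPc (subset_closure (P.ctrPt_mem_enl hθ hμ (by norm_num)))
    exact mem_iUnion₂.2 ⟨P, ⟨hP, hmem⟩, P.closure_enl_subset_bigBall hθ hμ (by norm_num) le_rfl hxP⟩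
  refine ⟨hsub, ?_⟩
  have hQN : Q.ctrPt θ μ ∈ N := closure_enl_subset_component hθ hμ hQ
    (subset_closure (Q.ctrPt_mem_enl hθ hμ (by norm_num)))
  have e : ⋃ P ∈ 𝒬, P.bigBall θ μ = ⋃ P : 𝒬, N ∪ (P : DSq).bigBall θ μ := by
    rw [biUnion_eq_iUnion]
    refine Subset.antisymm (iUnion_mono fun P => subset_union_right) (iUnion_subset fun P => ?_)
    refine union_subset ?_ (subset_iUnion (fun P : 𝒬 => (P : DSq).bigBall θ μ) P)
    rwa [← biUnion_eq_iUnion (s := 𝒬) (t := fun P _ => P.bigBall θ μ)]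
  rw [e]
  refine isPreconnected_iUnion ⟨Q.ctrPt θ μ, mem_iInter.2 fun P => Or.inl hQN⟩ fun P => ?_
  exact IsPreconnected.union _ P.2.2 ((P : DSq).ctrPt_mem_bigBall hθ hμ)
    isPreconnected_connectedComponentIn (P : DSq).isPreconnected_bigBall

theorem SeedPt.reaches (hθ : 0 < θ) (hμ : 0 < μ) {i : ℕ} (hi : i ≤ I) {y : E2}
    (hy : SeedPt θ μ r J i y) : Reaches θ μ r J I i y := by
  rcases hy with hy | ⟨Q, hQ, hiso, hyQ⟩
  · exact Or.inl hy
  · obtain rfl : Q.idx = i := hQ.1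
    obtain ⟨hsub, hcon⟩ := isPreconnected_biUnion_bigBall hθ hμ hQ
    refine Or.inr ⟨_, ?_, hcon, hsub (closure_enl_subset_component hθ hμ hQ
      (subset_closure (Q.enl_mono hθ hμ (by norm_num) hyQ))), Or.inr ?_⟩
    · rintro P ⟨hP, -⟩
      have hPi : P.idx = Q.idx := hP.1
      rw [hPi]
      exact ⟨le_rfl, hi, hP⟩
    · by_contra! hall
      exact hiso (Metric.diam_le_of_forall_dist_le (by positivity)
        fun a ha b hb => hall a (hsub ha) b (hsub hb))

theorem reaches_of_mem_keepSet_succ (hθ : 0 < θ) (hμ : 0 < μ)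
    (hvis : ∀ y ∈ E, y ∉ bdry μ → ∃ Q ∈ badSq θ μ (Jstar θ μ J) I, y ∈ Q.enl θ μ (3 / 2))
    {i : ℕ} (h8 : 8 ≤ i) (hi : i ≤ I) {y : E2} (hy : y ∈ keepSet θ μ r J E I (i + 1)) :
    Reaches θ μ r J I i y := by
  obtain ⟨-, s, -, hs, hchain⟩ := (mem_chainSet_succ h8 hi).1 hy
  clear hy
  induction hchain using Relation.ReflTransGen.head_induction_on with
  | refl => exact hs.reaches hθ hμ hi
  | @head y z hstep _ ih =>
    obtain ⟨hyE, hzE, k, hik, hkI, hv, hd⟩ := hstep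
    by_cases hyb : y ∈ bdry μ
    · exact Or.inl hyb
    obtain ⟨Q, hQ, hyQ⟩ : ∃ Q ∈ badSq θ μ (Jstar θ μ J) k, y ∈ Q.enl θ μ (3 / 2) := by
      rcases hv with rfl | hv
      · exact hvis y hyE hyb
      · exact hv
    obtain rfl : Q.idx = k := hQ.1
    have hyB : y ∈ Q.bigBall θ μ :=
      Q.closure_enl_subset_bigBall hθ hμ (by norm_num) (by norm_num) (subset_closure hyQ)
    have hzB : z ∈ Q.bigBall θ μ := by
      have h1 := DSq.dist_ctrPt_le_of_mem_closure_enl hθ hμ (by norm_num) (subset_closure hyQ)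
      have h2 := dist_triangle_left z (Q.ctrPt θ μ) y
      have h3 := Q.sc_pos hθ hμ
      rw [DSq.bigBall, Metric.mem_closedBall]
      simp only [DSq.sc] at *
      linarith
    rcases ih with hzb | ⟨𝒬, h𝒬, hcon, hz, hend⟩
    · refine Or.inr ⟨{Q}, ?_, ?_, ?_, Or.inl ⟨z, ?_, hzb⟩⟩
      · rintro P rfl
        exact ⟨hik, hkI, hQ⟩
      all_goals simp only [biUnion_singleton]
      exacts [Q.isPreconnected_bigBall, hyB, hzB]
    · refine Or.inr ⟨insert Q 𝒬, ?_, ?_, ?_, ?_⟩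
      · rintro P (rfl | hP)
        exacts [⟨hik, hkI, hQ⟩, h𝒬 P hP]
      all_goals rw [biUnion_insert]
      · exact IsPreconnected.union z hzB hz Q.isPreconnected_bigBall hcon
      · exact Or.inl hyB
      · refine hend.imp (fun h => h.mono (inter_subset_inter_left _ subset_union_right)) ?_
        rintro ⟨g₁, hg₁, g₂, hg₂, hg⟩
        exact ⟨g₁, Or.inr hg₁, g₂, Or.inr hg₂, hg⟩

end

section

variable {θ μ r : ℝ} {n₀ I : ℕ} {J E K Y : Set E2}

/-- The distance `4000 s_i`. -/
def gapAt (θ μ : ℝ) (i : ℕ) : ℝ := 4000 * (μ * θ ^ i)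

/-- The points at distance comparable to `s_i` from `K`. -/
def layer (θ μ : ℝ) (K : Set E2) (i : ℕ) : Set E2 :=
  {x | gapAt θ μ i / 8 ≤ Metric.infDist x K ∧ Metric.infDist x K ≤ gapAt θ μ i}

theorem infDist_le_add_of_mem_bigBall {S : Set E2} {Q : DSq} {x z : E2}
    (hθ : 0 < θ) (hμ : 0 < μ) (hx : x ∈ Q.bigBall θ μ) (hz : z ∈ Q.enl θ μ (3 / 2)) :
    |Metric.infDist z S - Metric.infDist x S| ≤ 400 * Q.sc θ μ := by
  have hz' := Q.closure_enl_subset_bigBall hθ hμ (by norm_num) (by norm_num) (subset_closure hz)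
  have h1 := Metric.infDist_le_infDist_add_dist (s := S) (x := z) (y := x)
  have h2 := Metric.infDist_le_infDist_add_dist (s := S) (x := x) (y := z)
  have h3 := dist_triangle_right x z (Q.ctrPt θ μ)
  rw [dist_comm z x] at h1
  rw [DSq.bigBall, Metric.mem_closedBall] at hx hz'
  rw [abs_le]
  constructor <;> linarith

theorem ofReal_le_measure_of_isolated (hθ : 0 < θ) (hθ1 : θ ≤ 1) (hμ : 0 < μ) {i : ℕ}
    (hK : ∀ y ∈ K, Reaches θ μ r J I i y) (hbK : bdry μ ⊆ K) (hYK : Y ⊆ K) (hY : IsCompact Y)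
    (hne : Y.Nonempty) (hYb : Disjoint Y (bdry μ))
    (hsep : ∀ y ∈ Y, ∀ k ∈ K \ Y, 2 * gapAt θ μ i < dist y k) :
    ENNReal.ofReal (θ ^ 3 * (μ * θ ^ i)) ≤ 2000 *
      (μH[1].restrict (Jstar θ μ J)
          (layer θ μ K i ∩ {x | Metric.infDist x Y ≤ gapAt θ μ i}) +
        ENNReal.ofReal (θ ^ ((i : ℝ) * r)) *
          μH[1].restrict (Jstar θ μ J) {x | Metric.infDist x Y ≤ gapAt θ μ i}) := by
  set ν := μH[1].restrict (Jstar θ μ J) with hν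
  set D := gapAt θ μ i with hD
  have hs : 0 < μ * θ ^ i := by positivity
  have hDs : D = 4000 * (μ * θ ^ i) := rfl
  obtain ⟨y, hy⟩ := hne
  rcases hK y (hYK hy) with hyb | ⟨𝒬, h𝒬, hcon, hyG, hend⟩
  · exact absurd hyb (hYb.notMem_of_mem_left hy)
  have hsc : ∀ Q ∈ 𝒬, Q.sc θ μ ≤ μ * θ ^ i := fun Q hQ =>
    mul_le_mul_of_nonneg_left (pow_le_pow_of_le_one hθ.le hθ1 (h𝒬 Q hQ).1) hμ.le
  have hνQ : ∀ Q ∈ 𝒬, ENNReal.ofReal (θ ^ 3 * Q.sc θ μ) ≤ ν (Q.enl θ μ (3 / 2)) := by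
    intro Q hQ
    rw [hν, Measure.restrict_apply (Q.isOpen_enl _).measurableSet, inter_comm]
    exact (h𝒬 Q hQ).2.2.2
  by_cases hfar : ∃ g ∈ ⋃ Q ∈ 𝒬, Q.bigBall θ μ, D / 2 ≤ Metric.infDist g Y
  · obtain ⟨g, hg, hgD⟩ := hfar
    have hy0 : Metric.infDist y Y = 0 := Metric.infDist_zero_of_mem hy
    have key := DSq.ofReal_mul_sub_le_measure (R := μ * θ ^ i) hθ hμ (by positivity) ν hsc hνQ
      (Metric.lipschitz_infDist_pt Y) (α := D / 4) (β := D / 2)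
      (W := layer θ μ K i ∩ {x | Metric.infDist x Y ≤ D}) ?_ ?_
    · refine le_trans (ENNReal.ofReal_le_ofReal ?_) (key.trans ?_)
      · refine mul_le_mul_of_nonneg_left ?_ (by positivity)
        linarith
      · gcongr
        exact le_self_add
    · refine fun t ht => hcon.intermediate_value hyG hg
        (Metric.continuous_infDist_pt Y).continuousOn ⟨?_, ht.2.trans hgD⟩
      rw [hy0]
      linarith [ht.1]
    · rintro Q hQ ⟨x, hx, hxI⟩ z hz
      have h1 := abs_le.1 (infDist_le_add_of_mem_bigBall (S := Y) hθ hμ hx hz)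
      have h2 := hsc Q hQ
      have h3 : D / 8 ≤ Metric.infDist z Y := by linarith [hxI.1]
      have h4 : Metric.infDist z Y ≤ 3 / 4 * D := by linarith [hxI.2]
      refine ⟨⟨?_, ?_⟩, ?_⟩
      · refine (Metric.le_infDist ⟨y, hYK hy⟩).2 fun k hk => ?_
        by_cases hkY : k ∈ Y
        · exact h3.trans (Metric.infDist_le_dist_of_mem hkY)
        · obtain ⟨p, hp, hpd⟩ := hY.exists_infDist_eq_dist ⟨y, hy⟩ z
          have h5 := hsep p hp k ⟨hk, hkY⟩
          have h6 := dist_triangle_left p k z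
          change gapAt θ μ i / 8 ≤ _
          rw [← hD]
          linarith
      · exact (Metric.infDist_le_infDist_of_subset hYK ⟨y, hy⟩).trans
          (by change _ ≤ D; linarith)
      · change _ ≤ D
        linarith
  · push Not at hfar
    obtain ⟨b, hb, hbb⟩ | ⟨g₁, hg₁, g₂, hg₂, hg⟩ := hend
    · obtain ⟨p, hp, hpd⟩ := hY.exists_infDist_eq_dist ⟨y, hy⟩ b
      have h1 := hfar b hb
      have h2 := hsep p hp b ⟨hbK hbb, fun h => hYb.notMem_of_mem_left h hbb⟩
      rw [dist_comm] at h2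
      linarith
    · have key := DSq.ofReal_mul_sub_le_measure (R := μ * θ ^ i) hθ hμ
        (c := θ ^ 3) (by positivity) ν hsc hνQ
        (LipschitzWith.dist_right g₁) (α := 0) (β := θ ^ (-((i : ℝ) * r)) * (μ * θ ^ i))
        (W := {x | Metric.infDist x Y ≤ D}) ?_ ?_
      · have e : θ ^ 3 * (μ * θ ^ i) = θ ^ ((i : ℝ) * r) *
            (θ ^ 3 * (θ ^ (-((i : ℝ) * r)) * (μ * θ ^ i) - 0)) := by
          rw [Real.rpow_neg hθ.le]
          have : θ ^ ((i : ℝ) * r) ≠ 0 := by positivity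
          field_simp
          ring
        rw [e, ENNReal.ofReal_mul (by positivity)]
        refine (mul_le_mul_right key _).trans ?_
        rw [mul_left_comm]
        gcongr
        exact le_add_self
      · refine fun t ht => hcon.intermediate_value hg₁ hg₂
          (continuous_const.dist continuous_id).continuousOn ⟨?_, ht.2.trans ?_⟩
        · simpa using ht.1
        · exact hg.le
      · rintro Q hQ ⟨x, hx, -⟩ z hz
        have h1 := abs_le.1 (infDist_le_add_of_mem_bigBall (S := Y) hθ hμ hx hz)
        have h2 := hsc Q hQ
        have h3 := hfar x (mem_iUnion₂.2 ⟨Q, hQ, hx⟩)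
        change _ ≤ D
        linarith

end

section

theorem isPreconnected_bdry {μ : ℝ} (hμ : 0 < μ) : IsPreconnected (bdry μ) := by
  have e : bdry μ = WithLp.toLp 2 '' Metric.sphere (0 : Fin 2 → ℝ) μ := by
    ext x
    constructor
    · rintro ⟨h, j, hj⟩
      refine ⟨WithLp.ofLp x, ?_, rfl⟩
      rw [mem_sphere_zero_iff_norm]
      refine le_antisymm ((pi_norm_le_iff_of_nonneg hμ.le).2 h) ?_
      rw [← hj]
      exact norm_le_pi_norm (WithLp.ofLp x) j
    · rintro ⟨y, hy, rfl⟩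
      rw [mem_sphere_zero_iff_norm] at hy
      refine ⟨(pi_norm_le_iff_of_nonneg hμ.le).1 hy.le, ?_⟩
      by_contra! hne
      refine ((pi_norm_lt_iff hμ).2 fun j => ?_).ne hy
      exact lt_of_le_of_ne ((pi_norm_le_iff_of_nonneg hμ.le).1 hy.le j) (hne j)
  rw [e]
  refine (isPreconnected_sphere ?_ _ _).image _ (PiLp.continuous_toLp 2 _).continuousOn
  rw [rank_fin_fun]
  norm_num

theorem nonempty_bdry {μ : ℝ} (hμ : 0 < μ) : (bdry μ).Nonempty :=
  ⟨WithLp.toLp 2 fun _ => μ, fun _ => (abs_of_pos hμ).le, 0, abs_of_pos hμ⟩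

theorem isClosed_connectedComponentIn {X : Type*} [TopologicalSpace X] {Γ : Set X}
    (h : IsClosed Γ) {x : X} (hx : x ∈ Γ) : IsClosed (connectedComponentIn Γ x) := by
  refine isClosed_of_closure_subset (IsPreconnected.subset_connectedComponentIn
    isPreconnected_connectedComponentIn.closure (subset_closure (mem_connectedComponentIn hx)) ?_)
  exact closure_minimal (connectedComponentIn_subset Γ x) h

theorem FinSegUnion.finite_components {Γ : Set E2} (h : FinSegUnion Γ) :
    (connectedComponentIn Γ '' Γ).Finite := by
  obtain ⟨n, a, b, rfl⟩ := h
  refine (finite_range fun i => connectedComponentIn (⋃ i, segment ℝ (a i) (b i)) (a i)).subset ?_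
  rintro _ ⟨x, hx, rfl⟩
  obtain ⟨i, hi⟩ := mem_iUnion.1 hx
  exact ⟨i, connectedComponentIn_eq_of_isPreconnected (convex_segment (a i) (b i)).isPreconnected
    (subset_iUnion (fun i => segment ℝ (a i) (b i)) i) (left_mem_segment _ _ _) hi⟩

theorem FinSegUnion.extends {μ : ℝ} {Γ : Set E2} (h : FinSegUnion Γ) (hs : Γ ⊆ cSq μ) :
    Extends μ Γ Γ :=
  ⟨h, hs, Subset.rfl, fun x hx => ⟨x, hx, rfl⟩, h.finite_components⟩

theorem isClosed_layer (θ μ : ℝ) (K : Set E2) (i : ℕ) : IsClosed (layer θ μ K i) :=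
  (isClosed_le continuous_const (Metric.continuous_infDist_pt K)).inter
    (isClosed_le (Metric.continuous_infDist_pt K) continuous_const)

section Phase

variable {θ μ r : ℝ} {n₀ I : ℕ} {J E K Γ : Set E2}

/-- All points of `K` at distance at most `R` are in the same component of `Γ`. -/
def Joins (K Γ : Set E2) (R : ℝ) : Prop :=
  ∀ x ∈ K, ∀ y ∈ K, dist x y ≤ R → connectedComponentIn Γ x = connectedComponentIn Γ y

theorem Extends.ncard_mul_le (hθ : 0 < θ) (hθ1 : θ ≤ 1) (hμ : 0 < μ) {i : ℕ}
    (h : Extends μ K Γ) (hKc : IsCompact K) (hK : ∀ y ∈ K, Reaches θ μ r J I i y)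
    (hbK : bdry μ ⊆ K) (hj : Joins K Γ (2 * gapAt θ μ i)) :
    ∃ n : ℕ, (connectedComponentIn Γ '' K).ncard ≤ n + 1 ∧
      n * ENNReal.ofReal (θ ^ 3 * (μ * θ ^ i)) ≤ 2000 *
        (μH[1].restrict (Jstar θ μ J) (layer θ μ K i) +
          ENNReal.ofReal (θ ^ ((i : ℝ) * r)) * μH[1].restrict (Jstar θ μ J) univ) := by
  classical
  set ν := μH[1].restrict (Jstar θ μ J) with hν
  have hcl : IsClosed Γ := h.finSegUnion.isCompact.isClosed
  obtain ⟨b, hb⟩ := nonempty_bdry hμ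
  have hfin' : {C ∈ connectedComponentIn Γ '' K | Disjoint C (bdry μ)}.Finite :=
    h.finite.subset (sep_subset _ _)
  set F := hfin'.toFinset with hF
  have hmem : ∀ C ∈ F, C ∈ connectedComponentIn Γ '' K ∧ Disjoint C (bdry μ) := fun C hC =>
    hfin'.mem_toFinset.1 hC
  refine ⟨F.card, ?_, ?_⟩
  · have hsub : connectedComponentIn Γ '' K ⊆
        insert (connectedComponentIn Γ b) (F : Set (Set E2)) := by
      rintro _ ⟨x, hx, rfl⟩
      by_cases hd : Disjoint (connectedComponentIn Γ x) (bdry μ)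
      · exact Or.inr (hfin'.mem_toFinset.2 ⟨⟨x, hx, rfl⟩, hd⟩)
      · left
        obtain ⟨c, hc, hcb⟩ := not_disjoint_iff.1 hd
        rw [connectedComponentIn_eq hc]
        exact connectedComponentIn_eq_of_isPreconnected (isPreconnected_bdry hμ)
          (hbK.trans h.subset) hcb hb
    refine (ncard_le_ncard hsub (F.finite_toSet.insert _)).trans ?_
    exact (ncard_insert_le _ _).trans (by rw [ncard_coe_finset])
  · set N : Set E2 → Set E2 := fun C => {x | Metric.infDist x (K ∩ C) ≤ gapAt θ μ i} with hN
    have hNcl : ∀ C, MeasurableSet (N C) := fun C =>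
      (isClosed_le (Metric.continuous_infDist_pt _) continuous_const).measurableSet
    have hcomp : ∀ C ∈ F, IsCompact (K ∩ C) ∧ (K ∩ C).Nonempty := by
      intro C hC
      obtain ⟨⟨x, hx, rfl⟩, -⟩ := hmem C hC
      exact ⟨hKc.inter_right (isClosed_connectedComponentIn hcl (h.subset hx)),
        x, hx, mem_connectedComponentIn (h.subset hx)⟩
    have hclass : ∀ C ∈ F, ∀ x ∈ C, connectedComponentIn Γ x = C := by
      intro C hC x hx
      obtain ⟨⟨y, hy, rfl⟩, -⟩ := hmem C hC
      exact (connectedComponentIn_eq hx).symm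
    have hone : ∀ C ∈ F, ENNReal.ofReal (θ ^ 3 * (μ * θ ^ i)) ≤
        2000 * (ν.restrict (layer θ μ K i) (N C) +
          ENNReal.ofReal (θ ^ ((i : ℝ) * r)) * ν (N C)) := by
      intro C hC
      rw [Measure.restrict_apply (hNcl C), inter_comm]
      refine ofReal_le_measure_of_isolated hθ hθ1 hμ hK hbK inter_subset_left (hcomp C hC).1
        (hcomp C hC).2 ((hmem C hC).2.mono_left inter_subset_right) ?_
      rintro y ⟨hyK, hyC⟩ k ⟨hk, hkn⟩
      by_contra! hd
      refine hkn ⟨hk, ?_⟩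
      rw [← hclass C hC y hyC, hj y hyK k hk hd]
      exact mem_connectedComponentIn (h.subset hk)
    have hdisj : (F : Set (Set E2)).Pairwise (Function.onFun Disjoint N) := by
      intro C hC C' hC' hne
      refine disjoint_left.2 fun x hx hx' => hne ?_
      obtain ⟨p, hp, hpd⟩ := (hcomp C hC).1.exists_infDist_eq_dist (hcomp C hC).2 x
      obtain ⟨q, hq, hqd⟩ := (hcomp C' hC').1.exists_infDist_eq_dist (hcomp C' hC').2 x
      change Metric.infDist x (K ∩ C) ≤ _ at hx
      change Metric.infDist x (K ∩ C') ≤ _ at hx'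
      rw [← hclass C hC p hp.2, ← hclass C' hC' q hq.2]
      refine hj p hp.1 q hq.1 ?_
      linarith [dist_triangle_left p q x]
    have hsum : ∀ m : Measure E2, ∑ C ∈ F, m (N C) ≤ m univ := fun m =>
      sum_measure_le_measure_univ (fun C _ => (hNcl C).nullMeasurableSet)
        (hdisj.mono' fun _ _ hd => hd.aedisjoint)
    calc (F.card : ℝ≥0∞) * ENNReal.ofReal (θ ^ 3 * (μ * θ ^ i))
        = ∑ C ∈ F, ENNReal.ofReal (θ ^ 3 * (μ * θ ^ i)) := by
          rw [Finset.sum_const, nsmul_eq_mul]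
      _ ≤ ∑ C ∈ F, 2000 * (ν.restrict (layer θ μ K i) (N C) +
            ENNReal.ofReal (θ ^ ((i : ℝ) * r)) * ν (N C)) := Finset.sum_le_sum hone
      _ = 2000 * (∑ C ∈ F, ν.restrict (layer θ μ K i) (N C) +
            ENNReal.ofReal (θ ^ ((i : ℝ) * r)) * ∑ C ∈ F, ν (N C)) := by
          rw [← Finset.mul_sum, Finset.sum_add_distrib, Finset.mul_sum]
      _ ≤ _ := by
          gcongr
          · exact (hsum _).trans_eq (Measure.restrict_apply_univ _)
          · exact hsum _

theorem Extends.exists_joins (hθ : 0 < θ) (hθ1 : θ ≤ 1) (hμ : 0 < μ) {i : ℕ}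
    (h : Extends μ K Γ) (hKc : IsCompact K) (hK : ∀ y ∈ K, Reaches θ μ r J I i y)
    (hbK : bdry μ ⊆ K) (hj : Joins K Γ (2 * gapAt θ μ i)) {R c : ℝ} (hc : 0 ≤ c)
    (hR : R ≤ c * (θ ^ 3 * (μ * θ ^ i))) :
    ∃ Γ', Extends μ K Γ' ∧ Joins K Γ' R ∧ μH[1] Γ' ≤ μH[1] Γ + ENNReal.ofReal c * (2000 *
        (μH[1].restrict (Jstar θ μ J) (layer θ μ K i) +
          ENNReal.ofReal (θ ^ ((i : ℝ) * r)) * μH[1].restrict (Jstar θ μ J) univ)) := by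
  obtain ⟨n, hn, hle⟩ := h.ncard_mul_le hθ hθ1 hμ hKc hK hbK hj
  obtain ⟨Γ', h', hm, hs⟩ := h.exists_merge R hn
  refine ⟨Γ', h', hs, hm.trans (add_le_add le_rfl ?_)⟩
  calc (n : ℝ≥0∞) * ENNReal.ofReal R
      ≤ n * ENNReal.ofReal (c * (θ ^ 3 * (μ * θ ^ i))) := by gcongr
    _ = ENNReal.ofReal c * (n * ENNReal.ofReal (θ ^ 3 * (μ * θ ^ i))) := by
        rw [ENNReal.ofReal_mul hc]
        ring
    _ ≤ _ := mul_le_mul_right hle _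

end Phase

end

section

variable {θ μ r : ℝ} {n₀ I : ℕ} {J E K Γ : Set E2}

theorem sum_measure_layer_le (hθ : 0 < θ) (hθ' : θ ≤ 1 / 128) (hμ : 0 < μ) (ν : Measure E2)
    (s : Finset ℕ) : ∑ k ∈ s, ν (layer θ μ K k) ≤ ν univ := by
  refine sum_measure_le_measure_univ
    (fun k _ => (isClosed_layer θ μ K k).measurableSet.nullMeasurableSet) ?_
  have key : ∀ i j : ℕ, i < j → Disjoint (layer θ μ K i) (layer θ μ K j) := by
    refine fun i j hij => disjoint_left.2 fun x hx hx' => ?_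
    have h1 := hx.1
    have h2 := hx'.2
    have h3 : θ ^ j ≤ θ ^ i / 128 := by
      refine (pow_le_pow_of_le_one hθ.le (by linarith) (Nat.succ_le_of_lt hij)).trans ?_
      rw [pow_succ]
      have : 0 < θ ^ i := by positivity
      nlinarith
    have h4 : μ * θ ^ j ≤ μ * θ ^ i / 128 := by
      rw [mul_div_assoc]
      gcongr
    have h5 : 0 < μ * θ ^ i := by positivity
    simp only [gapAt] at h1 h2
    linarith
  intro i _ j _ hij
  rcases lt_or_gt_of_ne hij with h | h
  · exact (key i j h).aedisjoint
  · exact (key j i h).symm.aedisjoint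

theorem sum_ofReal_rpow_le (hθ : 0 < θ) (hθ1 : θ < 1) (hr : 0 < r) (s : Finset ℕ) :
    ∑ k ∈ s, ENNReal.ofReal (θ ^ ((k : ℝ) * r)) ≤ ENNReal.ofReal (1 / (1 - θ ^ r)) := by
  have h0 : 0 ≤ θ ^ r := by positivity
  have h1 : θ ^ r < 1 := Real.rpow_lt_one hθ.le hθ1 hr
  have e : ∀ k : ℕ, θ ^ ((k : ℝ) * r) = (θ ^ r) ^ k := fun k => by
    rw [mul_comm, Real.rpow_mul hθ.le, Real.rpow_natCast]
  simp only [e]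
  rw [← ENNReal.ofReal_sum_of_nonneg fun k _ => by positivity]
  refine ENNReal.ofReal_le_ofReal ?_
  rw [one_div, ← tsum_geometric_of_lt_one h0 h1]
  exact (summable_geometric_of_lt_one h0 h1).sum_le_tsum _ fun k _ => by positivity

theorem exists_isPreconnected (hθ : 0 < θ) (hθ' : θ ≤ 1 / 128) (hμ : 0 < μ) (hr : 0 < r)
    (hI : 8 ≤ I) (hKf : FinSegUnion K) (hKs : K ⊆ cSq μ) (hbK : bdry μ ⊆ K)
    (hK : ∀ i, 8 ≤ i → i ≤ I → ∀ y ∈ K, Reaches θ μ r J I i y)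
    (hj : Joins K K (2 * gapAt θ μ I)) :
    ∃ Γ, FinSegUnion Γ ∧ Γ ⊆ cSq μ ∧ K ⊆ Γ ∧ IsPreconnected Γ ∧
      μH[1] Γ ≤ μH[1] K + ENNReal.ofReal (8000 / θ ^ 11) *
        (2000 * ((1 + ENNReal.ofReal (1 / (1 - θ ^ r))) *
          μH[1].restrict (Jstar θ μ J) univ)) := by
  set ν := μH[1].restrict (Jstar θ μ J) with hν
  set c := 8000 / θ ^ 11 with hc
  have hc0 : 0 ≤ c := by positivity
  have hθ1 : θ ≤ 1 := by linarith
  set g : ℕ → ℝ≥0∞ := fun k => ν (layer θ μ K k) + ENNReal.ofReal (θ ^ ((k : ℝ) * r)) * ν univ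
    with hg
  have hKc := hKf.isCompact
  have main : ∀ R : ℝ, R ≤ c * (θ ^ 3 * (μ * θ ^ 8)) → ∃ Γ, Extends μ K Γ ∧ Joins K Γ R ∧
      μH[1] Γ ≤ μH[1] K + ENNReal.ofReal c * (2000 * ∑ k ∈ Finset.Ico 8 (I + 1), g k) := by
    have step : ∀ i, 8 ≤ i → i ≤ I →
        (∃ Γ, Extends μ K Γ ∧ Joins K Γ (2 * gapAt θ μ i) ∧ μH[1] Γ ≤ μH[1] K +
          ENNReal.ofReal c * (2000 * ∑ k ∈ Finset.Ico (i + 1) (I + 1), g k)) →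
        ∀ R : ℝ, R ≤ c * (θ ^ 3 * (μ * θ ^ i)) → ∃ Γ, Extends μ K Γ ∧ Joins K Γ R ∧
          μH[1] Γ ≤ μH[1] K + ENNReal.ofReal c * (2000 * ∑ k ∈ Finset.Ico i (I + 1), g k) := by
      rintro i h8 hi ⟨Γ, h, hjΓ, hm⟩ R hR
      obtain ⟨Γ', h', hj', hm'⟩ := h.exists_joins hθ hθ1 hμ hKc (hK i h8 hi) hbK hjΓ hc0 hR
      refine ⟨Γ', h', hj', hm'.trans ((add_le_add hm le_rfl).trans_eq ?_)⟩
      rw [Finset.sum_eq_sum_Ico_succ_bot (by omega : i < I + 1), hg]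
      ring
    refine step 8 le_rfl hI (Nat.decreasingInduction' (m := 8) (n := I)
      (P := fun i => ∃ Γ, Extends μ K Γ ∧ Joins K Γ (2 * gapAt θ μ i) ∧ μH[1] Γ ≤ μH[1] K +
          ENNReal.ofReal c * (2000 * ∑ k ∈ Finset.Ico (i + 1) (I + 1), g k)) ?_ hI ?_)
    · intro k hkI h8 ih
      refine step (k + 1) (by omega) hkI ih _ ?_
      have e : c * (θ ^ 3 * (μ * θ ^ (k + 1))) = 8000 * (μ * θ ^ k) * (1 / θ) ^ 7 := by
        rw [hc]
        field_simp
        ring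
      rw [e, gapAt]
      have h1 : 1 ≤ (1 / θ) ^ 7 := one_le_pow₀ (by rw [le_div_iff₀ hθ]; linarith)
      have h2 : 0 < μ * θ ^ k := by positivity
      nlinarith
    · exact ⟨K, hKf.extends hKs, hj, by simp⟩
  obtain ⟨Γ, h, hjΓ, hm⟩ := main (3 * μ) (by
    have e : c * (θ ^ 3 * (μ * θ ^ 8)) = 8000 * μ := by
      rw [hc]
      field_simp
    rw [e]
    linarith)
  refine ⟨Γ, h.finSegUnion, h.subset_cSq, h.subset, ?_, hm.trans ?_⟩
  · obtain ⟨b, hb⟩ := nonempty_bdry hμ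
    have hall : ∀ x ∈ Γ, x ∈ connectedComponentIn Γ b := by
      intro x hx
      obtain ⟨k, hk, e⟩ := h.meets x hx
      rw [← hjΓ k hk b (hbK hb) ?_, ← e]
      · exact mem_connectedComponentIn hx
      · refine (dist_le_of_forall_abs_sub_le (d := 2 * μ) fun j => ?_).trans (by linarith)
        have h1 := abs_le.1 (hKs hk j)
        have h2 := abs_le.1 (hKs (hbK hb) j)
        rw [abs_le]
        constructor <;> linarith
    have e : connectedComponentIn Γ b = Γ := Subset.antisymm (connectedComponentIn_subset _ _) hall
    rw [← e]
    exact isPreconnected_connectedComponentIn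
  · gcongr
    rw [hg, Finset.sum_add_distrib, ← Finset.sum_mul, add_mul, one_mul]
    gcongr
    · exact sum_measure_layer_le hθ hθ' hμ ν _
    · exact sum_ofReal_rpow_le hθ (by linarith) hr _

end

theorem hausdorffMeasure_segment_axisPt_le (j : Fin 2) (c : ℝ) {L : ℝ} (hL : 0 ≤ L) :
    μH[1] (segment ℝ (axisPt j c (-L)) (axisPt j c L)) ≤ ENNReal.ofReal (3 * L) := by
  refine hausdorffMeasure_segment_le ?_
  refine (dist_le_of_forall_abs_sub_le (d := 2 * L) fun i => ?_).trans (by linarith)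
  by_cases hi : i = j
  · simp [axisPt, hi, hL]
  · simp only [axisPt, if_neg hi]
    rw [abs_le]
    constructor <;> linarith

theorem hausdorffMeasure_bdry_le {μ : ℝ} (hμ : 0 < μ) :
    μH[1] (bdry μ) ≤ ENNReal.ofReal (12 * μ) := by
  rw [bdry_eq hμ]
  refine (measure_iUnion_fintype_le _ _).trans ((Finset.sum_le_sum fun q _ =>
    hausdorffMeasure_segment_axisPt_le _ _ hμ.le).trans_eq ?_)
  rw [Finset.sum_const, nsmul_eq_mul, Finset.card_univ, Fintype.card_prod, Fintype.card_fin,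
    Fintype.card_bool, ← ENNReal.ofReal_natCast, ← ENNReal.ofReal_mul (by positivity)]
  congr 1
  push_cast
  ring

/-- A bound for the length of `J₀` in a square of unit half-sidelength. -/
def gridConst (θ : ℝ) : ℝ := 2 * (2 * ⌈1 / θ ^ 7⌉₊ + 1) * 3

theorem gridConst_nonneg (θ : ℝ) : 0 ≤ gridConst θ := by
  unfold gridConst
  positivity

theorem hausdorffMeasure_J0_le {θ μ : ℝ} (hθ : 0 < θ) (hμ : 0 < μ) :
    μH[1] (J0 θ μ) ≤ ENNReal.ofReal (gridConst θ * μ) := by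
  set N := ⌈1 / θ ^ 7⌉₊ with hN
  set T : Finset (Fin 2 × ℤ) := Finset.univ ×ˢ Finset.Icc (-(N : ℤ)) N with hT
  have hsub : J0 θ μ ⊆ ⋃ q ∈ T, segment ℝ (axisPt q.1 (2 * (μ * θ ^ 7) * q.2) (-μ))
      (axisPt q.1 (2 * (μ * θ ^ 7) * q.2) μ) := by
    intro x hx
    obtain ⟨Q, ⟨hQi, hQ⟩, hxQ⟩ := mem_iUnion₂.1 hx
    have hs : Q.sc θ μ = μ * θ ^ 7 := by rw [DSq.sc, hQi]
    have hxc : x ∈ cSq μ := closure_minimal (hQ.trans (Qsq_subset_cSq μ)) (isClosed_cSq μ)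
      (frontier_subset_closure hxQ)
    rw [DSq.core_eq_enl, (Q.isOpen_enl 1).frontier_eq, DSq.closure_enl hθ hμ Q one_pos] at hxQ
    obtain ⟨h1, h2⟩ := hxQ
    obtain ⟨j, hj⟩ : ∃ j, |x j - Q.ctr θ μ j| = 1 * Q.sc θ μ := by
      by_contra! hne
      exact h2 fun j => lt_of_le_of_ne (h1 j) (hne j)
    obtain ⟨k, hk⟩ : ∃ k : ℤ, x j = 2 * (μ * θ ^ 7) * k := by
      rw [hs, DSq.ctr, hs, one_mul, abs_eq (by positivity)] at hj
      rcases hj with hj | hj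
      · refine ⟨Q.pos j + 1, ?_⟩
        push_cast
        linarith
      · exact ⟨Q.pos j, by linarith⟩
    have h7 : 0 < θ ^ 7 := by positivity
    have hkN : |(k : ℝ)| ≤ N := by
      have h3 := hxc j
      rw [hk, abs_mul, abs_of_pos (by positivity)] at h3
      refine le_trans ?_ (Nat.le_ceil _)
      rw [le_div_iff₀ h7]
      have h4 : μ * (2 * (|(k : ℝ)| * θ ^ 7)) ≤ μ * 1 := by linarith
      have h5 := le_of_mul_le_mul_left h4 hμ
      have h6 : 0 ≤ |(k : ℝ)| * θ ^ 7 := by positivity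
      linarith
    refine mem_iUnion₂.2 ⟨(j, k), ?_, ?_⟩
    · have h3 := abs_le.1 hkN
      simp only [hT, Finset.mem_product, Finset.mem_univ, true_and, Finset.mem_Icc]
      constructor
      · exact_mod_cast h3.1
      · exact_mod_cast h3.2
    · rw [segment_axisPt _ _ hμ.le]
      exact ⟨hk, fun i _ => hxc i⟩
  refine (measure_mono hsub).trans ((measure_biUnion_finset_le _ _).trans
    ((Finset.sum_le_sum fun q _ => hausdorffMeasure_segment_axisPt_le _ _ hμ.le).trans_eq ?_))
  rw [Finset.sum_const, nsmul_eq_mul, hT, Finset.card_product, Int.card_Icc, Finset.card_univ,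
    Fintype.card_fin, ← ENNReal.ofReal_natCast, ← ENNReal.ofReal_mul (by positivity)]
  congr 1
  have e : ((N : ℤ) + 1 - -(N : ℤ)).toNat = 2 * N + 1 := by omega
  rw [e, gridConst, ← hN]
  push_cast
  ring

section

variable {θ μ r : ℝ} {I : ℕ} {J : Set E2}

theorem eventually_mul_pow_lt (hθ : 0 < θ) (hθ1 : θ < 1) (μ c : ℝ) {ε : ℝ} (hε : 0 < ε) :
    ∀ᶠ i : ℕ in Filter.atTop, c * (μ * θ ^ i) < ε := by
  have h := ((tendsto_pow_atTop_nhds_zero_of_lt_one hθ.le hθ1).const_mul μ).const_mul c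
  rw [mul_zero, mul_zero] at h
  exact h.eventually (gt_mem_nhds hε)

theorem eventually_lt_dist_of_disjoint (hθ : 0 < θ) (hθ1 : θ < 1) (μ c : ℝ) {S T : Set E2}
    (hS : IsCompact S) (hT : IsClosed T) :
    ∀ᶠ i : ℕ in Filter.atTop, Disjoint S T → ∀ x ∈ S, ∀ y ∈ T, c * (μ * θ ^ i) < dist x y := by
  by_cases hd : Disjoint S T
  · obtain ⟨ε, hε, h⟩ := Metric.exists_pos_forall_lt_edist hS hT hd
    filter_upwards [eventually_mul_pow_lt hθ hθ1 μ c (NNReal.coe_pos.2 hε)] with i hi _ x hx y hy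
    refine hi.trans ?_
    have := h x hx y hy
    rw [edist_dist, ← ENNReal.ofReal_coe_nnreal] at this
    exact (ENNReal.ofReal_lt_ofReal_iff_of_nonneg ε.2).1 this
  · exact Filter.Eventually.of_forall fun _ h => absurd h hd

/-- Points of a long segment contained in `J` are close to a bad square. -/
theorem exists_badSq_of_mem_segment (hθ : 0 < θ) (hθ' : θ ≤ 1 / 128) (hμ : 0 < μ) {p q y : E2}
    (hpq : segment ℝ p q ⊆ J) (hy : y ∈ segment ℝ p q) (hlen : μ * θ ^ I ≤ dist p q) :
    ∃ Q ∈ badSq θ μ (Jstar θ μ J) I, y ∈ Q.enl θ μ (3 / 2) := by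
  set s := μ * θ ^ I with hs
  have hs0 : 0 < s := by positivity
  obtain ⟨e, he, hed⟩ : ∃ e ∈ segment ℝ p q, s / 4 ≤ dist y e := by
    by_contra! hcon
    have h1 := hcon p (left_mem_segment _ _ _)
    have h2 := hcon q (right_mem_segment _ _ _)
    linarith [dist_triangle_left p q y]
  have hd0 : 0 < dist y e := by linarith
  set τ := s / 4 / dist y e with hτ
  have hτ0 : 0 ≤ τ := by positivity
  have hτ1 : τ ≤ 1 := (div_le_one hd0).2 hed
  set w := AffineMap.lineMap y e τ with hw
  have hyw : dist y w = s / 4 := by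
    rw [hw, dist_left_lineMap, Real.norm_of_nonneg hτ0, hτ, div_mul_cancel₀ _ hd0.ne']
  have hwJ : segment ℝ y w ⊆ segment ℝ p q := by
    refine (convex_segment p q).segment_subset hy ((convex_segment p q).segment_subset hy he ?_)
    rw [segment_eq_image_lineMap]
    exact ⟨τ, ⟨hτ0, hτ1⟩, rfl⟩
  have hwQ : segment ℝ y w ⊆ (DSq.cell θ μ I y).enl θ μ (3 / 2) := by
    intro x hx j
    have h1 := DSq.cell_bounds hθ hμ I y j
    have h2 : dist x y ≤ s / 4 := by
      rw [dist_comm, ← hyw]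
      have h4 := dist_add_dist_of_mem_segment hx
      linarith [dist_nonneg (x := x) (y := w)]
    have h3 := abs_le.1 ((abs_sub_apply_le_dist x y j).trans h2)
    rw [DSq.sc, DSq.cell_idx, abs_lt]
    constructor <;> linarith
  refine ⟨DSq.cell θ μ I y, ⟨rfl, ?_⟩, hwQ (left_mem_segment _ _ _)⟩
  calc ENNReal.ofReal (θ ^ 3 * s) ≤ ENNReal.ofReal (s / 4) := by
        refine ENNReal.ofReal_le_ofReal ?_
        have : θ ^ 3 ≤ 1 / 4 := (pow_le_of_le_one hθ.le (by linarith) (by norm_num)).trans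
          (by linarith)
        nlinarith
    _ = μH[1] (segment ℝ y w) := by rw [hausdorffMeasure_segment, edist_dist, hyw]
    _ ≤ _ := measure_mono (subset_inter ((hwJ.trans hpq).trans subset_union_left) hwQ)

theorem segment_subset_of_dist_le {K : Set E2} {p q : E2} {ρ : ℝ} (hρ : 0 < ρ)
    (hK : ∀ y ∈ segment ℝ p q, ∀ z ∈ K, dist y z ≤ ρ → y ∈ K)
    (hne : (segment ℝ p q ∩ K).Nonempty) : segment ℝ p q ⊆ K := by
  have hin : segment ℝ p q ∩ Metric.thickening ρ K ⊆ K := by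
    rintro x ⟨hx, hxK⟩
    obtain ⟨z, hz, hd⟩ := Metric.mem_thickening_iff.1 hxK
    exact hK x hx z hz hd.le
  have hsub := (convex_segment p q).isPreconnected.subset_of_closure_inter_subset
    (u := Metric.thickening (ρ / 2) K) Metric.isOpen_thickening
    (hne.mono (inter_subset_inter_right _ (Metric.self_subset_thickening (by positivity) K))) ?_
  · exact fun x hx => hin ⟨hx, Metric.thickening_mono (by linarith) K (hsub hx)⟩
  · rintro x ⟨hx, hxs⟩
    refine Metric.self_subset_thickening (by positivity) K (hin ⟨hxs, ?_⟩)
    exact Metric.cthickening_subset_thickening' hρ (by linarith) K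
      (Metric.closure_thickening_subset_cthickening _ _ hx)

/-- Decomposition of `J` into a closed set `E` made of nondegenerate segments and finitely many
points, and a scale at which the geometry of `J` is resolved. -/
theorem exists_scale (hθ : 0 < θ) (hθ' : θ ≤ 1 / 128) (hμ : 0 < μ) (hJ : FinSegUnion J) :
    ∃ (E : Set E2) (I : ℕ), 8 ≤ I ∧ bdry μ ⊆ E ∧ E ⊆ J ∪ bdry μ ∧ IsClosed E ∧
      μH[1] (J \ E) = 0 ∧
      (∀ y ∈ J \ E, ∀ z ∈ E, 100 * (μ * θ ^ I) < dist y z) ∧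
      (∀ y ∈ E, y ∉ bdry μ → ∃ Q ∈ badSq θ μ (Jstar θ μ J) I, y ∈ Q.enl θ μ (3 / 2)) ∧
      ∀ K ⊆ E, (∀ y ∈ E, ∀ z ∈ K, dist y z ≤ 100 * (μ * θ ^ I) → y ∈ K) →
        FinSegUnion K ∧ Joins K K (2 * gapAt θ μ I) := by
  have hθ1 : θ < 1 := by linarith
  obtain ⟨n, a, b, rfl⟩ := hJ
  set J := ⋃ i, segment ℝ (a i) (b i) with hJdef
  set p : Fin n ⊕ (Fin 2 × Bool) → E2 := Sum.elim a fun q => sideEnd μ q (-μ) with hp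
  set q : Fin n ⊕ (Fin 2 × Bool) → E2 := Sum.elim b fun q => sideEnd μ q μ with hq
  set E := ⋃ s : {s : Fin n ⊕ (Fin 2 × Bool) // p s ≠ q s}, segment ℝ (p s) (q s) with hE
  have hside : ∀ t, p (Sum.inr t) ≠ q (Sum.inr t) := by
    rintro ⟨j, b⟩ h
    have hk : ∃ k, k ≠ j := ⟨j + 1, by fin_cases j <;> decide⟩
    obtain ⟨k, hk⟩ := hk
    have h1 : sideEnd μ (j, b) (-μ) k = sideEnd μ (j, b) μ k := congrArg (fun v : E2 => v k) h
    simp only [sideEnd, axisPt, if_neg hk] at h1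
    linarith
  have hbE : bdry μ ⊆ E := by
    rw [bdry_eq hμ]
    exact iUnion_subset fun t => subset_iUnion
      (fun s : {s // p s ≠ q s} => segment ℝ (p s) (q s)) ⟨Sum.inr t, hside t⟩
  have hEJ : E ⊆ J ∪ bdry μ := by
    refine iUnion_subset ?_
    rintro ⟨s | t, hs⟩
    · exact (subset_iUnion (fun i => segment ℝ (a i) (b i)) s).trans subset_union_left
    · rw [bdry_eq hμ]
      exact (subset_iUnion (fun t => segment ℝ (sideEnd μ t (-μ)) (sideEnd μ t μ)) t).trans
        subset_union_right
  have hdiff : ∀ y ∈ J \ E, ∃ i, a i = b i ∧ y ∈ segment ℝ (a i) (b i) := by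
    rintro y ⟨hy, hyE⟩
    obtain ⟨i, hi⟩ := mem_iUnion.1 hy
    refine ⟨i, ?_, hi⟩
    by_contra hne
    exact hyE (mem_iUnion.2 ⟨⟨Sum.inl i, hne⟩, hi⟩)
  have hev : ∀ᶠ i : ℕ in Filter.atTop, (∀ s t, Disjoint (segment ℝ (p s) (q s))
      (segment ℝ (p t) (q t)) → ∀ x ∈ segment ℝ (p s) (q s), ∀ y ∈ segment ℝ (p t) (q t),
        8000 * (μ * θ ^ i) < dist x y) ∧
      (∀ s, p s ≠ q s → 1 * (μ * θ ^ i) < dist (p s) (q s)) ∧ 8 ≤ i := by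
    refine Filter.Eventually.and ?_ (Filter.Eventually.and ?_ (Filter.eventually_ge_atTop 8))
    · refine Filter.eventually_all.2 fun s => Filter.eventually_all.2 fun t => ?_
      exact eventually_lt_dist_of_disjoint hθ hθ1 μ 8000 (isCompact_segment _ _)
        (isCompact_segment _ _).isClosed
    · refine Filter.eventually_all.2 fun s => ?_
      by_cases hs : p s = q s
      · exact Filter.Eventually.of_forall fun _ h => absurd hs h
      · filter_upwards [eventually_mul_pow_lt hθ hθ1 μ 1 (dist_pos.2 hs)] with i hi _ using hi
  obtain ⟨I, hsep, hlen, hI⟩ := hev.exists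
  have hs : 0 < μ * θ ^ I := by positivity
  refine ⟨E, I, hI, hbE, hEJ, (finSegUnion_iUnion _ _).isCompact.isClosed, ?_, ?_, ?_, ?_⟩
  · refine measure_mono_null (t := ⋃ i ∈ {i | a i = b i}, segment ℝ (a i) (b i)) ?_ ?_
    · intro y hy
      obtain ⟨i, hi, hyi⟩ := hdiff y hy
      exact mem_iUnion₂.2 ⟨i, hi, hyi⟩
    · refine (measure_biUnion_null_iff (to_countable _)).2 fun i hi => ?_
      rw [hausdorffMeasure_segment, show a i = b i from hi, edist_self]
  · intro y hy z hz
    obtain ⟨i, hi, hyi⟩ := hdiff y hy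
    obtain ⟨t, ht⟩ := mem_iUnion.1 hz
    refine lt_trans (by linarith) (hsep (Sum.inl i) t (disjoint_left.2 fun x hx hxt => ?_)
      y hyi z ht)
    have e : segment ℝ (p (Sum.inl i)) (q (Sum.inl i)) = {a i} := by
      change segment ℝ (a i) (b i) = _
      rw [← hi, segment_same]
    rw [e, mem_singleton_iff] at hx
    rw [← hi, segment_same, mem_singleton_iff] at hyi
    rw [hx, ← hyi] at hxt
    exact hy.2 (mem_iUnion.2 ⟨t, hxt⟩)
  · intro y hy hyb
    obtain ⟨⟨s | t, hst⟩, hys⟩ := mem_iUnion.1 hy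
    · refine exists_badSq_of_mem_segment hθ hθ' hμ
        (subset_iUnion (fun i => segment ℝ (a i) (b i)) s) hys ?_
      have := hlen _ hst
      rw [one_mul] at this
      exact this.le
    · refine absurd ?_ hyb
      rw [bdry_eq hμ]
      exact mem_iUnion.2 ⟨t, hys⟩
  · intro K hKE hK
    have hsub : ∀ s : {s // p s ≠ q s}, (segment ℝ (p s) (q s) ∩ K).Nonempty →
        segment ℝ (p s) (q s) ⊆ K := fun s => segment_subset_of_dist_le (ρ := 100 * (μ * θ ^ I))
      (by positivity) fun y hy => hK y (mem_iUnion.2 ⟨s, hy⟩)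
    constructor
    · have e : K = ⋃ s : {s : {s // p s ≠ q s} // (segment ℝ (p s) (q s) ∩ K).Nonempty},
          segment ℝ (p s) (q s) := by
        refine Subset.antisymm (fun x hx => ?_) (iUnion_subset fun s => hsub s.1 s.2)
        obtain ⟨s, hs⟩ := mem_iUnion.1 (hKE hx)
        exact mem_iUnion.2 ⟨⟨s, x, hs, hx⟩, hs⟩
      rw [e]
      exact finSegUnion_iUnion _ _
    · intro x hx y hy hd
      obtain ⟨s, hxs⟩ := mem_iUnion.1 (hKE hx)
      obtain ⟨t, hyt⟩ := mem_iUnion.1 (hKE hy)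
      obtain ⟨w, hws, hwt⟩ : ∃ w, w ∈ segment ℝ (p s) (q s) ∧ w ∈ segment ℝ (p t) (q t) := by
        by_contra! hcon
        have := hsep s t (disjoint_left.2 hcon) x hxs y hyt
        rw [gapAt] at hd
        linarith
      rw [connectedComponentIn_eq_of_isPreconnected (convex_segment _ _).isPreconnected
        (hsub s ⟨x, hxs, hx⟩) hxs hws]
      exact connectedComponentIn_eq_of_isPreconnected (convex_segment _ _).isPreconnected
        (hsub t ⟨y, hyt, hy⟩) hwt hyt

end

/-- The constant in the bound for the length of the boundary of the partition. -/
def partitionConst (θ r : ℝ) : ℝ :=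
  (1 + 12 / θ ^ 2) +
    8000 / θ ^ 11 * (2000 * ((1 + 1 / (1 - θ ^ r)) * (1 + gridConst θ / θ ^ 2)))

theorem rpow_lt_one_of_le {θ r : ℝ} (hθ : 0 < θ) (hθ' : θ ≤ 1 / 128) (hr : 0 < r) :
    0 < 1 - θ ^ r := by
  have := Real.rpow_lt_one hθ.le (by linarith : θ < 1) hr
  linarith

theorem partitionConst_pos {θ r : ℝ} (hθ : 0 < θ) (hθ' : θ ≤ 1 / 128) (hr : 0 < r) :
    0 < partitionConst θ r := by
  have h1 := rpow_lt_one_of_le hθ hθ' hr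
  have h2 := gridConst_nonneg θ
  unfold partitionConst
  positivity

theorem ofReal_mul_le_mul {θ μ c : ℝ} (hθ : 0 < θ) (hc : 0 ≤ c) {a : ℝ≥0∞}
    (h : ENNReal.ofReal (μ * θ ^ 2) ≤ a) :
    ENNReal.ofReal (c * μ) ≤ ENNReal.ofReal (c / θ ^ 2) * a := by
  calc ENNReal.ofReal (c * μ) = ENNReal.ofReal (c / θ ^ 2 * (μ * θ ^ 2)) := by
        congr 1
        field_simp
    _ = ENNReal.ofReal (c / θ ^ 2) * ENNReal.ofReal (μ * θ ^ 2) :=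
        ENNReal.ofReal_mul (by positivity)
    _ ≤ _ := by gcongr

theorem measure_le_partitionConst_mul {θ μ r : ℝ} (hθ : 0 < θ) (hθ' : θ ≤ 1 / 128) (hμ : 0 < μ)
    (hr : 0 < r) {J K : Set E2} (hK : K ⊆ J ∪ bdry μ)
    (hJ : ENNReal.ofReal (μ * θ ^ 2) ≤ μH[1] J) :
    μH[1] K + ENNReal.ofReal (8000 / θ ^ 11) * (2000 *
      ((1 + ENNReal.ofReal (1 / (1 - θ ^ r))) * μH[1].restrict (Jstar θ μ J) univ)) ≤
      ENNReal.ofReal (partitionConst θ r) * μH[1] J := by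
  have h1 := rpow_lt_one_of_le hθ hθ' hr
  have h2 := gridConst_nonneg θ
  have hKm : μH[1] K ≤ ENNReal.ofReal (1 + 12 / θ ^ 2) * μH[1] J := by
    refine (measure_mono hK).trans ((measure_union_le _ _).trans ?_)
    rw [ENNReal.ofReal_add (by norm_num) (by positivity), add_mul, ENNReal.ofReal_one, one_mul]
    exact add_le_add le_rfl ((hausdorffMeasure_bdry_le hμ).trans
      (ofReal_mul_le_mul hθ (by norm_num) hJ))
  have hν : μH[1].restrict (Jstar θ μ J) univ ≤
      ENNReal.ofReal (1 + gridConst θ / θ ^ 2) * μH[1] J := by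
    rw [Measure.restrict_apply_univ]
    refine (measure_union_le _ _).trans ?_
    rw [ENNReal.ofReal_add (by norm_num) (by positivity), add_mul, ENNReal.ofReal_one, one_mul]
    exact add_le_add le_rfl ((hausdorffMeasure_J0_le hθ hμ).trans (ofReal_mul_le_mul hθ h2 hJ))
  have e1 : 1 + ENNReal.ofReal (1 / (1 - θ ^ r)) = ENNReal.ofReal (1 + 1 / (1 - θ ^ r)) := by
    rw [ENNReal.ofReal_add (by norm_num) (by positivity), ENNReal.ofReal_one]
  have e2 : (2000 : ℝ≥0∞) = ENNReal.ofReal 2000 := by norm_num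
  rw [e1, e2, partitionConst,
    ENNReal.ofReal_add (p := 1 + 12 / θ ^ 2) (by positivity) (by positivity),
    add_mul (ENNReal.ofReal (1 + 12 / θ ^ 2)),
    ENNReal.ofReal_mul (p := 8000 / θ ^ 11) (by positivity),
    ENNReal.ofReal_mul (p := 2000) (by positivity),
    ENNReal.ofReal_mul (p := 1 + 1 / (1 - θ ^ r)) (by positivity)]
  refine add_le_add hKm ?_
  rw [mul_assoc, mul_assoc, mul_assoc]
  gcongr

/-- **Auxiliary partition and Whitney-type covering associated to a jump set**
(Theorem 4.4). -/
theorem auxiliary_partition_whitney_covering :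
    ∃ θ₀ : ℝ, 0 < θ₀ ∧
    ∀ (n₀ : ℕ) (θ : ℝ), θ = (1 / 2 : ℝ) ^ n₀ → θ ≤ θ₀ →
    ∀ r : ℝ, 0 < r → r < 1 / 8 →
    ∃ C : ℝ, 0 < C ∧
    ∀ μ : ℝ, 0 < μ →
    ∀ J : Set E2, FinSegUnion J → J ⊆ Qsq μ →
      ENNReal.ofReal (μ * θ ^ 2) ≤ μH[1] J →
      μH[1] J ≤ ENNReal.ofReal (2 * Real.sqrt 2 * μ / θ ^ 2) →
      ∃ (m : ℕ) (P : Fin m → Set E2) (𝒞 : Set DSq) (Z : Set E2) (I : ℕ),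
        (∀ j, IsOpen (P j)) ∧
        (∀ j, SimplyConnectedSpace ↥(P j)) ∧
        Pairwise (Function.onFun Disjoint P) ∧
        (∀ j, P j ⊆ Qsq μ) ∧
        volume (Qsq μ \ ⋃ j, P j) = 0 ∧
        μH[1] (⋃ j, frontier (P j)) ≤ ENNReal.ofReal C * μH[1] J ∧
        FinSegUnion (⋃ j, frontier (P j)) ∧
        (∀ Q ∈ 𝒞, 8 ≤ Q.idx) ∧
        (∀ Q₁ ∈ 𝒞, ∀ Q₂ ∈ 𝒞, Q₁ ≠ Q₂ → Disjoint (Q₁.core θ μ) (Q₂.core θ μ)) ∧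
        IsClosed Z ∧ Z ⊆ Qsq μ ∧
        (Z ⊆ ⋃ i ∈ Finset.Icc 8 I, isoU θ μ J r i) ∧
        -- (i)
        (Qsq μ \ (J ∩ ⋃ j, frontier (P j)) ⊆ ⋃ Q ∈ 𝒞, Q.enl θ μ (3 / 2)) ∧
        ((⋃ Q ∈ 𝒞, Q.enl θ μ (3 / 2)) ⊆ Qsq μ) ∧
        -- (ii)
        (∀ Q₁ ∈ 𝒞, ∀ Q₂ ∈ 𝒞, (Q₁.enl θ μ (3 / 2) ∩ Q₂.enl θ μ (3 / 2)).Nonempty →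
          θ * Metric.diam (Q₁.core θ μ) ≤ Metric.diam (Q₂.core θ μ) ∧
          Metric.diam (Q₂.core θ μ) ≤ θ⁻¹ * Metric.diam (Q₁.core θ μ)) ∧
        -- (iii)
        (∀ x ∈ Qsq μ, {Q ∈ 𝒞 | x ∈ Q.enl θ μ (3 / 2)}.Finite ∧
          {Q ∈ 𝒞 | x ∈ Q.enl θ μ (3 / 2)}.ncard ≤ 12) ∧
        -- (iv)
        (∀ Q ∈ 𝒞, ¬ Q.enl θ μ 3 ⊆ Z →
          μH[1] (J ∩ Q.enl θ μ (3 / 2)) ≤ ENNReal.ofReal (θ ^ 2 * (μ * θ ^ Q.idx))) ∧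
        -- (v)
        (∀ Q ∈ 𝒞, ∀ Qh ∈ 𝒞, (Qh.idx + 1 = Q.idx ∨ Qh.idx = Q.idx + 1) →
          (Q.enl θ μ 3 ∩ Qh.enl θ μ 3).Nonempty →
          μH[1] (J ∩ Q.enl θ μ (3 / 2)) ≤ ENNReal.ofReal (θ ^ 2 * (μ * θ ^ Q.idx))) ∧
        -- (vi)
        (∀ Q ∈ 𝒞, I + 1 ≤ Q.idx → J ∩ Q.enl θ μ (3 / 2) = ∅) := by
  refine ⟨1 / 128, by norm_num, fun n₀ θ hθ hθ' r hr _ => ?_⟩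
  have hθ0 : 0 < θ := by rw [hθ]; positivity
  have hn : 1 ≤ n₀ := by
    by_contra! h
    obtain rfl : n₀ = 0 := by omega
    norm_num [hθ] at hθ'
  refine ⟨partitionConst θ r, partitionConst_pos hθ0 hθ' hr, fun μ hμ J hJf hJ hJ1 _ => ?_⟩
  obtain ⟨E, I, hI, hbE, hEJ, hEc, hnull, hgap, hvis, hfin⟩ := exists_scale hθ0 hθ' hμ hJf
  have hanti : Antitone (keepSet θ μ r J E I) := antitone_chainSet
  have hKE (i : ℕ) : keepSet θ μ r J E I i ⊆ E := chainSet_subset i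
  have hb (i : ℕ) : bdry μ ⊆ keepSet θ μ r J E I i := bdry_subset_keepSet hbE i
  set K := keepSet θ μ r J E I (I + 1) with hK
  obtain ⟨hKf, hKj⟩ := hfin K (hKE _) fun y hy z hz hd =>
    mem_chainSet_of_dist_le (fun _ => Or.inl rfl) hy hz hd
  have hEs : E ⊆ cSq μ := hEJ.trans
    (union_subset (hJ.trans (Qsq_subset_cSq μ)) (bdry_subset_cSq μ))
  obtain ⟨Γ, hΓf, hΓs, hKΓ, hΓc, hΓm⟩ := exists_isPreconnected (r := r) (J := J) hθ0 hθ' hμ hr hI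
    hKf ((hKE _).trans hEs) (hb _)
    (fun i h8 hi y hy => reaches_of_mem_keepSet_succ hθ0 hμ hvis h8 hi
      (hanti (by omega : i + 1 ≤ I + 1) hy)) hKj
  obtain ⟨m, P, hPo, hPs, hPd, hPQ, hPv, hPf⟩ := exists_partition_of_isPreconnected hμ hΓf hΓs
    ((hb _).trans hKΓ) hΓc
  have hZ {Q : DSq} (hQ : Q ∈ heavyLeaves θ μ r n₀ J E I) :=
    exists_mem_of_mem_heavyLeaves hθ hθ' hμ hI hnull hgap hQ
  refine ⟨m, P, DSq.leaves θ μ n₀ (keepSet θ μ r J E I),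
    ⋃ Q ∈ heavyLeaves θ μ r n₀ J E I, closure (Q.enl θ μ 3), I, hPo, hPs, hPd, hPQ, hPv, ?_⟩
  rw [hPf]
  refine ⟨hΓm.trans (measure_le_partitionConst_mul hθ0 hθ' hμ hr ((hKE _).trans hEJ) hJ1), hΓf,
    fun Q hQ => hQ.1, fun Q₁ h₁ Q₂ h₂ hne => disjoint_left.2 fun x hx₁ hx₂ =>
      hne (DSq.eq_of_mem_leaves hθ hμ hanti h₁ h₂ hx₁ hx₂),
    isClosed_biUnion_heavyLeaves hθ hθ' hμ hI hnull hgap, ?_, ?_, ?_, ?_, ?_, ?_, ?_, ?_, ?_⟩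
  · exact iUnion₂_subset fun Q hQ => (Q.closure_enl_subset hθ0 hμ (by norm_num)
      (by norm_num)).trans (DSq.enl_subset_Qsq_of_mem_leaves hθ0 hμ hb hQ.1)
  · refine iUnion₂_subset fun Q hQ => ?_
    obtain ⟨h8, hQI, hbad, -, hiso⟩ := hZ hQ
    exact (closure_enl_subset_isoU hθ0 hμ hbad hiso).trans
      (subset_biUnion_of_mem (u := isoU θ μ J r) (Finset.mem_Icc.2 ⟨h8, hQI⟩))
  · rintro x ⟨hx, hxJ⟩
    have hxK : x ∉ K := by
      intro h
      rcases hEJ (hKE _ h) with h' | h'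
      · exact hxJ ⟨h', hKΓ h⟩
      · rw [← cSq_diff_bdry] at hx
        exact hx.2 h'
    obtain ⟨Q, hQ, hxQ⟩ := DSq.exists_mem_leaves hθ hn hμ hKf.isCompact.isClosed
      (fun i (hi : I + 1 ≤ i) => chainSet_of_lt hi) hx hxK
    exact mem_iUnion₂.2 ⟨Q, hQ, hxQ⟩
  · exact iUnion₂_subset fun Q hQ => (Q.enl_mono hθ0 hμ (by norm_num)).trans
      (DSq.enl_subset_Qsq_of_mem_leaves hθ0 hμ hb hQ)
  · intro Q₁ h₁ Q₂ h₂ hne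
    refine ⟨DSq.diam_core_le hθ hθ' hμ hanti h₁ h₂ hne, ?_⟩
    rw [inv_mul_eq_div, le_div_iff₀' hθ0]
    exact DSq.diam_core_le hθ hθ' hμ hanti h₂ h₁ (by rwa [inter_comm])
  · intro x _
    obtain ⟨h1, h2⟩ := DSq.finite_leaves_inter hθ hθ' hμ hanti x
    exact ⟨h1, h2.trans (by norm_num)⟩
  · intro Q hQ hQZ
    by_contra! h
    exact hQZ (subset_closure.trans
      (subset_biUnion_of_mem (u := fun Q : DSq => closure (Q.enl θ μ 3))
        (show Q ∈ heavyLeaves θ μ r n₀ J E I from ⟨hQ, h⟩)))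
  · exact fun Q hQ Qh hQh => measure_inter_enl_le_of_adjacent hθ hθ' hμ hI hnull hgap hQ hQh
  · exact fun Q hQ => inter_enl_eq_empty_of_lt hθ hθ' hμ hI hgap hQ
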